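/- For all integers q ≥ 3, the Euler totient function satisfies φ(q) > q / (e^γ log log q + 3/ log log q), where γ is the Euler–Mascheroni constant; in particular φ(q) ≳ q / log log q. -/

import Mathlib

open Filter Topology Metric Set

theorem H_order_ne_top {G : ℂ → ℂ} (hG : Differentiable ℂ G) (s : ℂ) (hs : G s ≠ 0) (z : ℂ) :
    analyticOrderAt G z ≠ ⊤ := by
  have h1 : AnalyticOnNhd ℂ G univ := fun z _ => hG.analyticAt z
  refine h1.analyticOrderAt_ne_top_of_isPreconnected isPreconnected_univ (mem_univ s) (mem_univ z) ?_
  rw [(hG.analyticAt s).analyticOrderAt_eq_zero.mpr hs]; simp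

theorem H_fact1 {G : ℂ → ℂ} (hG : Differentiable ℂ G) (s : ℂ) (hs : G s ≠ 0) (z : ℂ) :
    ∃ g : ℂ → ℂ, Differentiable ℂ g ∧ g z ≠ 0 ∧ ∀ w, G w = (w - z) ^ (analyticOrderNatAt G z) * g w := by
  have h0 := (Nat.cast_analyticOrderNatAt (H_order_ne_top hG s hs z)).symm
  set n := analyticOrderNatAt G z
  obtain ⟨g0, hg0, hne, hev⟩ := (hG.analyticAt z).analyticOrderAt_eq_natCast.mp h0
  classical
  refine ⟨fun w => if w = z then g0 z else G w / (w - z) ^ n, ?_, by simpa using hne, ?_⟩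
  · intro w
    by_cases hw : w = z
    · subst hw
      refine hg0.differentiableAt.congr_of_eventuallyEq ?_
      filter_upwards [hev] with y hy
      by_cases hyw : y = w
      · simp [hyw]
      · have : (y - w) ^ n ≠ 0 := pow_ne_zero _ (sub_ne_zero.mpr hyw)
        simp only [hyw, if_false]
        rw [hy, smul_eq_mul]; field_simp
    · have : (w - z) ^ n ≠ 0 := pow_ne_zero _ (sub_ne_zero.mpr hw)
      have hd : DifferentiableAt ℂ (fun w => G w / (w - z) ^ n) w :=
        (hG w).div (by fun_prop) this
      refine hd.congr_of_eventuallyEq ?_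
      filter_upwards [isOpen_ne.mem_nhds hw] with y hy
      have hy' : y ≠ z := hy
      simp [hy']
  · intro w
    by_cases hw : w = z
    · subst hw
      have := hev.self_of_nhds
      simpa using this
    · have : (w - z) ^ n ≠ 0 := pow_ne_zero _ (sub_ne_zero.mpr hw)
      simp only [hw, if_false]; field_simp

theorem H_factS {G : ℂ → ℂ} (hG : Differentiable ℂ G) (s : ℂ) (hs : G s ≠ 0) (S : Finset ℂ) :
    ∃ g : ℂ → ℂ, Differentiable ℂ g ∧ (∀ z ∈ S, g z ≠ 0) ∧
      ∀ w, G w = (∏ z ∈ S, (w - z) ^ (analyticOrderNatAt G z)) * g w := by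
  classical
  induction S using Finset.induction_on with
  | empty => exact ⟨G, hG, by simp, by simp⟩
  | insert z S hz ih =>
    obtain ⟨g, hg, hgS, hGg⟩ := ih
    have hgs : g s ≠ 0 := by
      intro h; apply hs; rw [hGg, h, mul_zero]
    obtain ⟨g2, hg2, hg2z, hgg2⟩ := H_fact1 hg s hgs z
    have hP : Differentiable ℂ (fun w : ℂ => ∏ z ∈ S, (w - z) ^ (analyticOrderNatAt G z)) := by
      fun_prop
    have hPz : (∏ z' ∈ S, (z - z') ^ (analyticOrderNatAt G z')) ≠ 0 := by
      rw [Finset.prod_ne_zero_iff]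
      intro a ha
      apply pow_ne_zero; rw [sub_ne_zero]; rintro rfl; exact hz ha
    have ho : analyticOrderNatAt G z = analyticOrderNatAt g z := by
      have e : G = (fun w : ℂ => ∏ z ∈ S, (w - z) ^ (analyticOrderNatAt G z)) * g := by
        ext w; rw [Pi.mul_apply]; exact hGg w
      have hP0 : analyticOrderAt (fun w : ℂ => ∏ z ∈ S, (w - z) ^ (analyticOrderNatAt G z)) z = 0 :=
        (hP.analyticAt z).analyticOrderAt_eq_zero.mpr hPz
      have := analyticOrderNatAt_mul (hP.analyticAt z) (hg.analyticAt z) (by rw [hP0]; simp)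
        (H_order_ne_top hg s hgs z)
      rw [← e] at this
      rw [this]
      have : analyticOrderNatAt (fun w : ℂ => ∏ z ∈ S, (w - z) ^ (analyticOrderNatAt G z)) z = 0 := by
        rw [analyticOrderNatAt, hP0]; rfl
      omega
    refine ⟨g2, hg2, ?_, ?_⟩
    · intro y hy
      rcases Finset.mem_insert.mp hy with rfl | hy
      · exact hg2z
      · intro h
        apply hgS y hy
        rw [hgg2, h, mul_zero]
    · intro w
      rw [Finset.prod_insert hz, hGg w, hgg2 w, ho]; ring

theorem H_finite {G : ℂ → ℂ} (hG : Differentiable ℂ G) (s : ℂ) (hs : G s ≠ 0) (R : ℝ) :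
    {z | G z = 0 ∧ ‖z‖ ≤ R}.Finite := by
  have h1 : AnalyticOnNhd ℂ G univ := fun z _ => hG.analyticAt z
  have h2 := h1.preimage_zero_mem_codiscrete hs
  have h3 := (isCompact_closedBall (0:ℂ) R).finite_sdiff_of_mem_codiscreteWithin
    (codiscreteWithin_mono (subset_univ _) h2)
  refine h3.subset ?_
  rintro z ⟨hz, hzR⟩
  simp [hz, hzR]

/-- main disc estimate -/
theorem H_disc {G : ℂ → ℂ} (hG : Differentiable ℂ G) (h0 : G 0 = 1) (R B : ℝ) (hR : 0 < R) (hB : 0 < B)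
    (hb : ∀ w, ‖w‖ = R → ‖G w‖ ≤ Real.exp B) (Z : Finset ℂ) (hZ : ∀ z, z ∈ Z ↔ (G z = 0 ∧ ‖z‖ ≤ R)) :
    (∏ z ∈ Z, (R / ‖z‖) ^ (analyticOrderNatAt G z) ≤ Real.exp B) ∧
    ∀ s, ‖s‖ ≤ R / 4 → G s ≠ 0 →
      ‖deriv G s / G s - ∑ z ∈ Z, (analyticOrderNatAt G z : ℂ) * (1 / (s - z))‖ ≤
        8 * B / R + (∑ z ∈ Z, (analyticOrderNatAt G z : ℝ)) * (2 / R) := by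
  obtain ⟨g, hg, hgZ, hGg⟩ := H_factS hG 0 (by simp [h0]) Z
  set m := analyticOrderNatAt G with hm
  set h : ℂ → ℂ := fun w => (∏ z ∈ Z, (((R:ℂ)^2 - (starRingEnd ℂ) z * w) / R) ^ m z) * g w with hh
  have hRc : (R:ℂ) ≠ 0 := by exact_mod_cast hR.ne'
  have hhd : Differentiable ℂ h := by fun_prop
  have hfac : ∀ z ∈ Z, ∀ w, ‖w‖ < R → ((R:ℂ)^2 - (starRingEnd ℂ) z * w) ≠ 0 := by
    intro z hz w hw he
    have hz' := ((hZ z).mp hz).2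
    have : (R:ℂ)^2 = (starRingEnd ℂ) z * w := by linear_combination he
    have h2 := congrArg norm this
    rw [norm_pow, norm_mul, RCLike.norm_conj, Complex.norm_real, Real.norm_of_nonneg hR.le] at h2
    nlinarith [norm_nonneg w, norm_nonneg z]
  have hg0 : ∀ w, ‖w‖ < R → g w ≠ 0 := by
    intro w hw hgw
    have : w ∈ Z := (hZ w).mpr ⟨by rw [hGg, hgw, mul_zero], hw.le⟩
    exact hgZ w this hgw
  have hh0 : ∀ w, ‖w‖ < R → h w ≠ 0 := by
    intro w hw
    refine mul_ne_zero ?_ (hg0 w hw)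
    rw [Finset.prod_ne_zero_iff]
    intro z hz
    exact pow_ne_zero _ (div_ne_zero (hfac z hz w hw) hRc)
  have hcirc : ∀ w, ‖w‖ = R → ‖h w‖ ≤ Real.exp B := by
    intro w hw
    refine le_trans (le_of_eq ?_) (hb w hw)
    rw [hGg w, hh]
    simp only [norm_mul, norm_prod, norm_pow]
    congr 1
    refine Finset.prod_congr rfl fun z hz => ?_
    congr 1
    have e : (R:ℂ)^2 = w * (starRingEnd ℂ) w := by
      rw [Complex.mul_conj, Complex.normSq_eq_norm_sq, hw]; push_cast; ring
    have : ((R:ℂ)^2 - (starRingEnd ℂ) z * w) = w * (starRingEnd ℂ) (w - z) := by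
      rw [e, map_sub]; ring
    rw [this, norm_div, norm_mul, RCLike.norm_conj, hw, Complex.norm_real, Real.norm_of_nonneg hR.le]
    field_simp
  have hhB : ∀ w, ‖w‖ ≤ R → ‖h w‖ ≤ Real.exp B := by
    intro w hw
    refine Complex.norm_le_of_forall_mem_frontier_norm_le (U := ball 0 R) isBounded_ball hhd.diffContOnCl ?_ ?_
    · intro z hz
      rw [frontier_ball _ hR.ne'] at hz
      exact hcirc z (by simpa using hz)
    · rw [closure_ball _ hR.ne']; simpa using hw
  have hz0 : ∀ z ∈ Z, z ≠ 0 := by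
    rintro z hz rfl
    have := ((hZ 0).mp hz).1
    rw [h0] at this; exact one_ne_zero this
  have hn0 : ‖h 0‖ = ∏ z ∈ Z, (R / ‖z‖) ^ m z := by
    have e1 : (∏ z ∈ Z, ‖z‖ ^ m z) * ‖g 0‖ = 1 := by
      have := congrArg norm (hGg 0)
      simpa [h0] using this.symm
    have e2 : ‖h 0‖ = (∏ z ∈ Z, R ^ m z) * ‖g 0‖ := by
      rw [hh]
      simp only [norm_mul, norm_prod, norm_pow, mul_zero, sub_zero]
      congr 1
      refine Finset.prod_congr rfl fun z hz => ?_
      rw [norm_div, norm_pow, Complex.norm_real, Real.norm_of_nonneg hR.le]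
      congr 1; field_simp
    have e3 : (∏ z ∈ Z, ‖z‖ ^ m z) ≠ 0 := by
      rw [Finset.prod_ne_zero_iff]; intro z hz; exact pow_ne_zero _ (norm_ne_zero_iff.mpr (hz0 z hz))
    simp only [div_pow, Finset.prod_div_distrib]
    rw [e2]; field_simp; linear_combination e1
  refine ⟨hn0 ▸ hhB 0 (by simpa using hR.le), ?_⟩
  have hn1 : 1 ≤ ‖h 0‖ := by
    rw [hn0]
    calc (1:ℝ) = ∏ z ∈ Z, 1 := by simp
      _ ≤ _ := by
        refine Finset.prod_le_prod (fun _ _ => zero_le_one) fun z hz => ?_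
        apply one_le_pow₀
        rw [le_div_iff₀ (norm_pos_iff.mpr (hz0 z hz)), one_mul]
        exact ((hZ z).mp hz).2
  intro s hs hGs
  have hsR : ‖s‖ < R := by linarith
  -- log derivative of h
  have hld : DifferentiableOn ℂ (fun w => deriv h w / h w) (ball 0 R) := by
    intro w hw
    have hw' : ‖w‖ < R := by simpa using hw
    exact ((hhd.deriv w).div (hhd w) (hh0 w hw')).differentiableWithinAt
  obtain ⟨H0, hH0⟩ := hld.isExactOn_ball
  set H : ℂ → ℂ := fun w => H0 w - H0 0 with hHdef
  have hH : ∀ w ∈ ball (0:ℂ) R, HasDerivAt H (deriv h w / h w) w := fun w hw => (hH0 w hw).sub_const _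
  have hconst : ∀ w ∈ ball (0:ℂ) R, h w = h 0 * Complex.exp (H w) := by
    have hk : ∀ w ∈ ball (0:ℂ) R, HasDerivAt (fun w => h w * Complex.exp (- H w)) 0 w := by
      intro w hw
      have hw' : ‖w‖ < R := by simpa using hw
      have := hh0 w hw'
      refine HasDerivAt.congr_deriv ((hhd w).hasDerivAt.mul ((hH w hw).neg.cexp)) ?_
      simp only [Pi.neg_apply]
      field_simp
      ring
    intro w hw
    have := isOpen_ball.is_const_of_deriv_eq_zero (convex_ball (0:ℂ) R).isPreconnected
      (fun w hw => (hk w hw).differentiableAt.differentiableWithinAt) (fun w hw => (hk w hw).deriv)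
      hw (mem_ball_self hR)
    simp only [hHdef, sub_self, neg_zero, Complex.exp_zero, mul_one] at this
    rw [← this, mul_assoc, ← Complex.exp_add]; simp [hHdef]
  have hRe : MapsTo H (ball 0 R) {z | z.re ≤ B} := by
    intro w hw
    have hw' : ‖w‖ < R := by simpa using hw
    have h1 := hhB w hw'.le
    rw [hconst w hw, norm_mul, Complex.norm_exp] at h1
    have : Real.exp (H w).re ≤ Real.exp B := by
      refine le_trans ?_ h1
      nlinarith [Real.exp_pos (H w).re]
    exact Real.exp_le_exp.mp this
  have hBC : ∀ w, ‖w‖ ≤ R / 2 → ‖H w‖ ≤ 2 * B := by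
    intro w hw
    have := Complex.borelCaratheodory_zero hB
      (fun w hw => (hH w hw).differentiableAt.differentiableWithinAt) hRe hR
      (z := w) (by simp; linarith) (by simp [hHdef])
    refine this.trans ?_
    rw [div_le_iff₀ (by linarith)]
    nlinarith
  have hder : ‖deriv h s / h s‖ ≤ 8 * B / R := by
    have hsb : s ∈ ball (0:ℂ) R := by simpa using hsR
    rw [← (hH s hsb).deriv]
    have hsub : closedBall s (R/4) ⊆ closedBall 0 (R/2) := by
      intro y hy
      simp only [mem_closedBall, dist_eq_norm, sub_zero] at hy ⊢
      calc ‖y‖ = ‖(y - s) + s‖ := by ring_nf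
        _ ≤ ‖y - s‖ + ‖s‖ := norm_add_le _ _
        _ ≤ R/2 := by linarith
    have := Complex.norm_deriv_le_of_forall_mem_sphere_norm_le (c := s) (R := R/4) (C := 2*B) (f := H) (by linarith)
      (by
        apply DifferentiableOn.diffContOnCl
        rw [closure_ball _ (by positivity)]
        intro y hy
        have := hsub hy
        simp only [mem_closedBall, dist_eq_norm, sub_zero] at this
        exact (hH y (by simp; linarith)).differentiableAt.differentiableWithinAt)
      (fun z hz => hBC z (by simpa using hsub (sphere_subset_closedBall hz)))
    refine this.trans (le_of_eq ?_)
    field_simp; ring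
  -- decompose
  have hsz : ∀ z ∈ Z, s - z ≠ 0 := by
    intro z hz he
    have : s = z := by linear_combination he
    exact hGs (this ▸ ((hZ z).mp hz).1)
  have lG : deriv G s / G s = ∑ z ∈ Z, (m z : ℂ) * (1 / (s - z)) + logDeriv g s := by
    have e : G = fun w => (∏ z ∈ Z, (w - z) ^ (m z)) * g w := by ext w; exact hGg w
    have : deriv G s / G s = logDeriv G s := rfl
    rw [this]
    nth_rewrite 1 [e]
    rw [logDeriv_mul s (by rw [Finset.prod_ne_zero_iff]; intro z hz; exact pow_ne_zero _ (hsz z hz)) (hg0 s hsR)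
      (by fun_prop) (hg s), logDeriv_prod (f := fun z w => (w - z) ^ m z) (fun z hz => pow_ne_zero _ (hsz z hz)) (fun z hz => by fun_prop)]
    congr 1
    refine Finset.sum_congr rfl fun z hz => ?_
    rw [logDeriv_fun_pow (by fun_prop)]
    simp [logDeriv_apply]
  have lh : deriv h s / h s = ∑ z ∈ Z, (m z : ℂ) * (-(starRingEnd ℂ) z / ((R:ℂ)^2 - (starRingEnd ℂ) z * s)) + logDeriv g s := by
    have : deriv h s / h s = logDeriv h s := rfl
    rw [this, hh]
    have hn : ∀ z ∈ Z, ((R:ℂ)^2 - (starRingEnd ℂ) z * s) / R ≠ 0 := fun z hz => div_ne_zero (hfac z hz s hsR) hRc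
    rw [logDeriv_mul s (by rw [Finset.prod_ne_zero_iff]; intro z hz; exact pow_ne_zero _ (hn z hz)) (hg0 s hsR)
      (by fun_prop) (hg s), logDeriv_prod (f := fun z w => (((R:ℂ)^2 - (starRingEnd ℂ) z * w) / R) ^ m z) (fun z hz => pow_ne_zero _ (hn z hz)) (fun z hz => by fun_prop)]
    congr 1
    refine Finset.sum_congr rfl fun z hz => ?_
    rw [logDeriv_fun_pow (by fun_prop)]
    have hd : HasDerivAt (fun w : ℂ => ((R:ℂ)^2 - (starRingEnd ℂ) z * w) / R) ((-(starRingEnd ℂ z * 1))/R) s :=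
      (((hasDerivAt_id s).const_mul _).const_sub _).div_const _
    rw [logDeriv_apply, hd.deriv]
    have := hfac z hz s hsR
    field_simp
  have key : deriv G s / G s - ∑ z ∈ Z, (m z : ℂ) * (1 / (s - z)) = deriv h s / h s -
      ∑ z ∈ Z, (m z : ℂ) * (-(starRingEnd ℂ) z / ((R:ℂ)^2 - (starRingEnd ℂ) z * s)) := by
    rw [lG, lh]; ring
  rw [key]
  refine (norm_sub_le _ _).trans (add_le_add hder ?_)
  refine (norm_sum_le _ _).trans ?_
  rw [Finset.sum_mul]
  refine Finset.sum_le_sum fun z hz => ?_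
  rw [norm_mul, Complex.norm_natCast]
  refine mul_le_mul_of_nonneg_left ?_ (Nat.cast_nonneg _)
  rw [norm_div, norm_neg, RCLike.norm_conj]
  have hz' := ((hZ z).mp hz).2
  have : R^2 - R * (R/4) ≤ ‖(R:ℂ)^2 - (starRingEnd ℂ) z * s‖ := by
    have h1 := norm_sub_norm_le ((R:ℂ)^2) ((starRingEnd ℂ) z * s)
    rw [norm_pow, Complex.norm_real, Real.norm_of_nonneg hR.le, norm_mul, RCLike.norm_conj] at h1
    have : ‖z‖ * ‖s‖ ≤ R * (R/4) := mul_le_mul hz' hs (norm_nonneg _) hR.le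
    linarith
  rw [div_le_div_iff₀ (by nlinarith) hR]
  nlinarith

theorem H_count {G : ℂ → ℂ} (hG : Differentiable ℂ G) (h0 : G 0 = 1) (R B : ℝ) (hR : 0 < R) (hB : 0 < B)
    (hb : ∀ w, ‖w‖ = 3 * R → ‖G w‖ ≤ Real.exp B) (Z : Finset ℂ) (hZ : ∀ z, z ∈ Z ↔ (G z = 0 ∧ ‖z‖ ≤ R)) :
    (∑ z ∈ Z, (analyticOrderNatAt G z : ℝ)) ≤ B := by
  have hfin := H_finite hG 0 (by simp [h0]) (3 * R)
  have hZ3 : ∀ z, z ∈ hfin.toFinset ↔ (G z = 0 ∧ ‖z‖ ≤ 3 * R) := by intro z; rw [Set.Finite.mem_toFinset]; rfl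
  have h1 := (H_disc hG h0 (3*R) B (by linarith) hB hb _ hZ3).1
  have hz0 : ∀ z, G z = 0 → z ≠ 0 := by
    rintro z hz rfl
    rw [h0] at hz; exact one_ne_zero hz
  have h2 : Real.exp (∑ z ∈ Z, (analyticOrderNatAt G z : ℝ)) ≤
      ∏ z ∈ hfin.toFinset, (3 * R / ‖z‖) ^ (analyticOrderNatAt G z) := by
    rw [Real.exp_sum]
    have hsub : Z ⊆ hfin.toFinset := by
      intro z hz; rw [hZ3]; have := (hZ z).mp hz; exact ⟨this.1, by linarith [this.2]⟩
    have hle : ∏ z ∈ Z, (3 * R / ‖z‖) ^ (analyticOrderNatAt G z) ≤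
        ∏ z ∈ hfin.toFinset, (3 * R / ‖z‖) ^ (analyticOrderNatAt G z) := by
      rw [← Finset.prod_sdiff hsub]
      refine le_mul_of_one_le_left (Finset.prod_nonneg fun z hz => by positivity) ?_
      rw [← Finset.prod_const_one (s := hfin.toFinset \ Z)]
      refine Finset.prod_le_prod (fun _ _ => zero_le_one) fun z hz => ?_
      have := (hZ3 z).mp (Finset.mem_sdiff.mp hz).1
      apply one_le_pow₀
      rw [le_div_iff₀ (norm_pos_iff.mpr (hz0 z this.1)), one_mul]
      exact this.2
    refine le_trans ?_ hle
    · refine Finset.prod_le_prod (fun _ _ => (Real.exp_pos _).le) fun z hz => ?_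
      have := (hZ z).mp hz
      rw [← Real.exp_one_pow]
      refine pow_le_pow_left₀ (Real.exp_pos _).le ?_ _
      rw [le_div_iff₀ (norm_pos_iff.mpr (hz0 z this.1))]
      have h3 : Real.exp 1 ≤ 3 := by linarith [Real.exp_one_lt_d9]
      calc Real.exp 1 * ‖z‖ ≤ 3 * ‖z‖ := by gcongr
        _ ≤ 3 * R := by linarith [this.2]
  exact Real.exp_le_exp.mp (h2.trans h1)

theorem hadamard0 {G : ℂ → ℂ} (hG : Differentiable ℂ G) (h0 : G 0 = 1) (C : ℝ) (hC : 0 < C)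
    (hb : ∀ w, ‖G w‖ ≤ Real.exp (C * (1 + ‖w‖) ^ (3/4 : ℝ))) (s0 : ℂ) (hs0 : G s0 ≠ 0) (K : ℝ) (hK : 0 ≤ K)
    (hre : ∀ z, G z = 0 → ‖1 / (s0 - z)‖ ≤ K * (1 / (s0 - z)).re) :
    ∃ (ι : Type) (w : ι → ℂ), (∀ i, G (w i) = 0) ∧ Summable (fun i => ‖1 / (s0 - w i)‖) ∧
      (∀ s, G s ≠ 0 → Summable (fun i => ‖1 / (s - w i)‖)) ∧
      ∀ s, G s ≠ 0 → HasSum (fun i => 1 / (s - w i)) (deriv G s / G s) := by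
  set m := analyticOrderNatAt G with hm
  have hfin := fun R => H_finite hG 0 (by simp [h0]) R
  let Z : ℝ → Finset ℂ := fun R => (hfin R).toFinset
  have hZ : ∀ R z, z ∈ Z R ↔ (G z = 0 ∧ ‖z‖ ≤ R) := by intro R z; rw [Set.Finite.mem_toFinset]; rfl
  have hB0 : ∀ R : ℝ, 0 < R → 0 < C * (1 + R) ^ (3/4:ℝ) := fun R hR => by positivity
  -- error bound
  have herr : ∀ s, G s ≠ 0 → Tendsto (fun R : ℝ => ∑ z ∈ Z R, (m z : ℂ) * (1 / (s - z))) atTop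
      (𝓝 (deriv G s / G s)) := by
    intro s hs
    rw [tendsto_iff_norm_sub_tendsto_zero]
    have hlim : Tendsto (fun R : ℝ => 8 * (C * (1 + R) ^ (3/4:ℝ)) / R + (C * (1 + 3 * R) ^ (3/4:ℝ)) * (2 / R)) atTop (𝓝 0) := by
      have hu : Tendsto (fun R : ℝ => (8 * C * (2:ℝ)^(3/4:ℝ) + 2 * C * 4 ^ (3/4:ℝ)) * R ^ (-(1/4:ℝ))) atTop (𝓝 0) := by
        have := (tendsto_rpow_neg_atTop (y := 1/4) (by norm_num)).const_mul (8 * C * (2:ℝ)^(3/4:ℝ) + 2 * C * 4 ^ (3/4:ℝ))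
        simpa using this
      refine squeeze_zero' ?_ ?_ hu
      · filter_upwards [eventually_gt_atTop 0] with R hR; positivity
      · filter_upwards [eventually_ge_atTop 1] with R hR
        have hR0 : (0:ℝ) < R := by linarith
        have e1 : (1 + R) ^ (3/4:ℝ) ≤ 2 ^ (3/4:ℝ) * R ^ (3/4:ℝ) := by
          rw [← Real.mul_rpow (by norm_num) hR0.le]
          exact Real.rpow_le_rpow (by linarith) (by linarith) (by norm_num)
        have e2 : (1 + 3*R) ^ (3/4:ℝ) ≤ 4 ^ (3/4:ℝ) * R ^ (3/4:ℝ) := by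
          rw [← Real.mul_rpow (by norm_num) hR0.le]
          exact Real.rpow_le_rpow (by linarith) (by linarith) (by norm_num)
        have e3 : R ^ (-(1/4:ℝ)) = R ^ (3/4:ℝ) / R := by
          rw [← Real.rpow_sub_one hR0.ne']; norm_num
        rw [e3]
        calc _ ≤ 8 * (C * (2 ^ (3/4:ℝ) * R ^ (3/4:ℝ))) / R + (C * (4 ^ (3/4:ℝ) * R ^ (3/4:ℝ))) * (2 / R) := by gcongr
          _ = _ := by ring
    refine squeeze_zero' (Eventually.of_forall fun _ => norm_nonneg _) ?_ hlim
    filter_upwards [eventually_gt_atTop 0, eventually_ge_atTop (4 * ‖s‖)] with R hR hRs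
    have h1 := (H_disc hG h0 R _ hR (hB0 R hR) (fun w hw => by rw [← hw]; exact hb w) (Z R) (hZ R)).2 s (by linarith) hs
    have h2 := H_count hG h0 R _ hR (hB0 (3*R) (by linarith)) (fun w hw => by rw [← hw]; exact hb w) (Z R) (hZ R)
    rw [norm_sub_rev]
    refine h1.trans ?_
    gcongr
  let ι := (z : ℂ) × Fin (m z)
  let T : ℝ → Finset ι := fun R => (Z R).sigma fun _ => Finset.univ
  have hT : ∀ R s, ∑ i ∈ T R, 1 / (s - i.1) = ∑ z ∈ Z R, (m z : ℂ) * (1 / (s - z)) := by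
    intro R s
    rw [Finset.sum_sigma]
    refine Finset.sum_congr rfl fun z hz => ?_
    simp
  have hw : ∀ i : ι, G i.1 = 0 := by
    rintro ⟨z, j⟩
    apply apply_eq_zero_of_analyticOrderNatAt_ne_zero
    intro h
    have := j.2
    simp only [hm, h] at this
    omega
  have hmem : ∀ (i : ι) R, ‖i.1‖ ≤ R → i ∈ T R := by
    intro i R h
    exact Finset.mem_sigma.mpr ⟨(hZ R _).mpr ⟨hw i, h⟩, Finset.mem_univ _⟩
  have hTtop : Tendsto T atTop atTop := by
    refine tendsto_atTop_finset_of_monotone ?_ fun i => ⟨_, hmem i _ le_rfl⟩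
    intro R R' h i hi
    exact hmem i _ (((hZ R _).mp (Finset.mem_sigma.mp hi).1).2.trans h)
  have hsum0 : Summable (fun i : ι => ‖1 / (s0 - i.1)‖) := by
    have hev := (herr s0 hs0).norm.eventually_le_const (show ‖deriv G s0 / G s0‖ < ‖deriv G s0 / G s0‖ + 1 by linarith)
    refine summable_of_sum_le (c := K * (‖deriv G s0 / G s0‖ + 1)) (fun _ => norm_nonneg _) ?_
    intro u
    obtain ⟨R, hR1, hR2⟩ := (hev.and (hTtop.eventually_ge_atTop u)).exists
    have hnn : ∀ i : ι, 0 ≤ K * (1 / (s0 - i.1)).re := fun i => (norm_nonneg _).trans (hre _ (hw i))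
    calc ∑ i ∈ u, ‖1 / (s0 - i.1)‖ ≤ ∑ i ∈ u, K * (1 / (s0 - i.1)).re := Finset.sum_le_sum fun i _ => hre _ (hw i)
      _ ≤ ∑ i ∈ T R, K * (1 / (s0 - i.1)).re := Finset.sum_le_sum_of_subset_of_nonneg hR2 fun i _ _ => hnn i
      _ = K * (∑ i ∈ T R, 1 / (s0 - i.1)).re := by rw [← Finset.mul_sum, Complex.re_sum]
      _ ≤ K * (‖deriv G s0 / G s0‖ + 1) := by
        refine mul_le_mul_of_nonneg_left ?_ hK
        rw [hT]
        exact (Complex.re_le_norm _).trans hR1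
  have hsum : ∀ s, G s ≠ 0 → Summable (fun i : ι => ‖1 / (s - i.1)‖) := by
    intro s hs
    refine Summable.of_norm_bounded_eventually (hsum0.mul_left 2) ?_
    have := hsum0.tendsto_cofinite_zero.eventually_lt_const (show (0:ℝ) < 1 / (2 * ‖s - s0‖ + 1) by positivity)
    filter_upwards [this] with i hi
    have hne : s0 - i.1 ≠ 0 := by
      intro h
      apply hs0
      have : s0 = i.1 := by linear_combination h
      rw [this]; exact hw i
    have hpos : 0 < ‖s0 - i.1‖ := norm_pos_iff.mpr hne
    rw [norm_div, norm_one, div_lt_div_iff₀ hpos (by positivity)] at hi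
    have htri : ‖s0 - i.1‖ ≤ ‖s - i.1‖ + ‖s - s0‖ := by
      have : s0 - i.1 = (s - i.1) - (s - s0) := by ring
      rw [this]; exact norm_sub_le _ _
    rw [norm_norm, norm_div, norm_div, norm_one]
    rw [mul_one_div, div_le_div_iff₀ (by linarith [norm_nonneg (s - s0)]) hpos]
    linarith
  refine ⟨ι, fun i => i.1, hw, hsum0, hsum, fun s hs => ?_⟩
  have h1 := (hsum s hs).of_norm.hasSum
  have h2 : Tendsto (fun R => ∑ i ∈ T R, 1 / (s - i.1)) atTop (𝓝 (∑' i : ι, 1 / (s - i.1))) := h1.comp hTtop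
  have h3 := herr s hs
  simp only [← hT] at h3
  rwa [tendsto_nhds_unique h2 h3] at h1


noncomputable def xi (s : ℂ) : ℂ := 1 + s * (s - 1) * completedRiemannZeta₀ s

theorem xi_diff : Differentiable ℂ xi := by
  have := differentiable_completedZeta₀
  unfold xi; fun_prop

theorem xi_symm (s : ℂ) : xi (1 - s) = xi s := by
  unfold xi; rw [completedRiemannZeta₀_one_sub]; ring

theorem xi_one : xi 1 = 1 := by simp [xi]
theorem xi_zero : xi 0 = 1 := by simp [xi]

theorem xi_eq {s : ℂ} (h0 : 0 < s.re) (h1 : s ≠ 1) : xi s = s * (s - 1) * (Complex.Gammaℝ s * riemannZeta s) := by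
  have h2 : (1 - s) ≠ 0 := sub_ne_zero.mpr h1.symm
  have h0' : s ≠ 0 := by rintro rfl; simp at h0
  have hz := riemannZeta_def_of_ne_zero h0'
  have hG := Complex.Gammaℝ_ne_zero_of_re_pos h0
  have : Complex.Gammaℝ s * riemannZeta s = completedRiemannZeta s := by
    rw [hz]; field_simp
  rw [this, completedRiemannZeta_eq, xi]
  field_simp; ring

theorem xi_ne_zero_of_one_le {s : ℂ} (h : 1 ≤ s.re) : xi s ≠ 0 := by
  by_cases h1 : s = 1
  · rw [h1, xi_one]; exact one_ne_zero
  · have h0 : 0 < s.re := by linarith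
    rw [xi_eq h0 h1]
    have h0' : s ≠ 0 := by rintro rfl; simp at h0
    exact mul_ne_zero (mul_ne_zero h0' (sub_ne_zero.mpr h1))
      (mul_ne_zero (Complex.Gammaℝ_ne_zero_of_re_pos h0) (riemannZeta_ne_zero_of_one_le_re h))

theorem xi_zero_re {s : ℂ} (h : xi s = 0) : 0 < s.re ∧ s.re < 1 := by
  constructor
  · by_contra h1
    rw [not_lt] at h1
    refine xi_ne_zero_of_one_le (s := 1 - s) ?_ ?_
    · simp; linarith
    · rw [xi_symm, h]
  · by_contra h1
    rw [not_lt] at h1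
    exact xi_ne_zero_of_one_le h1 h

theorem Lam0_strip : ∃ M : ℝ, 0 < M ∧ ∀ s : ℂ, -1 ≤ s.re → s.re ≤ 2 → ‖completedRiemannZeta₀ s‖ ≤ M := by
  set P := HurwitzZeta.hurwitzEvenFEPair 0
  have hc : ∀ s : ℂ, MellinConvergent P.f_modif s := fun s =>
    (P.isStrongFEPair_toStrongFEPair.hasMellin s).1
  have hi : ∀ r : ℝ, MeasureTheory.IntegrableOn (fun t : ℝ => t ^ (r - 1) * ‖P.f_modif t‖) (Ioi 0) := by
    intro r
    have h0 : MeasureTheory.IntegrableOn (fun t : ℝ => ‖(t:ℂ) ^ ((r:ℂ) - 1) • P.f_modif t‖) (Ioi 0) := (hc (r:ℂ)).norm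
    refine h0.congr_fun ?_ measurableSet_Ioi
    intro t ht
    simp only [norm_smul]
    rw [Complex.norm_cpow_eq_rpow_re_of_pos ht]; simp
  set A := (∫ t in Ioi (0:ℝ), t ^ ((-1/2:ℝ) - 1) * ‖P.f_modif t‖) + (∫ t in Ioi (0:ℝ), t ^ ((1:ℝ) - 1) * ‖P.f_modif t‖)
  have hA : 0 ≤ A := by
    refine add_nonneg ?_ ?_ <;>
    · refine MeasureTheory.setIntegral_nonneg measurableSet_Ioi fun t ht => ?_
      have : (0:ℝ) < t := ht
      positivity
  refine ⟨A + 1, by linarith, fun s h1 h2 => ?_⟩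
  have e : completedRiemannZeta₀ s = mellin P.f_modif (s/2) / 2 := rfl
  rw [e, norm_div]
  have h3 : ‖mellin P.f_modif (s/2)‖ ≤ A := by
    rw [mellin]
    refine (MeasureTheory.norm_integral_le_integral_norm _).trans ?_
    simp only [A]
    rw [← MeasureTheory.integral_add (hi _) (hi _)]
    refine MeasureTheory.setIntegral_mono_on (hc _).norm ((hi _).add (hi _)) measurableSet_Ioi fun t ht => ?_
    have ht : (0:ℝ) < t := ht
    rw [norm_smul, Complex.norm_cpow_eq_rpow_re_of_pos ht, ← add_mul]
    refine mul_le_mul_of_nonneg_right ?_ (norm_nonneg _)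
    have e2 : (s / 2 - 1).re = s.re/2 - 1 := by simp
    rw [e2]
    rcases le_total 1 t with h | h
    · have := Real.rpow_le_rpow_of_exponent_le h (show s.re/2 - 1 ≤ (1:ℝ) - 1 by linarith)
      have := Real.rpow_nonneg ht.le ((-1/2:ℝ) - 1)
      linarith
    · have k1 := Real.rpow_le_rpow_of_exponent_ge ht h (show (-1/2:ℝ) - 1 ≤ s.re/2 - 1 by linarith)
      have k2 := Real.rpow_nonneg ht.le ((1:ℝ) - 1)
      exact k1.trans (le_add_of_nonneg_right k2)
  have : ‖(2:ℂ)‖ = 2 := by simp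
  rw [this]
  linarith [norm_nonneg (mellin P.f_modif (s/2))]

theorem norm_Gamma_le {s : ℂ} (hs : 0 < s.re) : ‖Complex.Gamma s‖ ≤ Real.Gamma s.re := by
  rw [Complex.Gamma_eq_integral hs, Complex.GammaIntegral, Real.Gamma_eq_integral hs]
  refine (MeasureTheory.norm_integral_le_integral_norm _).trans (le_of_eq ?_)
  refine MeasureTheory.setIntegral_congr_fun measurableSet_Ioi fun t ht => ?_
  have ht : (0:ℝ) < t := ht
  simp only [norm_mul]
  rw [Complex.norm_cpow_eq_rpow_re_of_pos ht, Complex.norm_real, Real.norm_of_nonneg (Real.exp_pos _).le]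
  simp

theorem xi_growth_right : ∃ C : ℝ, 0 < C ∧ ∀ v : ℂ, 3/2 ≤ v.re →
    ‖xi (1/2 + v)‖ ≤ Real.exp (C * (1 + ‖v‖^2) ^ (3/4:ℝ)) := by
  obtain ⟨Mz, hMz⟩ : ∃ Mz : ℝ, ∀ s : ℂ, 2 ≤ s.re → ‖riemannZeta s‖ ≤ Mz := by
    refine ⟨∑' n : ℕ, 1 / ((n:ℝ)+1)^2, fun s hs => ?_⟩
    rw [zeta_eq_tsum_one_div_nat_add_one_cpow (by linarith)]
    have hsum : Summable fun n : ℕ => 1 / ((n:ℝ)+1)^2 := by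
      have := (summable_nat_add_iff 1).mpr (Real.summable_one_div_nat_pow.mpr (show 1 < 2 by norm_num))
      simpa using this
    refine tsum_of_norm_bounded hsum.hasSum fun n => ?_
    have hn : (0:ℝ) < (n:ℝ) + 1 := by positivity
    rw [norm_div, norm_one]
    have : ((n:ℂ) + 1) = (((n:ℝ)+1 : ℝ) : ℂ) := by push_cast; rfl
    rw [this, Complex.norm_cpow_eq_rpow_re_of_pos hn]
    refine one_div_le_one_div_of_le (by positivity) ?_
    rw [← Real.rpow_natCast]
    exact Real.rpow_le_rpow_of_exponent_le (by linarith [(Nat.cast_nonneg n : (0:ℝ) ≤ n)]) (by exact_mod_cast hs)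
  refine ⟨2 + 12 + |Mz|, by positivity, fun v hv => ?_⟩
  set s : ℂ := 1/2 + v with hs
  have hsre : s.re = 1/2 + v.re := by simp [hs]
  set y := 1 + ‖v‖^2 with hy
  have hy1 : 1 ≤ y := by simp [hy]
  have hy0 : 0 < y := by linarith
  have hvy : ‖v‖ ≤ Real.sqrt y := Real.le_sqrt_of_sq_le (by linarith)
  have hs1 : s ≠ 1 := by intro h; rw [h] at hsre; simp at hsre; linarith
  rw [xi_eq (by linarith) hs1]
  have hsy1 : 1 ≤ Real.sqrt y := Real.one_le_sqrt.mpr hy1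
  have h34 : 1 ≤ y ^ (3/4:ℝ) := Real.one_le_rpow hy1 (by norm_num)
  have b1 : ‖s * (s - 1)‖ ≤ Real.exp (2 * y ^ (3/4:ℝ)) := by
    have : s * (s - 1) = v^2 - 1/4 := by rw [hs]; ring
    rw [this]
    have h1 : ‖v^2 - 1/4‖ ≤ y := by
      refine (norm_sub_le _ _).trans ?_
      rw [norm_pow, hy]; norm_num; linarith
    have h2 := Real.log_le_rpow_div hy0.le (show (0:ℝ) < 3/4 by norm_num)
    refine h1.trans ?_
    rw [← Real.log_le_iff_le_exp hy0]
    refine h2.trans ?_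
    rw [div_le_iff₀ (by norm_num)]; linarith
  have b2 : ‖Complex.Gammaℝ s‖ ≤ Real.exp (12 * y ^ (3/4:ℝ)) := by
    rw [Complex.Gammaℝ, norm_mul, ← Complex.ofReal_ofNat]
    have hre2 : (s / ((2:ℝ):ℂ)).re = s.re / 2 := by simp
    have p1 : ‖(Real.pi : ℂ) ^ (-s / ((2:ℝ):ℂ))‖ ≤ 1 := by
      rw [Complex.norm_cpow_eq_rpow_re_of_pos Real.pi_pos]
      apply Real.rpow_le_one_of_one_le_of_nonpos (by linarith [Real.pi_gt_three])
      have : (-s / ((2:ℝ):ℂ)).re = -(s.re / 2) := by rw [neg_div, Complex.neg_re, hre2]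
      rw [this]; linarith
    have p2 : ‖Complex.Gamma (s / ((2:ℝ):ℂ))‖ ≤ Real.exp (12 * y ^ (3/4:ℝ)) := by
      refine (norm_Gamma_le (by rw [hre2]; linarith)).trans ?_
      rw [hre2]
      set x := s.re / 2 with hx
      have hx1 : 1 ≤ x := by linarith
      set n := ⌈x⌉₊
      have hn1 : x ≤ n := Nat.le_ceil x
      have hn2 : (n:ℝ) < x + 1 := Nat.ceil_lt_add_one (by linarith)
      have hvre : v.re ≤ ‖v‖ := Complex.re_le_norm v
      have g1 : Real.Gamma x ≤ Real.Gamma (x + 1) := by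
        rw [Real.Gamma_add_one (by linarith)]
        exact le_mul_of_one_le_left (Real.Gamma_pos_of_pos (by linarith)).le hx1
      have g2 : Real.Gamma (x + 1) ≤ Real.Gamma (n + 1) := by
        refine Real.Gamma_strictMonoOn_Ici.monotoneOn ?_ ?_ (by linarith) <;> simp only [mem_Ici] <;> linarith
      rw [Real.Gamma_nat_eq_factorial] at g2
      have g3 : ((n.factorial : ℕ):ℝ) ≤ (n:ℝ)^n := by exact_mod_cast Nat.factorial_le_pow n
      have hn3 : (n:ℝ) ≤ 3 * Real.sqrt y := by linarith
      have hnp : (0:ℝ) < n := by linarith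
      have g4 : (n:ℝ)^n = Real.exp (n * Real.log n) := by
        rw [mul_comm, Real.exp_mul, Real.exp_log hnp, Real.rpow_natCast]
      have q1 : 1 ≤ y ^ (1/4:ℝ) := Real.one_le_rpow hy1 (by norm_num)
      have hlog : Real.log n ≤ 4 * y ^ (1/4:ℝ) := by
        have h1 : Real.log n ≤ Real.log (3 * Real.sqrt y) := Real.log_le_log hnp hn3
        rw [Real.log_mul (by norm_num) (by positivity), Real.log_sqrt hy0.le] at h1
        have h2 := Real.log_le_rpow_div hy0.le (show (0:ℝ) < 1/4 by norm_num)
        have h3 := Real.log_le_sub_one_of_pos (show (0:ℝ) < 3 by norm_num)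
        rw [div_eq_mul_inv] at h2
        norm_num at h2
        linarith
      have g5 : n * Real.log n ≤ 12 * y ^ (3/4:ℝ) := by
        have : y ^ (3/4:ℝ) = Real.sqrt y * y ^ (1/4:ℝ) := by
          rw [Real.sqrt_eq_rpow, ← Real.rpow_add hy0]; norm_num
        rw [this]
        calc n * Real.log n ≤ (3 * Real.sqrt y) * (4 * y ^ (1/4:ℝ)) :=
              mul_le_mul hn3 hlog (Real.log_nonneg (by linarith)) (by positivity)
          _ = _ := by ring
      calc _ ≤ (n:ℝ)^n := g1.trans (g2.trans g3)
        _ ≤ _ := by rw [g4]; exact Real.exp_le_exp.mpr g5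
    calc _ ≤ 1 * Real.exp (12 * y ^ (3/4:ℝ)) := mul_le_mul p1 p2 (norm_nonneg _) zero_le_one
      _ = _ := one_mul _
  have b3 : ‖riemannZeta s‖ ≤ Real.exp (|Mz| * y ^ (3/4:ℝ)) := by
    have h1 := hMz s (by linarith)
    have h2 := Real.add_one_le_exp (|Mz| * y ^ (3/4:ℝ))
    have h3 := le_abs_self Mz
    have h4 := abs_nonneg Mz
    nlinarith
  rw [norm_mul, norm_mul (Complex.Gammaℝ s)]
  calc _ ≤ Real.exp (2 * y ^ (3/4:ℝ)) * (Real.exp (12 * y ^ (3/4:ℝ)) * Real.exp (|Mz| * y ^ (3/4:ℝ))) := by gcongr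
    _ = _ := by rw [← Real.exp_add, ← Real.exp_add]; congr 1; ring

theorem xi_growth : ∃ C : ℝ, 0 < C ∧ ∀ v : ℂ, ‖xi (1/2 + v)‖ ≤ Real.exp (C * (1 + ‖v‖^2) ^ (3/4:ℝ)) := by
  obtain ⟨C, hC, h⟩ := xi_growth_right
  obtain ⟨M, hM, hs⟩ := Lam0_strip
  refine ⟨C + M + 3, by positivity, fun v => ?_⟩
  set y := 1 + ‖v‖^2 with hy
  have hy1 : 1 ≤ y := by simp [hy]
  have hy0 : 0 < y := by linarith
  have h34 : 1 ≤ y ^ (3/4:ℝ) := Real.one_le_rpow hy1 (by norm_num)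
  rcases le_total (3/2) v.re with h1 | h1
  · refine (h v h1).trans (Real.exp_le_exp.mpr ?_); gcongr; linarith
  rcases le_total v.re (-(3/2)) with h2 | h2
  · rw [← xi_symm]
    have := h (-v) (by simp; linarith)
    rw [norm_neg] at this
    have e : (1:ℂ) - (1/2 + v) = 1/2 + -v := by ring
    rw [e]
    refine this.trans (Real.exp_le_exp.mpr ?_); gcongr; linarith
  · have h3 := hs (1/2 + v) (by simp; linarith) (by simp; linarith)
    have e : (1/2 + v) * (1/2 + v - 1) = v^2 - 1/4 := by ring
    rw [xi, e]
    have h4 : ‖v^2 - 1/4‖ ≤ y := by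
      refine (norm_sub_le _ _).trans ?_
      rw [norm_pow, hy]; norm_num; linarith
    have h5 : ‖1 + (v^2 - 1/4) * completedRiemannZeta₀ (1/2+v)‖ ≤ y * (1 + M) := by
      refine (norm_add_le _ _).trans ?_
      rw [norm_mul, norm_one]
      nlinarith [mul_le_mul h4 h3 (norm_nonneg _) hy0.le]
    refine h5.trans ?_
    have h6 := Real.log_le_rpow_div hy0.le (show (0:ℝ) < 3/4 by norm_num)
    rw [div_eq_mul_inv] at h6
    norm_num at h6
    have h7 : y ≤ Real.exp (2 * y ^ (3/4:ℝ)) := by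
      rw [← Real.log_le_iff_le_exp hy0]; linarith
    have h8 : 1 + M ≤ Real.exp (M * y ^ (3/4:ℝ)) := by
      have := Real.add_one_le_exp (M * y ^ (3/4:ℝ)); nlinarith
    calc _ ≤ Real.exp (2 * y ^ (3/4:ℝ)) * Real.exp (M * y ^ (3/4:ℝ)) := by gcongr
      _ ≤ _ := by rw [← Real.exp_add]; apply Real.exp_le_exp.mpr; nlinarith

noncomputable def xiF (w : ℂ) : ℂ := xi (1/2 + w ^ (1/2:ℂ))

theorem sqrt_sq (w : ℂ) : (w ^ (1/2:ℂ))^2 = w := by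
  simp

theorem xiF_sq (v : ℂ) : xiF (v^2) = xi (1/2 + v) := by
  have h := sqrt_sq (v^2)
  unfold xiF
  rcases sq_eq_sq_iff_eq_or_eq_neg.mp h with h | h
  · rw [h]
  · rw [h, ← xi_symm]; congr 1; ring

theorem norm_sqrt (w : ℂ) : ‖w ^ (1/2:ℂ)‖^2 = ‖w‖ := by
  rw [← norm_pow, sqrt_sq]

theorem xiF_diff : Differentiable ℂ xiF := by
  have hne : ∀ w : ℂ, w ≠ 0 → DifferentiableAt ℂ xiF w := by
    intro w hw
    by_cases h : w ∈ Complex.slitPlane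
    · unfold xiF
      have h1 : DifferentiableAt ℂ (fun w : ℂ => 1/2 + w ^ (1/2:ℂ)) w :=
        (differentiableAt_id.cpow_const h).const_add _
      exact (xi_diff _).comp w h1
    · have h2 : -w ∈ Complex.slitPlane := by
        rw [Complex.mem_slitPlane_iff] at h ⊢
        simp only [not_or, not_lt, not_not, ne_eq] at h
        left
        simp only [Complex.neg_re]
        rcases h.1.lt_or_eq with h3 | h3
        · linarith
        · exact absurd (Complex.ext h3 h.2) hw
      have e : xiF = fun w => xi (1/2 + Complex.I * (-w) ^ (1/2:ℂ)) := by
        ext w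
        rw [← xiF_sq, mul_pow, sqrt_sq, Complex.I_sq]; congr 1; ring
      rw [e]
      have h1 : DifferentiableAt ℂ (fun w : ℂ => 1/2 + Complex.I * (-w) ^ (1/2:ℂ)) w :=
        (((differentiableAt_id.neg).cpow_const h2).const_mul _).const_add _
      exact (xi_diff _).comp w h1
  intro w
  by_cases hw : w = 0
  · subst hw
    refine (Complex.analyticAt_of_differentiable_on_punctured_nhds_of_continuousAt ?_ ?_).differentiableAt
    · filter_upwards [self_mem_nhdsWithin] with z hz
      exact hne z hz
    · have h1 : Tendsto (fun w : ℂ => w ^ (1/2:ℂ)) (𝓝 0) (𝓝 0) := by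
        rw [tendsto_zero_iff_norm_tendsto_zero]
        have : (fun w : ℂ => ‖w ^ (1/2:ℂ)‖) = fun w => Real.sqrt ‖w‖ := by
          ext w; rw [← Real.sqrt_sq (norm_nonneg (w ^ (1/2:ℂ))), norm_sqrt]
        rw [this]
        have : Continuous fun w : ℂ => Real.sqrt ‖w‖ := by fun_prop
        simpa using this.tendsto 0
      have h2 : Tendsto (fun w : ℂ => xi (1/2 + w ^ (1/2:ℂ))) (𝓝 0) (𝓝 (xi (1/2 + 0))) :=
        (xi_diff.continuous.tendsto _).comp (tendsto_const_nhds.add h1)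
      unfold ContinuousAt
      have h3 : xiF 0 = xi (1/2 + 0) := by
        unfold xiF; rw [Complex.zero_cpow (by norm_num)]
      rw [h3]; exact h2
  · exact hne w hw

theorem xi_hadamard : ∃ (ι : Type) (ρ : ι → ℂ), (∀ i, xi (ρ i) = 0) ∧ (∀ i, 1/2 ≤ (ρ i).re) ∧
    (∀ s, xi s ≠ 0 → Summable (fun i => ‖1 / ((s - ρ i) * (s - 1 + ρ i))‖)) ∧
    (∀ s, xi s ≠ 0 → HasSum (fun i => 1 / (s - ρ i) + 1 / (s - 1 + ρ i)) (deriv xi s / xi s)) := by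
  obtain ⟨C, hC, hb⟩ := xi_growth
  set G : ℂ → ℂ := fun w => xiF (w + 1/4) with hG
  have hGd : Differentiable ℂ G := xiF_diff.comp (differentiable_id.add_const _)
  have hGv : ∀ v : ℂ, G (v^2 - 1/4) = xi (1/2 + v) := by
    intro v; simp only [hG]; rw [sub_add_cancel, xiF_sq]
  have hG0 : G 0 = 1 := by
    have := hGv (1/2); norm_num at this; rw [this, xi_one]
  have hGb : ∀ w, ‖G w‖ ≤ Real.exp ((2 * C) * (1 + ‖w‖) ^ (3/4:ℝ)) := by
    intro w
    have e : G w = xi (1/2 + (w + 1/4) ^ (1/2:ℂ)) := rfl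
    rw [e]
    refine (hb _).trans (Real.exp_le_exp.mpr ?_)
    rw [norm_sqrt]
    have h1 : 1 + ‖w + 1/4‖ ≤ 2 * (1 + ‖w‖) := by
      have := norm_add_le w (1/4)
      norm_num at this ⊢
      linarith [norm_nonneg w]
    calc C * (1 + ‖w + 1/4‖) ^ (3/4:ℝ) ≤ C * (2 * (1 + ‖w‖)) ^ (3/4:ℝ) := by gcongr
      _ = C * (2 ^ (3/4:ℝ) * (1 + ‖w‖) ^ (3/4:ℝ)) := by
        rw [Real.mul_rpow (by norm_num) (by positivity)]
      _ ≤ C * (2 ^ (1:ℝ) * (1 + ‖w‖) ^ (3/4:ℝ)) := by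
        gcongr <;> norm_num
      _ = _ := by rw [Real.rpow_one]; ring
  have hs0 : G 2 ≠ 0 := by
    have := hGv (3/2); norm_num at this; rw [this]; exact xi_ne_zero_of_one_le (by norm_num)
  have hzero : ∀ z, G z = 0 → xi (1/2 + (z + 1/4) ^ (1/2:ℂ)) = 0 := fun z hz => hz
  have hre : ∀ z, G z = 0 → ‖1 / (2 - z)‖ ≤ 2 * (1 / (2 - z)).re := by
    intro z hz
    have h1 := xi_zero_re (hzero z hz)
    set v := (z + 1/4) ^ (1/2:ℂ) with hv
    have hzv : z = v^2 - 1/4 := by rw [hv, sqrt_sq]; ring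
    have hre1 : -(1/2) < v.re ∧ v.re < 1/2 := by
      have := h1; simp at this; constructor <;> linarith [this.1, this.2]
    set x : ℂ := 2 - z with hx
    have e1 : x.re = 9/4 - v.re^2 + v.im^2 := by rw [hx, hzv]; simp [pow_two]; norm_num; ring
    have e2 : x.im = -2 * v.re * v.im := by rw [hx, hzv]; simp [pow_two]; ring
    have a1 : v.re^2 ≤ 1/4 := by nlinarith [hre1.1, hre1.2]
    have h2 : |x.im| ≤ x.re := by
      rw [abs_le]
      constructor <;> nlinarith [sq_nonneg (v.re - v.im), sq_nonneg (v.re + v.im)]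
    have hx0 : 0 < x.re := by nlinarith [sq_nonneg v.im]
    have h3 : ‖x‖ ≤ 2 * x.re := by
      have := Complex.norm_le_abs_re_add_abs_im x
      rw [abs_of_pos hx0] at this; linarith
    have hxn : 0 < ‖x‖ := hx0.trans_le (Complex.re_le_norm x)
    rw [norm_div, norm_one, one_div x, Complex.inv_re, Complex.normSq_eq_norm_sq]
    rw [← mul_div_assoc, div_le_div_iff₀ hxn (by positivity)]
    nlinarith
  obtain ⟨ι, w, h1, _, h3, h4⟩ := hadamard0 hGd hG0 (2*C) (by linarith) hGb 2 hs0 2 (by norm_num) hre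
  refine ⟨ι, fun i => 1/2 + (w i + 1/4) ^ (1/2:ℂ), fun i => hzero _ (h1 i), ?_, ?_, ?_⟩
  · intro i
    have : 0 ≤ ((w i + 1/4) ^ (1/2:ℂ)).re := by
      by_cases hz : w i + 1/4 = 0
      · rw [hz, Complex.zero_cpow (by norm_num)]; simp
      rw [Complex.cpow_def_of_ne_zero hz, Complex.exp_re]
      refine mul_nonneg (Real.exp_pos _).le (Real.cos_nonneg_of_mem_Icc ?_)
      have i1 : (Complex.log (w i + 1/4) * (1/2)).im = Complex.arg (w i + 1/4) / 2 := by
        rw [mul_comm, show (1/2:ℂ) = ((1/2:ℝ):ℂ) by push_cast; rfl, Complex.im_ofReal_mul, Complex.log_im]; ring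
      rw [i1]
      have := Complex.neg_pi_lt_arg (w i + 1/4)
      have := Complex.arg_le_pi (w i + 1/4)
      constructor <;> linarith
    have e : (1/2 + (w i + 1/4) ^ (1/2:ℂ)).re = 1/2 + ((w i + 1/4) ^ (1/2:ℂ)).re := by simp
    rw [e]; linarith
  · intro s hs
    have hs' : G ((s - 1/2)^2 - 1/4) ≠ 0 := by rw [hGv]; simpa using hs
    refine (h3 _ hs').congr fun i => ?_
    congr 2
    have := sqrt_sq (w i + 1/4)
    linear_combination this
  · intro s hs
    have hs' : G ((s - 1/2)^2 - 1/4) ≠ 0 := by rw [hGv]; simpa using hs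
    have key := (h4 _ hs').mul_left (2 * (s - 1/2))
    have e : xi = fun s => G ((s - 1/2)^2 - 1/4) := by ext s; rw [hGv]; congr 1; ring
    have hd : deriv xi s = deriv G ((s - 1/2)^2 - 1/4) * (2 * (s - 1/2)) := by
      have hi : HasDerivAt (fun s : ℂ => (s - 1/2)^2 - 1/4) (2 * (s - 1/2)) s := by
        have := (((hasDerivAt_id s).sub_const (1/2)).pow 2).sub_const (1/4)
        simpa using this
      have := (hGd ((s - 1/2)^2 - 1/4)).hasDerivAt.comp s hi
      nth_rewrite 1 [e]
      exact this.deriv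
    have e2 : deriv xi s / xi s = 2 * (s - 1/2) * (deriv G ((s - 1/2)^2 - 1/4) / G ((s - 1/2)^2 - 1/4)) := by
      rw [hd, hGv]; simp; ring
    rw [e2]
    refine key.congr_fun fun i => ?_
    have hq := sqrt_sq (w i + 1/4)
    beta_reduce
    generalize (w i + 1/4) ^ (1/2:ℂ) = v at hq ⊢
    have hn : (s - 1/2)^2 - 1/4 - w i ≠ 0 := by
      intro h; apply hs'; 
      have : (s - 1/2)^2 - 1/4 = w i := by linear_combination h
      rw [this]; exact h1 i
    have hp : (s - (1/2 + v)) * (s - 1 + (1/2 + v)) = (s - 1/2)^2 - 1/4 - w i := by linear_combination -hq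
    have hp' := hp ▸ hn
    have hp1 := left_ne_zero_of_mul hp'
    have hp2 := right_ne_zero_of_mul hp'
    rw [← hp, div_add_div _ _ hp1 hp2, mul_one_div]
    congr 1
    ring


noncomputable def psiR (x : ℝ) : ℝ := deriv (Real.log ∘ Real.Gamma) x

lemma lgd {x : ℝ} (hx : 0 < x) : DifferentiableAt ℝ (Real.log ∘ Real.Gamma) x := by
  refine ((Real.differentiableAt_Gamma ?_).log (Real.Gamma_ne_zero ?_)) <;>
    exact fun m ↦ ne_of_gt (by have := Nat.cast_nonneg (α := ℝ) m; linarith)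

lemma lg_rec (x : ℝ) (hx : 0 < x) :
    (Real.log ∘ Real.Gamma) (x + 1) = (Real.log ∘ Real.Gamma) x + Real.log x := by
  simp only [Function.comp_apply,
      Real.Gamma_add_one hx.ne', Real.log_mul hx.ne' (Real.Gamma_pos_of_pos hx).ne', add_comm]

lemma psiR_rec (x : ℝ) (hx : 0 < x) : psiR (x + 1) = psiR x + 1 / x := by
  unfold psiR
  rw [← deriv_comp_add_const, one_div, ← Real.deriv_log,
      ← deriv_add (lgd <| by positivity) (Real.differentiableAt_log hx.ne')]
  apply EventuallyEq.deriv_eq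
  filter_upwards [eventually_gt_nhds hx] using lg_rec

lemma psiR_le (x : ℝ) (hx : 0 < x) : psiR x ≤ Real.log x := by
  refine (Real.convexOn_log_Gamma.deriv_le_slope (mem_Ioi.2 hx) (mem_Ioi.2 (by linarith : 0 < x+1))
        (by linarith) (lgd hx)).trans (le_of_eq ?_)
  rw [slope_def_field, lg_rec x hx]
  field_simp
  ring

lemma le_psiR (x : ℝ) (hx : 0 < x) : Real.log x ≤ psiR (x + 1) := by
  refine (le_of_eq ?_).trans (Real.convexOn_log_Gamma.slope_le_deriv (mem_Ioi.2 hx) (mem_Ioi.2 (by linarith : 0 < x+1))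
        (by linarith) (lgd (by linarith)))
  rw [slope_def_field, lg_rec x hx]
  field_simp
  ring

lemma psiR_add_nat (x : ℝ) (hx : 0 < x) (N : ℕ) :
    psiR (x + N) = psiR x + ∑ n ∈ Finset.range N, 1 / (x + n) := by
  induction N with
  | zero => simp
  | succ n ih =>
    rw [Finset.sum_range_succ, ← add_assoc, ← ih, ← psiR_rec _ (by positivity)]
    push_cast; congr 1; ring

lemma log_le_half {t : ℝ} (ht : 1 ≤ t) : Real.log t ≤ (t - 1/t)/2 := by
  have h := (Real.self_le_sinh_iff (x := Real.log t)).2 (Real.log_nonneg ht)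
  rw [Real.sinh_eq, Real.exp_neg, Real.exp_log (by linarith)] at h
  simpa [one_div] using h

lemma psiR_le' (x : ℝ) (hx : 0 < x) : psiR x ≤ Real.log x - 1/(2*x) := by
  have hstep : ∀ y : ℝ, 0 < y → Real.log (y+1) - 1/(2*(y+1)) - psiR (y+1) ≤
      Real.log y - 1/(2*y) - psiR y := by
    intro y hy
    rw [psiR_rec y hy]
    have h := log_le_half (t := (y+1)/y) (by rw [le_div_iff₀ hy]; linarith)
    rw [Real.log_div (by positivity) hy.ne'] at h
    have : ((y+1)/y - 1/((y+1)/y))/2 = 1/(2*y) + 1/(2*(y+1)) := by field_simp; ring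
    have h2 : 1/y = 2*(1/(2*y)) := by field_simp
    rw [this] at h
    linarith
  have hN : ∀ N : ℕ, -(1/(2*(x+N))) ≤ Real.log x - 1/(2*x) - psiR x := by
    intro N
    have : Real.log (x+N) - 1/(2*(x+N)) - psiR (x+N) ≤ Real.log x - 1/(2*x) - psiR x := by
      induction N with
      | zero => simp
      | succ n ih =>
        refine le_trans ?_ ih
        have := hstep (x+n) (by positivity)
        push_cast
        rw [← add_assoc]; exact this
    have h2 := psiR_le (x+N) (by positivity)
    linarith
  have hl : Tendsto (fun N : ℕ => -(1/(2*(x+N)))) atTop (𝓝 (-0)) := by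
    refine Tendsto.neg ?_
    refine tendsto_const_nhds.div_atTop ?_
    refine Tendsto.const_mul_atTop (by norm_num) ?_
    exact tendsto_atTop_add_const_left _ _ tendsto_natCast_atTop_atTop
  have := le_of_tendsto' hl hN
  linarith

lemma digamma_ofReal (x : ℝ) (hx : 0 < x) : Complex.digamma (x:ℂ) = (psiR x : ℂ) := by
  have hne : ∀ m : ℕ, x ≠ -m := fun m ↦ ne_of_gt (by have := Nat.cast_nonneg (α := ℝ) m; linarith)
  have h1 : HasDerivAt Real.Gamma (deriv Real.Gamma x) x :=
    (Real.differentiableAt_Gamma hne).hasDerivAt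
  have hneC : ∀ m : ℕ, (x:ℂ) ≠ -m := fun m h => hne m (by exact_mod_cast h)
  have h2 := (Complex.differentiableAt_Gamma (x:ℂ) hneC).hasDerivAt.comp_ofReal
  have h3 := h1.ofReal_comp
  have h4 : (fun y : ℝ => Complex.Gamma (y:ℂ)) = fun y : ℝ => ((Real.Gamma y : ℝ) : ℂ) := by
    ext y; exact Complex.Gamma_ofReal y
  rw [h4] at h2
  have h5 := h2.unique h3
  have h6 : psiR x = deriv Real.Gamma x / Real.Gamma x := by
    unfold psiR
    rw [Function.comp_def, deriv.log (Real.differentiableAt_Gamma hne) (Real.Gamma_pos_of_pos hx).ne']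
  rw [Complex.digamma_def, logDeriv_apply, h5, Complex.Gamma_ofReal, h6]
  push_cast; rfl

lemma psi_term_bound {z : ℂ} (hz : 1 < z.re) (n : ℕ) {R : ℝ} (hR : ‖z‖ ≤ R) :
    ‖1/((n:ℂ)+1) - 1/((n:ℂ)+z)‖ ≤ (R+1) * (1/((n:ℝ)+1)^2) := by
  have h1 : ((n:ℂ)+1) ≠ 0 := by exact_mod_cast Nat.succ_ne_zero n
  have hre : (n:ℝ) + 1 ≤ ‖(n:ℂ)+z‖ := by
    refine le_trans ?_ (Complex.re_le_norm _)
    simp; exact hz.le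
  have hpos : (0:ℝ) < (n:ℝ)+1 := by positivity
  have h2 : ((n:ℂ)+z) ≠ 0 := by
    intro h; rw [h] at hre; simp at hre; linarith
  rw [show 1/((n:ℂ)+1) - 1/((n:ℂ)+z) = (z-1)/(((n:ℂ)+1)*((n:ℂ)+z)) by field_simp; ring]
  rw [norm_div, norm_mul]
  have h3 : ‖(n:ℂ)+1‖ = (n:ℝ)+1 := by
    rw [show (n:ℂ)+1 = ((n+1:ℕ):ℂ) by push_cast; rfl, Complex.norm_natCast]; push_cast; rfl
  rw [h3]
  have h4 : ‖z-1‖ ≤ R+1 := (norm_sub_le _ _).trans (by simpa using hR)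
  have h5 : 0 ≤ R := (norm_nonneg _).trans hR
  rw [mul_one_div, pow_two]
  gcongr

lemma sum_inv_succ_sq : Summable (fun n:ℕ => 1/((n:ℝ)+1)^2) := by
  have := (summable_nat_add_iff (f := fun n:ℕ => 1/((n:ℝ))^2) 1).2 (Real.summable_one_div_nat_pow.2 (by norm_num))
  simpa using this

lemma psi_summable {z : ℂ} (hz : 1 < z.re) :
    Summable (fun n:ℕ => 1/((n:ℂ)+1) - 1/((n:ℂ)+z)) :=
  Summable.of_norm_bounded (sum_inv_succ_sq.mul_left (‖z‖+1)) (fun n => psi_term_bound hz n le_rfl)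

lemma psi_hasSum_real (x : ℝ) (hx : 1 < x) :
    HasSum (fun n:ℕ => 1/((n:ℂ)+1) - 1/((n:ℂ)+(x:ℂ))) (Complex.digamma x + Real.eulerMascheroniConstant) := by
  rw [(psi_summable (z := (x:ℂ)) (by simpa using hx)).hasSum_iff_tendsto_nat]
  have hx0 : 0 < x := by linarith
  have h1 : ∀ N : ℕ, ∑ n ∈ Finset.range N, (1/((n:ℂ)+1) - 1/((n:ℂ)+(x:ℂ))) =
     (((harmonic N : ℝ) - Real.log N + psiR x - (psiR (x+N) - Real.log N) : ℝ) : ℂ) := by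
    intro N
    rw [psiR_add_nat x hx0, harmonic]
    push_cast
    rw [Finset.sum_sub_distrib]
    have : ∀ n : ℕ, 1/((n:ℂ)+(x:ℂ)) = 1/((x:ℂ)+n) := fun n => by rw [add_comm]
    simp only [this, one_div]
    ring
  simp only [h1]
  have h2 : Tendsto (fun N : ℕ => psiR (x+N) - Real.log N) atTop (𝓝 0) := by
    have hb : Tendsto (fun N : ℕ => x / (N:ℝ)) atTop (𝓝 0) :=
      tendsto_const_nhds.div_atTop tendsto_natCast_atTop_atTop
    refine tendsto_of_tendsto_of_tendsto_of_le_of_le' tendsto_const_nhds hb ?_ ?_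
    · filter_upwards [eventually_gt_atTop 0] with N hN
      have hN' : (0:ℝ) < N := by exact_mod_cast hN
      have := le_psiR (x+N-1) (by linarith)
      rw [show x+N-1+1 = x+N by ring] at this
      have h3 : Real.log N ≤ Real.log (x+N-1) := Real.log_le_log hN' (by linarith)
      linarith
    · filter_upwards [eventually_gt_atTop 0] with N hN
      have hN' : (0:ℝ) < N := by exact_mod_cast hN
      have := psiR_le (x+N) (by positivity)
      have h4 : Real.log ((x+N)/N) ≤ (x+N)/N - 1 := Real.log_le_sub_one_of_pos (by positivity)
      rw [Real.log_div (by positivity) (by positivity)] at h4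
      have : (x+N)/N - 1 = x/N := by field_simp; ring
      linarith
  have h3 := ((Real.tendsto_harmonic_sub_log.add_const (psiR x)).sub h2)
  rw [digamma_ofReal x hx0]
  have h4 := (Complex.continuous_ofReal.tendsto _).comp h3
  simp only [Function.comp_def] at h4
  convert h4 using 2
  push_cast; ring

lemma psi_hasSum {z : ℂ} (hz : 1 < z.re) :
    HasSum (fun n:ℕ => 1/((n:ℂ)+1) - 1/((n:ℂ)+z)) (Complex.digamma z + Real.eulerMascheroniConstant) := by
  set R := ‖z‖ + 3
  set U : Set ℂ := {w | 1 < w.re} ∩ ball 0 R with hU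
  have hUo : IsOpen U := (isOpen_lt continuous_const Complex.continuous_re).inter isOpen_ball
  have hUc : IsPreconnected U :=
    ((convex_halfSpace_re_gt 1).inter (convex_ball 0 R)).isPreconnected
  have hd1 : DifferentiableOn ℂ (fun w => ∑' n:ℕ, (1/((n:ℂ)+1) - 1/((n:ℂ)+w))) U := by
    refine Complex.differentiableOn_tsum_of_summable_norm (sum_inv_succ_sq.mul_left (R+1)) ?_ hUo ?_
    · intro n w hw
      have h2 : ((n:ℂ)+w) ≠ 0 := by
        intro h
        have := congrArg Complex.re h
        have h3 : 1 < w.re := hw.1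
        simp at this
        have := Nat.cast_nonneg (α := ℝ) n; linarith
      refine DifferentiableAt.differentiableWithinAt ?_
      fun_prop (disch := assumption)
    · intro n w hw
      exact psi_term_bound hw.1 n (by have := hw.2; rw [mem_ball_zero_iff] at this; exact this.le)
  have hne : ∀ w ∈ U, ∀ m : ℕ, w ≠ -m := by
    intro w hw m h
    have h3 : 1 < w.re := hw.1
    rw [h] at h3; simp at h3
    have := Nat.cast_nonneg (α := ℝ) m; linarith
  have hd2 : DifferentiableOn ℂ (fun w => Complex.digamma w + Real.eulerMascheroniConstant) U := by
    have hG : DifferentiableOn ℂ Complex.Gamma U :=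
      fun w hw => (Complex.differentiableAt_Gamma w (hne w hw)).differentiableWithinAt
    refine DifferentiableOn.add_const _ ?_
    rw [Complex.digamma_def]
    exact (hG.deriv hUo).div hG (fun w hw => Complex.Gamma_ne_zero (hne w hw))
  have h2U : (2:ℂ) ∈ U := by
    refine ⟨by simp, ?_⟩
    rw [mem_ball_zero_iff]; have := norm_nonneg z; simp only [R]; norm_num; linarith
  have hfr : ∃ᶠ w in 𝓝[≠] (2:ℂ), (∑' n:ℕ, (1/((n:ℂ)+1) - 1/((n:ℂ)+w))) = Complex.digamma w + Real.eulerMascheroniConstant := by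
    have ht : Tendsto (fun k : ℕ => (((2 + 1/((k:ℝ)+1) : ℝ)) : ℂ)) atTop (𝓝[≠] (2:ℂ)) := by
      rw [tendsto_nhdsWithin_iff]
      constructor
      · have := (Complex.continuous_ofReal.tendsto _).comp
          ((tendsto_one_div_add_atTop_nhds_zero_nat (𝕜 := ℝ)).const_add 2)
        simpa [Function.comp_def] using this
      · refine Eventually.of_forall fun k => ?_
        simp only [mem_compl_iff, mem_singleton_iff]
        intro h
        have : (2 + 1/((k:ℝ)+1) : ℝ) = 2 := by exact_mod_cast h
        have h2 : 0 < 1/((k:ℝ)+1) := by positivity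
        linarith
    refine ht.frequently (Frequently.of_forall fun k => ?_)
    exact (psi_hasSum_real _ (by have h2 : 0 < 1/((k:ℝ)+1) := by positivity
                                 linarith)).tsum_eq
  have key := (hd1.analyticOnNhd hUo).eqOn_of_preconnected_of_frequently_eq (hd2.analyticOnNhd hUo) hUc h2U hfr
  have hzU : z ∈ U := ⟨hz, by rw [mem_ball_zero_iff]; simp [R]⟩
  have := key hzU
  simp only at this
  rw [← this]
  exact (psi_summable hz).hasSum

lemma psi_step {v Y : ℝ} (hv : 3/2 ≤ v) (hY : 0 ≤ Y) :
    Y/(v*(v^2+Y)) ≤ 1/2*Real.log (1+Y/(v-7/10)^2) - 1/2*Real.log (1+Y/(v+3/10)^2) := by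
  have ha : 0 < (v-7/10)^2 := by apply pow_pos; linarith
  have hb : 0 < (v+3/10)^2 := by positivity
  set a := (v-7/10)^2 with ha'
  set b := (v+3/10)^2 with hb'
  have hab : a ≤ b := by rw [ha', hb']; nlinarith
  have hx : 0 ≤ (b-a)*Y/(a*(b+Y)) := by
    have : 0 ≤ b - a := by linarith
    positivity
  have h := Real.le_log_one_add_of_nonneg hx
  have e1 : 1 + (b-a)*Y/(a*(b+Y)) = (1+Y/a)/(1+Y/b) := by
    have : b + Y ≠ 0 := by positivity
    field_simp; ring
  rw [e1, Real.log_div (by positivity) (by positivity)] at h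
  have e2 : 2*((b-a)*Y/(a*(b+Y)))/((b-a)*Y/(a*(b+Y)) + 2) = 2*((b-a)*Y/(2*a*b+(a+b)*Y)) := by
    have : b + Y ≠ 0 := by positivity
    have h3 : 2*a*b+(a+b)*Y ≠ 0 := by positivity
    have h4 : ((b-a)*Y/(a*(b+Y)) + 2) = (2*a*b+(a+b)*Y)/(a*(b+Y)) := by field_simp; ring
    rw [h4]
    field_simp
  rw [e2] at h
  have h5 : Y/(v*(v^2+Y)) ≤ (b-a)*Y/(2*a*b+(a+b)*Y) := by
    rw [div_le_div_iff₀ (by positivity) (by positivity)]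
    have : 2*a*b+(a+b)*Y ≤ (b-a)*(v*(v^2+Y)) := by
      have h6 : b - a = 2*v - 2/5 := by rw [ha', hb']; ring
      have h7 : a + b = 2*v^2 - 4/5*v+29/50 := by rw [ha', hb']; ring
      have h8 : a*b = (v^2 - 2/5*v-21/100)^2 := by rw [ha', hb']; ring
      rw [h6, h7, mul_assoc, h8]
      have h9 : 0 ≤ (v - 3/2)*Y := mul_nonneg (by linarith) hY
      have h10 : 0 ≤ (v-3/2)*v^2 := mul_nonneg (by linarith) (sq_nonneg _)
      nlinarith [mul_nonneg (show 0 ≤ v-3/2 by linarith) (show 0 ≤ v by linarith)]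
    nlinarith
  linarith

lemma psi_re_le {x y : ℝ} (hx : 3/2 ≤ x) :
    (Complex.digamma (x + y*Complex.I)).re ≤ psiR x + 1/2*Real.log (1+y^2/(x-7/10)^2) := by
  have h1 := Complex.hasSum_re (psi_hasSum (z := x + y*Complex.I) (by simp; linarith))
  have h2 := Complex.hasSum_re (psi_hasSum (z := (x:ℂ)) (by simp; linarith))
  rw [digamma_ofReal x (by linarith)] at h2
  have h3 := h1.sub h2
  have hx0 : 0 < x := by linarith
  have key := le_of_tendsto' h3.tendsto_sum_nat (b := 1/2*Real.log (1+y^2/(x-7/10)^2)) ?_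
  · simp at key ⊢
    linarith
  intro N
  have hterm : ∀ n : ℕ, ((1/((n:ℂ)+1) - 1/((n:ℂ)+(x + y*Complex.I))).re - (1/((n:ℂ)+1) - 1/((n:ℂ)+(x:ℂ))).re)
     ≤ 1/2*Real.log (1+y^2/((x+n)-7/10)^2) - 1/2*Real.log (1+y^2/((x+(n+1:ℕ))-7/10)^2) := by
    intro n
    have h := psi_step (v := x+n) (Y := y^2) (by have := Nat.cast_nonneg (α := ℝ) n; linarith) (sq_nonneg y)
    have e : (x+(n+1:ℕ))-7/10 = x + n + 3/10 := by push_cast; ring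
    rw [e]
    refine le_trans (le_of_eq ?_) h
    have hv : (n:ℂ)+(x:ℂ) = ((x+n:ℝ):ℂ) := by push_cast; ring
    have hw : (n:ℂ)+(x + y*Complex.I) = ((x+n:ℝ):ℂ) + y*Complex.I := by push_cast; ring
    rw [hv, hw]
    have hv0 : 0 < x + n := by positivity
    generalize x + n = v at *
    simp only [Complex.sub_re, one_div, Complex.inv_re, Complex.normSq_apply, Complex.add_re, Complex.add_im, Complex.mul_re, Complex.mul_im, Complex.ofReal_re, Complex.ofReal_im, Complex.I_re, Complex.I_im]
    have : v^2 + y^2 ≠ 0 := by positivity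
    have h7 : (v + (y*0-0*1))*(v + (y*0-0*1)) + (0 + (y*1+0*0))*(0 + (y*1+0*0)) = v^2+y^2 := by ring
    rw [h7]
    have h8 : v*v+0*0 = v^2 := by ring
    rw [h8]
    field_simp
    ring
  refine (Finset.sum_le_sum (fun n _ => hterm n)).trans ?_
  rw [Finset.sum_range_sub' (fun n:ℕ => 1/2*Real.log (1+y^2/((x+n)-7/10)^2)) N]
  have : 0 ≤ 1/2*Real.log (1+y^2/((x+N)-7/10)^2) := by
    have : 0 ≤ Real.log (1+y^2/((x+N)-7/10)^2) := Real.log_nonneg (by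
      have : 0 ≤ y^2/((x+N)-7/10)^2 := by positivity
      linarith)
    linarith
  simp only [Nat.cast_zero, add_zero]
  linarith


def ZI : Type := xi_hadamard.choose
noncomputable def zr : ZI → ℂ := xi_hadamard.choose_spec.choose

lemma zr_zero (i : ZI) : xi (zr i) = 0 := xi_hadamard.choose_spec.choose_spec.1 i
lemma zr_half (i : ZI) : 1/2 ≤ (zr i).re := xi_hadamard.choose_spec.choose_spec.2.1 i
lemma zr_lt_one (i : ZI) : (zr i).re < 1 := (xi_zero_re (zr_zero i)).2
lemma zr_summable {s : ℂ} (hs : xi s ≠ 0) : Summable (fun i => ‖1/((s-zr i)*(s-1+zr i))‖) :=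
  xi_hadamard.choose_spec.choose_spec.2.2.1 s hs
lemma zr_hasSum {s : ℂ} (hs : xi s ≠ 0) :
    HasSum (fun i => 1/(s-zr i)+1/(s-1+zr i)) (deriv xi s / xi s) :=
  xi_hadamard.choose_spec.choose_spec.2.2.2 s hs

lemma xi_logderiv {s : ℂ} (hs : 1 < s.re) :
    deriv xi s / xi s = 1/(s-1) - (Real.log Real.pi)/2 + 1/2*Complex.digamma (s/2+1)
      + deriv riemannZeta s / riemannZeta s := by
  have hπ : (Real.pi:ℂ) ≠ 0 := by exact_mod_cast Real.pi_ne_zero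
  have hs1 : s - 1 ≠ 0 := by
    intro h; have := congrArg Complex.re h; simp at this; linarith
  have hs1' : s ≠ 1 := sub_ne_zero.1 hs1
  have hev : xi =ᶠ[𝓝 s] fun w => 2*(w-1)*((Real.pi:ℂ)^(-w/2) * (Complex.Gamma (w/2+1) * riemannZeta w)) := by
    filter_upwards [(isOpen_lt continuous_const Complex.continuous_re).mem_nhds hs] with w hw
    have hw' : 1 < w.re := hw
    have hw0 : w ≠ 0 := by rintro rfl; simp at hw'; linarith
    rw [xi_eq (by linarith) (by rintro rfl; simp at hw'), Complex.Gammaℝ_def,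
      Complex.Gamma_add_one _ (div_ne_zero hw0 two_ne_zero)]
    ring
  have hG : ∀ m : ℕ, s/2+1 ≠ -m := by
    intro m h; have := congrArg Complex.re h
    simp at this
    have := Nat.cast_nonneg (α := ℝ) m; linarith
  have hGne := Complex.Gamma_ne_zero hG
  have hζ : riemannZeta s ≠ 0 := riemannZeta_ne_zero_of_one_le_re hs.le
  have d1 : HasDerivAt (fun w : ℂ => 2*(w-1)) 2 s := by
    simpa using ((hasDerivAt_id s).sub_const 1).const_mul 2
  have d2 : HasDerivAt (fun w : ℂ => (Real.pi:ℂ)^(-w/2)) ((Real.pi:ℂ)^(-s/2) * (-(Real.log Real.pi)/2)) s := by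
    have h := ((hasDerivAt_id s).neg.div_const 2).const_cpow (c := (Real.pi:ℂ)) (Or.inl hπ)
    simp only [Pi.neg_apply, id] at h
    convert h using 1
    rw [Complex.ofReal_log Real.pi_pos.le]; ring
  have d3 : HasDerivAt (fun w : ℂ => Complex.Gamma (w/2+1)) (deriv Complex.Gamma (s/2+1) * (1/2)) s := by
    have h := (Complex.differentiableAt_Gamma _ hG).hasDerivAt
    exact h.comp s (((hasDerivAt_id s).div_const 2).add_const 1)
  have d4 : HasDerivAt riemannZeta (deriv riemannZeta s) s := (differentiableAt_riemannZeta hs1').hasDerivAt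
  have d := d1.mul (d2.mul (d3.mul d4))
  have hd : deriv xi s = _ := hev.deriv_eq.trans d.deriv
  rw [hd, hev.self_of_nhds, Complex.digamma_def, logDeriv_apply]
  have hp : (Real.pi:ℂ)^(-s/2) ≠ 0 := by simp [Complex.cpow_eq_zero_iff, hπ]
  simp only [Pi.mul_apply]
  clear hev d d1 d2 d3 d4 hd hG
  generalize (Real.pi:ℂ)^(-s/2) = P at *
  generalize deriv Complex.Gamma (s/2+1) = G' at *
  generalize Complex.Gamma (s/2+1) = G at *
  field_simp
  ring

lemma gamma_le : Real.eulerMascheroniConstant ≤ 0.5775 := by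
  have hstep : ∀ n : ℕ, ((harmonic (n+1) : ℚ) : ℝ) - Real.log ((n+1:ℕ) + 1/2) ≤ (harmonic n : ℝ) - Real.log (n+1/2) := by
    intro n
    have hx : (0:ℝ) < n + 1/2 := by positivity
    have h := Real.le_log_one_add_of_nonneg (x := 1/((n:ℝ)+1/2)) (by positivity)
    have e : 1 + 1/((n:ℝ)+1/2) = ((n+1:ℕ) + 1/2)/((n:ℝ)+1/2) := by push_cast; field_simp; ring
    rw [e, Real.log_div (by positivity) (by positivity)] at h
    have e2 : 2*(1/((n:ℝ)+1/2))/(1/((n:ℝ)+1/2)+2) = ((n:ℝ)+1)⁻¹ := by field_simp; ring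
    rw [harmonic_succ]
    push_cast at *
    linarith
  have hmono : Antitone (fun n : ℕ => (harmonic n : ℝ) - Real.log (n+1/2)) := antitone_nat_of_succ_le hstep
  have hlim : Tendsto (fun n : ℕ => (harmonic n : ℝ) - Real.log (n+1)) atTop (𝓝 Real.eulerMascheroniConstant) :=
    Real.tendsto_harmonic_sub_log_add_one
  have h1 : Real.eulerMascheroniConstant ≤ (harmonic 15 : ℝ) - Real.log ((15:ℕ)+1/2) := by
    refine le_of_tendsto hlim ?_
    filter_upwards [eventually_ge_atTop 15] with n hn
    refine le_trans ?_ (hmono hn)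
    have : Real.log ((n:ℝ)+1/2) ≤ Real.log (n+1) := Real.log_le_log (by positivity) (by linarith)
    simp only; linarith
  have h2 : (harmonic 15 : ℝ) ≤ 3.31823 := by
    norm_num [harmonic, Finset.sum_range_succ]
  have h3 := log_le_half (t := 32/31) (by norm_num)
  have h4 : Real.log ((15:ℕ)+1/2) = 4*Real.log 2 - Real.log (32/31) := by
    rw [show (((15:ℕ):ℝ)+1/2) = 2^4/(32/31) by norm_num, Real.log_div (by norm_num) (by norm_num), Real.log_pow]
    norm_num
  have := Real.log_two_gt_d9
  rw [h4] at h1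
  norm_num at h3 h1 h2 ⊢
  linarith

lemma log_pi_ge : 1.1446 ≤ Real.log Real.pi := by
  have h1 : Real.log 31 ≤ Real.log (Real.pi^3) := by
    refine Real.log_le_log (by norm_num) ?_
    have := Real.pi_gt_d4
    calc (31:ℝ) ≤ 3.1415^3 := by norm_num
      _ ≤ _ := by gcongr
  rw [Real.log_pow] at h1
  have h3 := log_le_half (t := 32/31) (by norm_num)
  have h4 : Real.log 31 = 5*Real.log 2 - Real.log (32/31) := by
    rw [show (31:ℝ) = 2^5/(32/31) by norm_num, Real.log_div (by norm_num) (by norm_num), Real.log_pow]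
    norm_num
  have := Real.log_two_gt_d9
  rw [h4] at h1
  norm_num at h3 h1 ⊢
  linarith

noncomputable def qq (i : ZI) : ℂ := 1/(zr i * (1 - zr i))

lemma zr_ne_zero (i : ZI) : zr i ≠ 0 := by
  intro h; have := zr_half i; rw [h] at this; norm_num at this
lemma zr_ne_one (i : ZI) : 1 - zr i ≠ 0 := by
  intro h; have := zr_lt_one i; rw [← sub_eq_zero.1 h] at this; norm_num at this

lemma qq_summable_norm : Summable (fun i => ‖qq i‖) := by
  have := zr_summable (s := 1) (xi_ne_zero_of_one_le (by simp))
  refine this.congr fun i => ?_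
  simp [qq, mul_comm]

noncomputable def Qsum : ℝ := 1 + (Real.eulerMascheroniConstant - Real.log (4*Real.pi))/2

lemma xi_deriv_one : deriv xi 1 = (Qsum : ℂ) := by
  have hd := (differentiable_completedZeta₀ 1).hasDerivAt
  have h : HasDerivAt xi (((1:ℂ)*(1-1)+1*1)*completedRiemannZeta₀ 1 + 1*(1-1)*deriv completedRiemannZeta₀ 1) 1 := by
    have h1 : HasDerivAt (fun s:ℂ => s*(s-1)) (1*(1-1)+1*1) (1:ℂ) :=
      (hasDerivAt_id (1:ℂ)).mul ((hasDerivAt_id (1:ℂ)).sub_const 1)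
    exact (h1.mul hd).const_add 1
  rw [h.deriv, completedRiemannZeta₀_one, Qsum]
  push_cast
  rw [Complex.ofReal_log (by positivity)]
  push_cast
  ring

lemma qq_hasSum : HasSum qq (Qsum : ℂ) := by
  have := zr_hasSum (s := 1) (xi_ne_zero_of_one_le (by simp))
  rw [xi_one, xi_deriv_one, div_one] at this
  refine this.congr_fun fun i => ?_
  have h1 := zr_ne_zero i
  have h2 := zr_ne_one i
  simp only [qq, sub_self, zero_add]
  field_simp
  ring

lemma Qsum_le : Qsum ≤ 0.0234 := by
  unfold Qsum
  rw [Real.log_mul (by norm_num) Real.pi_ne_zero, show (4:ℝ) = 2^2 by norm_num, Real.log_pow]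
  have := Real.log_two_gt_d9
  have := gamma_le
  have := log_pi_ge
  norm_num at *
  linarith

lemma qq_re_form (i : ZI) : (qq i).re = ((zr i).re*(1-(zr i).re) + (zr i).im^2) /
    (((zr i).re*(1-(zr i).re) + (zr i).im^2)^2 + (zr i).im^2*(1-2*(zr i).re)^2) := by
  rw [qq, one_div, Complex.inv_re, Complex.normSq_apply]
  simp only [Complex.mul_re, Complex.mul_im, Complex.sub_re, Complex.sub_im, Complex.one_re, Complex.one_im]
  congr 1 <;> ring

lemma qq_norm_form (i : ZI) : 1/‖qq i‖^2 =
    (((zr i).re*(1-(zr i).re) + (zr i).im^2)^2 + (zr i).im^2*(1-2*(zr i).re)^2) := by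
  rw [qq, norm_div, norm_one, one_div, div_pow, one_pow, one_div, inv_inv, ← Complex.normSq_eq_norm_sq, Complex.normSq_apply]
  simp only [Complex.mul_re, Complex.mul_im, Complex.sub_re, Complex.sub_im, Complex.one_re, Complex.one_im]
  ring

lemma qq_re_nonneg (i : ZI) : 0 ≤ (qq i).re := by
  rw [qq_re_form]
  have := zr_half i
  have := zr_lt_one i
  have : 0 ≤ (zr i).re*(1-(zr i).re) := mul_nonneg (by linarith) (by linarith)
  positivity

lemma qq_re_le (i : ZI) : (qq i).re ≤ 0.0234 := by
  have h := Complex.hasSum_re qq_hasSum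
  simp only [Complex.ofReal_re] at h
  exact (le_hasSum h i (fun j _ => qq_re_nonneg j)).trans Qsum_le

lemma zr_im_sq (i : ZI) : 36 ≤ (zr i).im^2 := by
  have h := qq_re_le i
  rw [qq_re_form] at h
  have h1 := zr_half i
  have h2 := zr_lt_one i
  have hb : 0 < (zr i).re*(1-(zr i).re) := mul_pos (by linarith) (by linarith)
  have hb2 : (zr i).re*(1-(zr i).re) ≤ 1/4 := by nlinarith [sq_nonneg ((zr i).re-1/2)]
  have hc : (1-2*(zr i).re)^2 ≤ 1 := by nlinarith
  have hg := sq_nonneg (zr i).im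
  have hc0 := sq_nonneg (1-2*(zr i).re)
  generalize (zr i).re*(1-(zr i).re) = b at *
  generalize (zr i).im^2 = g at *
  generalize (1-2*(zr i).re)^2 = c at *
  by_contra! hlt
  rw [div_le_iff₀ (by positivity)] at h
  have h5 : g*c ≤ g := by nlinarith
  nlinarith

lemma qq_norm_le_inv (i : ZI) : ‖qq i‖ ≤ 1/(zr i).im^2 := by
  have h := qq_norm_form i
  have hg := zr_im_sq i
  have h1 := zr_half i
  have h2 := zr_lt_one i
  have hb : 0 < (zr i).re*(1-(zr i).re) := mul_pos (by linarith) (by linarith)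
  have h3 : ((zr i).im^2)^2 ≤ 1/‖qq i‖^2 := by
    rw [h]; nlinarith [sq_nonneg ((zr i).im*(1-2*(zr i).re))]
  have hq : 0 < ‖qq i‖ := by
    rw [norm_pos_iff]; exact div_ne_zero one_ne_zero (mul_ne_zero (zr_ne_zero i) (zr_ne_one i))
  rw [le_div_iff₀ (by linarith)]
  rw [le_div_iff₀ (by positivity), ← mul_pow] at h3
  have := abs_le_of_sq_le_sq (a := (zr i).im^2 * ‖qq i‖) (b := 1) (by linarith) (by norm_num)
  rw [mul_comm]; exact (le_abs_self _).trans this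

lemma qq_norm_le_re (i : ZI) : ‖qq i‖ ≤ 73/72*(qq i).re := by
  have h := qq_norm_form i
  have hr := qq_re_form i
  have hg := zr_im_sq i
  have h1 := zr_half i
  have h2 := zr_lt_one i
  have hb : 0 < (zr i).re*(1-(zr i).re) := mul_pos (by linarith) (by linarith)
  have hc : (1-2*(zr i).re)^2 ≤ 1 := by nlinarith
  have hc0 := sq_nonneg (1-2*(zr i).re)
  have hq : 0 < ‖qq i‖ := by
    rw [norm_pos_iff]; exact div_ne_zero one_ne_zero (mul_ne_zero (zr_ne_zero i) (zr_ne_one i))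
  rw [← h] at hr
  rw [hr, div_div_eq_mul_div, div_one]
  generalize (zr i).re*(1-(zr i).re) = b at *
  generalize (zr i).im^2 = g at *
  generalize (1-2*(zr i).re)^2 = c at *
  generalize ‖qq i‖ = n at *
  have h5 : g*c ≤ g := by nlinarith
  have h6 : 1/n ≤ 73/72*(b+g) := by
    refine le_of_sq_le_sq ?_ (by positivity)
    rw [div_pow, one_pow, h]
    nlinarith [sq_nonneg (b+g-36), mul_pos hb hb]
  rw [div_le_iff₀ hq] at h6
  nlinarith

noncomputable def Qabs : ℝ := ∑' i, ‖qq i‖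

lemma Qabs_le : Qabs ≤ 0.0238 := by
  have h := (Complex.hasSum_re qq_hasSum).mul_left (73/72)
  have := qq_summable_norm.tsum_le_tsum qq_norm_le_re h.summable
  rw [h.tsum_eq] at this
  have h2 := Qsum_le
  simp only [Complex.ofReal_re] at this
  unfold Qabs
  norm_num at *
  linarith


lemma vm_term_re (σ x : ℝ) (n : ℕ) :
    (LSeries.term (fun n => ((ArithmeticFunction.vonMangoldt n : ℝ):ℂ)) (σ + x*Complex.I) n).re =
     ArithmeticFunction.vonMangoldt n * (Real.exp (-σ * Real.log n) * Real.cos (x * Real.log n)) := by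
  rcases Nat.eq_zero_or_pos n with rfl | hn
  · simp
  have hn0 : (n:ℂ) ≠ 0 := by exact_mod_cast hn.ne'
  rw [LSeries.term_of_ne_zero hn.ne', div_eq_mul_inv, ← Complex.cpow_neg, Complex.re_ofReal_mul,
    Complex.cpow_def_of_ne_zero hn0, Complex.exp_re, ← Complex.natCast_log]
  congr 2
  · congr 1; simp [-Complex.natCast_log]; ring
  · rw [← Real.cos_neg]; congr 1; simp [-Complex.natCast_log]; ring

lemma vm_hasSum {σ x : ℝ} (hσ : 1 < σ) :
    HasSum (fun n : ℕ => ArithmeticFunction.vonMangoldt n * (Real.exp (-σ * Real.log n) * Real.cos (x * Real.log n)))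
      (-(deriv riemannZeta (σ + x*Complex.I) / riemannZeta (σ + x*Complex.I))).re := by
  have hre : 1 < ((σ:ℂ) + x*Complex.I).re := by simpa using hσ
  have h := (ArithmeticFunction.LSeriesSummable_vonMangoldt hre).hasSum
  have h2 := Complex.hasSum_re h
  have h3 := ArithmeticFunction.LSeries_vonMangoldt_eq_deriv_riemannZeta_div hre
  rw [LSeries] at h3
  rw [h3] at h2
  simp only [vm_term_re] at h2
  rw [← neg_div]
  exact h2

lemma vm_trig {σ t : ℝ} (hσ : 1 < σ) :
    0 ≤ 5 * (-(deriv riemannZeta (σ + (0:ℝ)*Complex.I) / riemannZeta (σ + (0:ℝ)*Complex.I))).re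
     + 8 * (-(deriv riemannZeta (σ + t*Complex.I) / riemannZeta (σ + t*Complex.I))).re
     + 4 * (-(deriv riemannZeta (σ + (2*t:ℝ)*Complex.I) / riemannZeta (σ + (2*t:ℝ)*Complex.I))).re
     + (-(deriv riemannZeta (σ + (3*t:ℝ)*Complex.I) / riemannZeta (σ + (3*t:ℝ)*Complex.I))).re := by
  have h := ((((vm_hasSum (x := 0) hσ).mul_left 5).add ((vm_hasSum (x := t) hσ).mul_left 8)).add
    ((vm_hasSum (x := 2*t) hσ).mul_left 4)).add (vm_hasSum (x := 3*t) hσ)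
  refine h.nonneg fun n => ?_
  have hΛ := ArithmeticFunction.vonMangoldt_nonneg (n := n)
  have he := Real.exp_pos (-σ * Real.log n)
  have c2 : Real.cos (2*t*Real.log n) = 2*Real.cos (t*Real.log n)^2 - 1 := by
    rw [mul_assoc, Real.cos_two_mul]
  have c3 : Real.cos (3*t*Real.log n) = 4*Real.cos (t*Real.log n)^3 - 3*Real.cos (t*Real.log n) := by
    rw [mul_assoc, Real.cos_three_mul]
  rw [c2, c3, zero_mul, Real.cos_zero]
  have hc := Real.neg_one_le_cos (t*Real.log n)
  generalize Real.cos (t*Real.log n) = c at *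
  have : 0 ≤ ArithmeticFunction.vonMangoldt n * Real.exp (-σ * Real.log n) * ((1+c)*(1+2*c)^2) := by
    have : 0 ≤ 1 + c := by linarith
    positivity
  nlinarith

lemma pair_re_nonneg {s : ℂ} (hs : 1 ≤ s.re) (i : ZI) : 0 ≤ (1/(s-zr i)).re ∧ 0 ≤ (1/(s-1+zr i)).re := by
  have h1 := zr_half i
  have h2 := zr_lt_one i
  rw [one_div, one_div, Complex.inv_re, Complex.inv_re]
  refine ⟨div_nonneg ?_ (Complex.normSq_nonneg _), div_nonneg ?_ (Complex.normSq_nonneg _)⟩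
  · simp; linarith
  · simp; linarith

lemma D_eq {s : ℂ} (hs : 1 < s.re) : (-(deriv riemannZeta s / riemannZeta s)).re =
    (1/(s-1)).re - (Real.log Real.pi)/2 + 1/2*(Complex.digamma (s/2+1)).re - (deriv xi s / xi s).re := by
  have h := congrArg Complex.re (xi_logderiv hs)
  rw [Complex.add_re, Complex.add_re, Complex.sub_re] at h
  have e1 : (((Real.log Real.pi:ℝ):ℂ)/2).re = (Real.log Real.pi)/2 := by
    rw [show ((Real.log Real.pi:ℝ):ℂ)/2 = ((Real.log Real.pi/2 : ℝ):ℂ) by push_cast; rfl, Complex.ofReal_re]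
  have e2 : (1/2*Complex.digamma (s/2+1)).re = 1/2*(Complex.digamma (s/2+1)).re := by
    rw [show (1/2:ℂ) = ((1/2:ℝ):ℂ) by push_cast; rfl, Complex.re_ofReal_mul]
  rw [e1, e2] at h
  rw [Complex.neg_re]
  linarith

lemma D_le {σ x : ℝ} (hσ : 1 < σ) : (-(deriv riemannZeta (σ + x*Complex.I) / riemannZeta (σ + x*Complex.I))).re ≤
    (σ-1)/((σ-1)^2+x^2) - (Real.log Real.pi)/2 + 1/2*(psiR (σ/2+1) + 1/2*Real.log (1+(x/2)^2/((σ/2+1)-7/10)^2))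
     - (deriv xi (σ + x*Complex.I) / xi (σ + x*Complex.I)).re := by
  rw [D_eq (by simpa using hσ)]
  have h := psi_re_le (x := σ/2+1) (y := x/2) (by linarith)
  have e : ((σ:ℂ) + x*Complex.I)/2+1 = ((σ/2+1:ℝ):ℂ) + ((x/2:ℝ):ℂ)*Complex.I := by push_cast; ring
  rw [e]
  have e2 : (1/((σ:ℂ) + x*Complex.I-1)).re = (σ-1)/((σ-1)^2+x^2) := by
    rw [one_div, Complex.inv_re, Complex.normSq_apply]
    simp
    ring
  rw [e2]
  linarith

lemma xi_ld_ne {s : ℂ} (hs : 1 < s.re) : xi s ≠ 0 := xi_ne_zero_of_one_le hs.le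

lemma xi_ld_nonneg {s : ℂ} (hs : 1 < s.re) : 0 ≤ (deriv xi s / xi s).re :=
  (Complex.hasSum_re (zr_hasSum (xi_ld_ne hs))).nonneg fun i => by
    rw [Complex.add_re]; exact add_nonneg (pair_re_nonneg hs.le i).1 (pair_re_nonneg hs.le i).2

lemma xi_ld_ge (i : ZI) {σ : ℝ} (hσ : 1 < σ) :
    1/(σ-(zr i).re) ≤ (deriv xi (σ + (zr i).im*Complex.I) / xi (σ + (zr i).im*Complex.I)).re := by
  set s : ℂ := σ + (zr i).im*Complex.I with hs'
  have hs : 1 < s.re := by simp [hs', hσ]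
  have h := le_hasSum (Complex.hasSum_re (zr_hasSum (xi_ld_ne hs))) i (fun j _ => by
    rw [Complex.add_re]; exact add_nonneg (pair_re_nonneg hs.le j).1 (pair_re_nonneg hs.le j).2)
  refine le_trans ?_ h
  rw [Complex.add_re]
  have e : s - zr i = ((σ-(zr i).re : ℝ):ℂ) := by
    rw [hs']; apply Complex.ext <;> simp
  have e2 : (1/(s - zr i)).re = 1/(σ-(zr i).re) := by
    rw [e, ← Complex.ofReal_one, ← Complex.ofReal_div, Complex.ofReal_re]
  rw [e2]
  linarith [(pair_re_nonneg hs.le i).2]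

lemma log_num1 : Real.log 1.7 ≤ 0.5308 := by
  have h3 := log_le_half (t := 289/256) (by norm_num)
  have h4 : 2*Real.log 1.7 = 2*Real.log (1.6) + Real.log (289/256) := by
    have e : Real.log (289/256) = 2*Real.log (17/16) := by
      rw [show (289/256:ℝ) = (17/16)^2 by norm_num, Real.log_pow]; norm_num
    have e2 : Real.log (1.7) = Real.log 1.6 + Real.log (17/16) := by
      rw [← Real.log_mul (by norm_num) (by norm_num)]; norm_num
    rw [e, e2]; ring
  have h5 : Real.log 1.6 = 3*Real.log 2 - Real.log 5 := by
    rw [show (1.6:ℝ) = 2^3/5 by norm_num, Real.log_div (by norm_num) (by norm_num), Real.log_pow]; norm_num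
  have h6 : 7*Real.log 2 ≤ 3*Real.log 5 + Real.log (128/125) := by
    have : Real.log (128/125) = 7*Real.log 2 - 3*Real.log 5 := by
      rw [show (128/125:ℝ) = 2^7/5^3 by norm_num, Real.log_div (by norm_num) (by norm_num), Real.log_pow, Real.log_pow]; norm_num
    linarith
  have h7 := log_le_half (t := 128/125) (by norm_num)
  have := Real.log_two_lt_d9
  norm_num at *
  linarith

lemma log_one_add_sq {t a : ℝ} (ht : 0 < t) (ha : 0 < a) :
    Real.log (1+(t/2)^2/a^2) ≤ 2*Real.log t - 2*Real.log (2*a) + (2*a)^2/t^2 := by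
  have e : 1+(t/2)^2/a^2 = (t/(2*a))^2*(1 + (2*a)^2/t^2) := by field_simp; ring
  rw [e, Real.log_mul (by positivity) (by positivity), Real.log_pow, Real.log_div (by positivity) (by positivity)]
  have h := Real.log_le_sub_one_of_pos (x := 1 + (2*a)^2/t^2) (by positivity)
  push_cast
  linarith

lemma log_one_add_mono {t a : ℝ} (ha : 4/5 ≤ a) (ht : 0 < t) :
    Real.log (1+(t/2)^2/a^2) ≤ 2*Real.log t - 2*Real.log 1.6 + 2.56/t^2 := by
  have h : Real.log (1+(t/2)^2/a^2) ≤ Real.log (1+(t/2)^2/(4/5)^2) := by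
    apply Real.log_le_log (by positivity); gcongr
  refine h.trans ((log_one_add_sq ht (by norm_num)).trans (le_of_eq ?_))
  norm_num

lemma log_num3 : Real.log 3 ≤ 1.1 := by
  have n2 := Real.log_two_lt_d9
  have h7 := log_le_half (t := 9/8) (by norm_num)
  have : Real.log (9/8) = 2*Real.log 3 - 3*Real.log 2 := by
    rw [show (9/8:ℝ) = 3^2/2^3 by norm_num, Real.log_div (by norm_num) (by norm_num), Real.log_pow, Real.log_pow]; norm_num
  norm_num at *
  linarith

lemma log_num16 : 0.469 ≤ Real.log 1.6 := by
  have n2 := Real.log_two_gt_d9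
  have h5 : Real.log 1.6 = 3*Real.log 2 - Real.log 5 := by
    rw [show (1.6:ℝ) = 2^3/5 by norm_num, Real.log_div (by norm_num) (by norm_num), Real.log_pow]; norm_num
  have h7 := Real.log_le_sub_one_of_pos (x := 125/128) (by norm_num)
  have : Real.log (125/128) = 3*Real.log 5 - 7*Real.log 2 := by
    rw [show (125/128:ℝ) = 5^3/2^7 by norm_num, Real.log_div (by norm_num) (by norm_num), Real.log_pow, Real.log_pow]; norm_num
  norm_num at *
  linarith

lemma zfr_aux {a g G : ℝ} (ha' : a ≤ 0.4) (hG : 0 < G) (hg : G ≤ g) : a/(a^2+g) ≤ 0.4/G :=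
  div_le_div₀ (by norm_num) ha' hG (by nlinarith [sq_nonneg a])

lemma zfr_lin {D0 D1 D2 D3 X p ps K0 K1 K2 K3 F1 F2 F3 L1 L2 L3 a b c lt : ℝ}
    (hT : 0 ≤ 5*D0+8*D1+4*D2+D3) (h0 : D0 ≤ 5/4*X - p/2 + 1/2*(ps+1/2*0) - K0)
    (h1 : D1 ≤ F1 - p/2 + 1/2*(ps+1/2*L1) - K1) (h2 : D2 ≤ F2 - p/2 + 1/2*(ps+1/2*L2) - K2)
    (h3 : D3 ≤ F3 - p/2 + 1/2*(ps+1/2*L3) - K3) (g0 : 0 ≤ K0) (g1 : X ≤ K1) (g2 : 0 ≤ K2) (g3 : 0 ≤ K3)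
    (f1 : F1 ≤ 0.4/36) (f2 : F2 ≤ 0.4/144) (f3 : F3 ≤ 0.4/324)
    (l1 : L1 ≤ 2*lt - 2*c + 2.56/36) (l2 : L2 ≤ 2*(a+lt) - 2*c + 2.56/144) (l3 : L3 ≤ 2*(b+lt) - 2*c + 2.56/324)
    (hp : ps ≤ 0.5308 - 1/3.4) (hlp : 1.1446 ≤ p) (n2 : a < 0.6931471808) (n2' : 0.6931471803 < a)
    (n3 : b ≤ 1.1) (n16 : 0.469 ≤ c) (hlog : 0 ≤ lt - a - b) :
    5*X ≤ 18.6*(lt - a - b) + 10 := by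
  norm_num at *
  linarith

set_option maxHeartbeats 800000 in
lemma zfr (i : ZI) : 1/(1-(zr i).re) ≤ 18.6*Real.log (|(zr i).im|/6) + 10 := by
  have hg := zr_im_sq i
  have hβ := zr_lt_one i
  set t := |(zr i).im| with ht
  have ht6 : 6 ≤ t := by
    rw [ht]; exact by have := Real.abs_le_sqrt (x := 6) (y := (zr i).im^2) (by linarith); rw [Real.sqrt_sq_eq_abs] at this; norm_num at this; exact this
  have hlog : 0 ≤ Real.log (t/6) := Real.log_nonneg (by linarith)
  by_cases hη : 1/10 ≤ 1-(zr i).re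
  · have : 1/(1-(zr i).re) ≤ 10 := by
      rw [div_le_iff₀ (by linarith)]; linarith
    linarith
  push Not at hη
  set η := 1-(zr i).re with hη'
  have hη0 : 0 < η := by linarith
  set σ := 1 + 4*η with hσ'
  have hσ : 1 < σ := by linarith
  have ht0 : 0 < t := by linarith
  have f1 : (σ-1)/((σ-1)^2+(zr i).im^2) ≤ 0.4/36 :=
    zfr_aux (by linarith) (by norm_num) (by rw [← one_mul ((zr i).im^2)]; linarith)
  have f2 : (σ-1)/((σ-1)^2+(2*(zr i).im)^2) ≤ 0.4/144 :=
    zfr_aux (by linarith) (by norm_num) (by rw [mul_pow]; linarith)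
  have f3 : (σ-1)/((σ-1)^2+(3*(zr i).im)^2) ≤ 0.4/324 :=
    zfr_aux (by linarith) (by norm_num) (by rw [mul_pow]; linarith)
  have hp : psiR (σ/2+1) ≤ 0.5308 - 1/3.4 := by
    have h := psiR_le' (σ/2+1) (by linarith)
    have h' : Real.log (σ/2+1) ≤ Real.log 1.7 := Real.log_le_log (by linarith) (by linarith)
    have h'' : 1/3.4 ≤ 1/(2*(σ/2+1)) := by
      apply one_div_le_one_div_of_le <;> linarith
    linarith [log_num1]
  have ha : 4/5 ≤ σ/2+1-7/10 := by linarith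
  have l1 := log_one_add_mono (t := t) ha (by positivity)
  have l2 := log_one_add_mono (t := 2*t) ha (by positivity)
  have l3 := log_one_add_mono (t := 3*t) ha (by positivity)
  have e1 : (t/2)^2 = ((zr i).im/2)^2 := by rw [div_pow, div_pow, ht, sq_abs]
  have e2 : (2*t/2)^2 = (2*(zr i).im/2)^2 := by rw [div_pow, div_pow, mul_pow, mul_pow, ht, sq_abs]
  have e3 : (3*t/2)^2 = (3*(zr i).im/2)^2 := by rw [div_pow, div_pow, mul_pow, mul_pow, ht, sq_abs]
  rw [e1] at l1; rw [e2] at l2; rw [e3] at l3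
  have t2 : 2.56/t^2 ≤ 2.56/36 := by
    apply div_le_div_of_nonneg_left (by norm_num) (by norm_num); rw [ht, sq_abs]; exact hg
  have t2' : 2.56/(2*t)^2 ≤ 2.56/144 := by
    apply div_le_div_of_nonneg_left (by norm_num) (by norm_num); rw [mul_pow, ht, sq_abs]; linarith
  have t2'' : 2.56/(3*t)^2 ≤ 2.56/324 := by
    apply div_le_div_of_nonneg_left (by norm_num) (by norm_num); rw [mul_pow, ht, sq_abs]; linarith
  have f0 : (σ-1)/((σ-1)^2+0^2) = 5/4*(1/(5*η)) := by
    rw [hσ']; field_simp; ring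
  have f4 : 1/(σ-(zr i).re) = 1/(5*η) := by
    congr 1; rw [hσ', hη']; ring
  have f5 : 1/η = 5*(1/(5*η)) := by field_simp
  have hlt : Real.log (2*t) = Real.log 2 + Real.log t := Real.log_mul (by norm_num) ht0.ne'
  have hlt3 : Real.log (3*t) = Real.log 3 + Real.log t := Real.log_mul (by norm_num) ht0.ne'
  have hl6 : Real.log (t/6) = Real.log t - Real.log 2 - Real.log 3 := by
    rw [Real.log_div ht0.ne' (by norm_num), show (6:ℝ) = 2*3 by norm_num, Real.log_mul (by norm_num) (by norm_num)]
    ring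
  have hlp := log_pi_ge
  have n2 := Real.log_two_lt_d9
  have n2' := Real.log_two_gt_d9
  have n3 := log_num3
  have n16 := log_num16
  have hT := vm_trig (t := (zr i).im) hσ
  have h0 := D_le (x := 0) hσ
  have h1 := D_le (x := (zr i).im) hσ
  have h2 := D_le (x := 2*(zr i).im) hσ
  have h3 := D_le (x := 3*(zr i).im) hσ
  have g0 := xi_ld_nonneg (s := σ + (0:ℝ)*Complex.I) (by simpa using hσ)
  have g1 := xi_ld_ge i hσ
  have g2 := xi_ld_nonneg (s := σ + (2*(zr i).im:ℝ)*Complex.I) (by simpa using hσ)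
  have g3 := xi_ld_nonneg (s := σ + (3*(zr i).im:ℝ)*Complex.I) (by simpa using hσ)
  rw [f0] at h0
  simp only [ne_eq, OfNat.ofNat_ne_zero, not_false_eq_true, zero_pow, zero_div, add_zero, Real.log_one] at h0
  rw [f4] at g1
  rw [f5, hl6]
  rw [hl6] at hlog
  rw [hlt] at l2
  rw [hlt3] at l3
  have l1' := l1.trans (add_le_add_right t2 _)
  have l2' := l2.trans (add_le_add_right t2' _)
  have l3' := l3.trans (add_le_add_right t2'' _)
  exact zfr_lin hT h0 h1 h2 h3 g0 g1 g2 g3 f1 f2 f3 l1' l2' l3' hp hlp n2 n2' n3 n16 hlog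


lemma pair_lower (i : ZI) {z : ℝ} (hz : 1/2 < z) :
    2*z/(z^2+(zr i).im^2+1) ≤ (1/(((1/2+z:ℝ):ℂ)-zr i)+1/(((1/2+z:ℝ):ℂ)-1+zr i)).re := by
  have h1 := zr_half i
  have h2 := zr_lt_one i
  have hg := zr_im_sq i
  rw [Complex.add_re, one_div (((1/2+z:ℝ):ℂ)-zr i), one_div (((1/2+z:ℝ):ℂ)-1+zr i), Complex.inv_re, Complex.inv_re, Complex.normSq_apply, Complex.normSq_apply]
  simp only [Complex.sub_re, Complex.sub_im, Complex.add_re, Complex.add_im, Complex.ofReal_re, Complex.ofReal_im, Complex.one_re, Complex.one_im]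
  obtain ⟨δ, hδ⟩ : ∃ δ, (zr i).re = 1/2+δ := ⟨(zr i).re - 1/2, by ring⟩
  rw [hδ] at h1 h2 ⊢
  generalize (zr i).im = y at *
  have e1 : (1/2+z-(1/2+δ))*(1/2+z-(1/2+δ)) + (0-y)*(0-y) = (z-δ)^2+y^2 := by ring
  have e2 : (1/2+z-1+(1/2+δ))*(1/2+z-1+(1/2+δ)) + (0-0+y)*(0-0+y) = (z+δ)^2+y^2 := by ring
  have e3 : 1/2+z-(1/2+δ) = z-δ := by ring
  have e4 : 1/2+z-1+(1/2+δ) = z+δ := by ring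
  rw [e1, e2, e3, e4]
  have p1 : 0 < (z-δ)^2+y^2 := by positivity
  have p2 : 0 < (z+δ)^2+y^2 := by positivity
  rw [div_add_div _ _ p1.ne' p2.ne', div_le_div_iff₀ (by positivity) (by positivity)]
  obtain ⟨A, hA⟩ : ∃ A, A = z^2-δ^2+y^2 := ⟨_, rfl⟩
  have n1 : (z-δ)*((z+δ)^2+y^2) + ((z-δ)^2+y^2)*(z+δ) = 2*z*A := by rw [hA]; ring
  have n2 : ((z-δ)^2+y^2)*((z+δ)^2+y^2) = A^2+4*δ^2*y^2 := by rw [hA]; ring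
  rw [n1, n2, show z^2+y^2+1 = A+δ^2+1 by rw [hA]; ring]
  have hd : δ^2 ≤ 1/4 := by nlinarith
  have hAg : y^2 ≤ A := by nlinarith
  have : A^2+4*δ^2*y^2 ≤ A*(A+δ^2+1) := by nlinarith [sq_nonneg δ, sq_nonneg y]
  nlinarith

lemma xi_ld_upper {z : ℝ} (hz : 1/2 < z) :
    (deriv xi ((1/2+z:ℝ):ℂ) / xi ((1/2+z:ℝ):ℂ)).re ≤ 1/(z-1/2) - Real.log Real.pi/2 +
      1/2*(Real.log (z/2+5/4) - 1/(2*(z/2+5/4))) := by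
  have hs : 1 < (((1/2+z:ℝ):ℂ)).re := by rw [Complex.ofReal_re]; linarith
  have h := D_eq hs
  have h2 : 0 ≤ (-(deriv riemannZeta ((1/2+z:ℝ):ℂ) / riemannZeta ((1/2+z:ℝ):ℂ))).re := by
    have := vm_hasSum (σ := 1/2+z) (x := 0) (by linarith)
    rw [Complex.ofReal_zero, zero_mul, add_zero] at this
    refine this.nonneg fun n => ?_
    have := ArithmeticFunction.vonMangoldt_nonneg (n := n)
    rw [zero_mul, Real.cos_zero]
    positivity
  have e1 : (1/(((1/2+z:ℝ):ℂ)-1)).re = 1/(z-1/2) := by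
    rw [show (((1/2+z:ℝ):ℂ)-1) = ((z-1/2:ℝ):ℂ) by push_cast; ring, ← Complex.ofReal_one, ← Complex.ofReal_div, Complex.ofReal_re]
  have e2 : ((1/2+z:ℝ):ℂ)/2+1 = ((z/2+5/4:ℝ):ℂ) := by push_cast; ring
  rw [e1, e2, digamma_ofReal _ (by linarith), Complex.ofReal_re] at h
  have := psiR_le' (z/2+5/4) (by linarith)
  linarith

lemma U_bound (j : ℕ) : (deriv xi ((1/2+6*2^j:ℝ):ℂ) / xi ((1/2+6*2^j:ℝ):ℂ)).re ≤ 0.28+0.35*j := by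
  have hy : (1:ℝ) ≤ 2^j := one_le_pow₀ (by norm_num)
  have h := xi_ld_upper (z := 6*2^j) (by linarith)
  refine h.trans ?_
  have h1 : Real.log (6*2^j/2+5/4) ≤ Real.log (4.25) + j*Real.log 2 := by
    rw [← Real.log_pow, ← Real.log_mul (by norm_num) (by positivity)]
    exact Real.log_le_log (by positivity) (by linarith)
  have h2 : Real.log 4.25 ≤ 2*Real.log 2 + 0.0610 := by
    have h7 := log_le_half (t := 17/16) (by norm_num)
    have : Real.log 4.25 = 2*Real.log 2 + Real.log (17/16) := by
      rw [show (4.25:ℝ) = 2^2*(17/16) by norm_num, Real.log_mul (by norm_num) (by norm_num), Real.log_pow]; norm_num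
    norm_num at *
    linarith
  have h3 : 1/(6*2^j-1/2) - 1/2*(1/(2*(6*2^j/2+5/4))) ≤ (0.124:ℝ) := by
    generalize (2:ℝ)^j = y at *
    have p1 : 0 < 6*y-1/2 := by linarith
    have q1 : 0 < 12*y-1 := by linarith
    have a1 : 1/(6*y-1/2) = 2/(12*y-1) := by
      rw [div_eq_div_iff p1.ne' q1.ne']; ring
    have a2 : 1/2*(1/(2*(6*y/2+5/4))) = 1/(12*y+5) := by
      have : 12*y+5 ≠ 0 := by positivity
      have : 6*y/2+5/4 ≠ 0 := by positivity
      field_simp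
      ring
    rw [a1, a2, div_sub_div _ _ q1.ne' (by positivity), div_le_iff₀ (by positivity)]
    nlinarith
  have n2 := Real.log_two_lt_d9
  have n2' := Real.log_two_gt_d9
  have hlp := log_pi_ge
  have hj : (j:ℝ)*Real.log 2 ≤ j*0.6932 := by gcongr; linarith
  norm_num at *
  linarith

lemma geo_sum (J : ℕ) : ∑ j ∈ Finset.range J, (0.28+0.35*(j:ℝ))/2^j ≤ 1.26 := by
  have : ∑ j ∈ Finset.range J, (0.28+0.35*(j:ℝ))/2^j = 1.26 - (0.56+0.35*(2*J+2))/2^J := by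
    induction J with
    | zero => norm_num
    | succ n ih =>
      rw [Finset.sum_range_succ, ih, pow_succ]
      push_cast
      field_simp
      ring
  rw [this]
  have : 0 ≤ (0.56+0.35*(2*(J:ℝ)+2))/2^J := by positivity
  linarith

lemma neg_log_le {p : ℝ} (h0 : 0 ≤ p) (h1 : p ≤ 1) : -Real.log (1-3/4*p) ≤ p*Real.log 4 := by
  have h := strictConcaveOn_log_Ioi.concaveOn.2 (mem_Ioi.2 (one_pos : (0:ℝ) < 1)) (mem_Ioi.2 (by norm_num : (0:ℝ) < 1/4))
    (by linarith : 0 ≤ 1-p) h0 (by ring)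
  simp only [smul_eq_mul, Real.log_one, mul_zero, zero_add] at h
  rw [one_div, Real.log_inv, show (1-p)*1+p*4⁻¹ = 1-3/4*p by ring] at h
  linarith

lemma log_tele {T : ℝ} (hT : 0 < T) (j : ℕ) :
    Real.log (1+T/(36*4^j)) - Real.log (1+T/(36*4^(j+1))) ≤ T/(36*4^j+T)*Real.log 4 := by
  have hy : (0:ℝ) < 36*4^j := by positivity
  rw [pow_succ, ← mul_assoc]
  generalize (36:ℝ)*4^j = y at *
  have hp1 : T/(y+T) ≤ 1 := by rw [div_le_one (by positivity)]; linarith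
  refine le_trans (le_of_eq ?_) (neg_log_le (p := T/(y+T)) (by positivity) hp1)
  rw [← Real.log_div (by positivity) (by positivity), ← Real.log_inv]
  congr 1
  have : 1-3/4*(T/(y+T)) = (4*y+T)/(4*(y+T)) := by field_simp; ring
  rw [this]
  field_simp

noncomputable def TT (i : ZI) : ℝ := (zr i).im^2+1

lemma log_sum_J (F : Finset ZI) (J : ℕ) :
    ∑ i ∈ F, 12/(TT i)*(Real.log (1+TT i/36) - Real.log (1+TT i/(36*4^J))) ≤ 1.26*Real.log 4 := by
  have hT : ∀ i, 0 < TT i := fun i => by unfold TT; positivity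
  have h1 : ∀ i, 12/(TT i)*(Real.log (1+TT i/36) - Real.log (1+TT i/(36*4^J))) ≤
     Real.log 4 * ∑ j ∈ Finset.range J, 12/(36*4^j+TT i) := by
    intro i
    have h := Finset.sum_range_sub' (fun j:ℕ => Real.log (1+TT i/(36*4^j))) J
    simp only [pow_zero, mul_one] at h
    rw [← h, Finset.mul_sum, Finset.mul_sum]
    refine Finset.sum_le_sum fun j _ => ?_
    refine (mul_le_mul_of_nonneg_left (log_tele (hT i) j) (by have := hT i; positivity)).trans (le_of_eq ?_)
    have := hT i
    field_simp
  refine (Finset.sum_le_sum fun i _ => h1 i).trans ?_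
  rw [← Finset.mul_sum, mul_comm]
  refine mul_le_mul_of_nonneg_right ?_ (Real.log_nonneg (by norm_num))
  rw [Finset.sum_comm]
  refine le_trans (Finset.sum_le_sum fun j _ => ?_) (geo_sum J)
  have hy : (1:ℝ) ≤ 2^j := one_le_pow₀ (by norm_num)
  have hs : 1 < (((1/2+6*2^j:ℝ):ℂ)).re := by rw [Complex.ofReal_re]; linarith
  have h := sum_le_hasSum F (fun i _ => by
    rw [Complex.add_re]; exact add_nonneg (pair_re_nonneg hs.le i).1 (pair_re_nonneg hs.le i).2)
    (Complex.hasSum_re (zr_hasSum (xi_ld_ne hs)))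
  have h2 := h.trans (U_bound j)
  rw [le_div_iff₀ (by positivity), Finset.sum_mul]
  refine le_trans (Finset.sum_le_sum fun i _ => ?_) h2
  refine le_trans (le_of_eq ?_) (pair_lower i (z := 6*2^j) (by linarith))
  have e : (4:ℝ)^j = 2^j*2^j := by rw [← mul_pow]; norm_num
  rw [e, TT]
  have e2 : 36*((2:ℝ)^j*2^j)+((zr i).im^2+1) = (6*2^j)^2+(zr i).im^2+1 := by ring
  rw [e2]
  ring

lemma log_sum (F : Finset ZI) :
    ∑ i ∈ F, 12/(TT i)*(Real.log (1+TT i/36)) ≤ 1.26*Real.log 4 := by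
  have hlim : Tendsto (fun J : ℕ => ∑ i ∈ F, 12/(TT i)*(Real.log (1+TT i/36) - Real.log (1+TT i/(36*4^J)))) atTop
      (𝓝 (∑ i ∈ F, 12/(TT i)*(Real.log (1+TT i/36) - 0))) := by
    refine tendsto_finsetSum _ fun i _ => Tendsto.const_mul _ (Tendsto.const_sub _ ?_)
    have h1 : Tendsto (fun J : ℕ => 1+TT i/(36*4^J)) atTop (𝓝 (1+0)) := by
      refine Tendsto.const_add _ (tendsto_const_nhds.div_atTop ?_)
      exact Tendsto.const_mul_atTop (by norm_num) (tendsto_pow_atTop_atTop_of_one_lt (by norm_num))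
    rw [add_zero] at h1
    have := (Real.continuousAt_log (x := 1) one_ne_zero).tendsto.comp h1
    rwa [Real.log_one] at this
  have := le_of_tendsto' hlim (log_sum_J F)
  simpa using this

lemma q_log (i : ZI) : ‖qq i‖*Real.log (|(zr i).im|/6) ≤ 37/864*(12/(TT i)*(Real.log (1+TT i/36))) := by
  have hg := zr_im_sq i
  have hq := qq_norm_le_inv i
  have h1 : 0 ≤ Real.log (1+TT i/36) := Real.log_nonneg (by unfold TT; linarith)
  have h2 : 2*Real.log (|(zr i).im|/6) ≤ Real.log (1+TT i/36) := by
    rw [show (2:ℝ) = ((2:ℕ):ℝ) by norm_num, ← Real.log_pow]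
    have : (|(zr i).im|/6)^2 = (zr i).im^2/36 := by rw [div_pow, sq_abs]; norm_num
    rw [this]
    apply Real.log_le_log (by positivity)
    unfold TT; linarith
  have h3 : ‖qq i‖ ≤ 37/36/TT i := by
    refine hq.trans ?_
    unfold TT
    rw [div_le_div_iff₀ (by positivity) (by positivity)]
    linarith
  have hT : 0 < TT i := by unfold TT; positivity
  calc ‖qq i‖*Real.log (|(zr i).im|/6) ≤ ‖qq i‖*(1/2*Real.log (1+TT i/36)) :=
        mul_le_mul_of_nonneg_left (by linarith) (norm_nonneg _)
    _ ≤ 37/36/TT i*(1/2*Real.log (1+TT i/36)) := mul_le_mul_of_nonneg_right h3 (by linarith)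
    _ = _ := by ring

lemma S_fin (F : Finset ZI) : ∑ i ∈ F, ‖qq i‖/(1-(zr i).re) ≤ 1.65 := by
  have h1 : ∀ i, ‖qq i‖/(1-(zr i).re) ≤ 18.6*(37/864*(12/(TT i)*(Real.log (1+TT i/36)))) + 10*‖qq i‖ := by
    intro i
    have h := mul_le_mul_of_nonneg_left (zfr i) (norm_nonneg (qq i))
    rw [mul_one_div] at h
    have := q_log i
    nlinarith
  refine (Finset.sum_le_sum fun i _ => h1 i).trans ?_
  rw [Finset.sum_add_distrib, ← Finset.mul_sum, ← Finset.mul_sum, ← Finset.mul_sum]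
  have h2 := log_sum F
  have h3 : ∑ i ∈ F, ‖qq i‖ ≤ 0.0238 :=
    (qq_summable_norm.sum_le_tsum F (fun i _ => norm_nonneg _)).trans Qabs_le
  have h4 : Real.log 4 ≤ 1.3864 := by
    have : Real.log 4 = 2*Real.log 2 := by rw [show (4:ℝ) = 2^2 by norm_num, Real.log_pow]; norm_num
    have := Real.log_two_lt_d9
    norm_num at *
    linarith
  norm_num at *
  linarith

lemma S_summable : Summable (fun i => ‖qq i‖/(1-(zr i).re)) :=
  summable_of_sum_le (fun i => div_nonneg (norm_nonneg _) (by linarith [zr_lt_one i])) S_fin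

lemma S_le : ∑' i, ‖qq i‖/(1-(zr i).re) ≤ 1.65 :=
  Real.tsum_le_of_sum_le (fun i => div_nonneg (norm_nonneg _) (by linarith [zr_lt_one i])) S_fin


def Gd (b : ℝ) (f : ℝ → ℂ) (l : ℂ → ℂ) : Prop :=
  ContinuousOn f (Ici 0) ∧ (∀ u : ℝ, 0 ≤ u → ‖f u‖ ≤ b * Real.exp (u / 2)) ∧
    ∀ z : ℂ, z.re = 1 → ∫ u in Ioi (0:ℝ), Complex.exp (-z * u) * f u = l z

lemma gd_norm {b : ℝ} {f : ℝ → ℂ} {z : ℂ} (hz : z.re = 1)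
    (h2 : ∀ u : ℝ, 0 ≤ u → ‖f u‖ ≤ b * Real.exp (u / 2)) (u : ℝ) (hu : 0 ≤ u) :
    ‖Complex.exp (-z * u) * f u‖ ≤ b * Real.exp (-(1/2) * u) := by
  rw [norm_mul, Complex.norm_exp]
  have : (-z * (u:ℂ)).re = -u := by simp [hz]
  rw [this]
  calc Real.exp (-u) * ‖f u‖ ≤ Real.exp (-u) * (b * Real.exp (u/2)) := by
        gcongr; exact h2 u hu
    _ = b * (Real.exp (-u) * Real.exp (u/2)) := by ring
    _ = _ := by rw [← Real.exp_add]; congr 2; ring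

lemma gd_int {b : ℝ} {f : ℝ → ℂ} {z : ℂ} (hz : z.re = 1) (h1 : ContinuousOn f (Ici 0))
    (h2 : ∀ u : ℝ, 0 ≤ u → ‖f u‖ ≤ b * Real.exp (u / 2)) :
    MeasureTheory.IntegrableOn (fun u : ℝ => Complex.exp (-z * u) * f u) (Ioi 0) := by
  have h0 : MeasureTheory.IntegrableOn (fun u : ℝ => b * Real.exp (-(1/2) * u)) (Ioi 0) :=
    (integrableOn_exp_mul_Ioi (by norm_num) 0).const_mul b
  refine MeasureTheory.Integrable.mono' h0 ?_ ?_
  · apply ContinuousOn.aestronglyMeasurable _ measurableSet_Ioi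
    exact ContinuousOn.mul (by fun_prop) (h1.mono Ioi_subset_Ici_self)
  · refine (MeasureTheory.ae_restrict_iff' measurableSet_Ioi).2 (Eventually.of_forall ?_)
    intro u hu
    exact gd_norm hz h2 u (le_of_lt hu)

lemma Gd.add {b c : ℝ} {f g : ℝ → ℂ} {l m : ℂ → ℂ} (hf : Gd b f l) (hg : Gd c g m) :
    Gd (b + c) (fun u => f u + g u) (fun z => l z + m z) := by
  refine ⟨hf.1.add hg.1, fun u hu => ?_, fun z hz => ?_⟩
  · have := hf.2.1 u hu
    have := hg.2.1 u hu
    have := norm_add_le (f u) (g u)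
    linarith
  · beta_reduce
    rw [← hf.2.2 z hz, ← hg.2.2 z hz, ← MeasureTheory.integral_add
      (gd_int hz hf.1 hf.2.1) (gd_int hz hg.1 hg.2.1)]
    congr 1; ext u; ring

lemma Gd.cmul {b : ℝ} {f : ℝ → ℂ} {l : ℂ → ℂ} (hf : Gd b f l) (a : ℂ) :
    Gd (‖a‖ * b) (fun u => a * f u) (fun z => a * l z) := by
  refine ⟨continuousOn_const.mul hf.1, fun u hu => ?_, fun z hz => ?_⟩
  · rw [norm_mul, mul_assoc]
    exact mul_le_mul_of_nonneg_left (hf.2.1 u hu) (norm_nonneg _)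
  · beta_reduce
    rw [← hf.2.2 z hz, ← MeasureTheory.integral_const_mul]
    congr 1; ext u; ring

lemma Gd.congr {b : ℝ} {f g : ℝ → ℂ} {l m : ℂ → ℂ} (hf : Gd b f l)
    (h1 : ∀ u, 0 ≤ u → g u = f u) (h2 : ∀ z : ℂ, z.re = 1 → m z = l z) : Gd b g m := by
  refine ⟨hf.1.congr h1, fun u hu => ?_, fun z hz => ?_⟩
  · rw [h1 u hu]; exact hf.2.1 u hu
  · rw [h2 z hz, ← hf.2.2 z hz]
    refine MeasureTheory.setIntegral_congr_fun measurableSet_Ioi (fun u hu => ?_)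
    simp only [h1 u (le_of_lt hu)]

lemma gd_tsum {ι : Type} [Countable ι] {f : ι → ℝ → ℂ} {l : ι → ℂ → ℂ} {b : ι → ℝ}
    (hb : Summable b) (hf : ∀ i, Gd (b i) (f i) (l i)) :
    Gd (∑' i, b i) (fun u => ∑' i, f i u) (fun z => ∑' i, l i z) := by
  have key : ∀ i, ∀ u ∈ Ici (0:ℝ), ‖Complex.exp (-(u/2:ℝ)) * f i u‖ ≤ b i := by
    intro i u hu
    rw [norm_mul, Complex.norm_exp]
    have h := (hf i).2.1 u hu
    have : (-((u/2:ℝ):ℂ)).re = -(u/2) := by rw [← Complex.ofReal_neg, Complex.ofReal_re]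
    rw [this]
    calc _ ≤ Real.exp (-(u/2)) * (b i * Real.exp (u/2)) := by gcongr
      _ = b i * (Real.exp (-(u/2)) * Real.exp (u/2)) := by ring
      _ = b i := by rw [← Real.exp_add]; simp
  have hc := continuousOn_tsum (f := fun i (u:ℝ) => Complex.exp (-(u/2:ℝ)) * f i u)
    (fun i => ContinuousOn.mul (by fun_prop) (hf i).1) hb key
  have e1 : ∀ u : ℝ, ∑' i, f i u
      = Complex.exp ((u/2:ℝ)) * ∑' i, Complex.exp (-(u/2:ℝ)) * f i u := by
    intro u
    rw [tsum_mul_left, ← mul_assoc, ← Complex.exp_add]; simp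
  refine ⟨?_, fun u hu => ?_, fun z hz => ?_⟩
  · have : ContinuousOn (fun u : ℝ => Complex.exp ((u/2:ℝ))) (Ici 0) := by fun_prop
    exact (this.mul hc).congr (fun u _ => e1 u)
  · rw [← tsum_mul_right]
    exact tsum_of_norm_bounded (hb.mul_right _).hasSum (fun i => (hf i).2.1 u hu)
  · have h := MeasureTheory.hasSum_integral_of_summable_integral_norm
      (μ := MeasureTheory.volume.restrict (Ioi (0:ℝ)))
      (F := fun i (u:ℝ) => Complex.exp (-z * u) * f i u)
      (fun i => gd_int hz (hf i).1 (hf i).2.1) ?_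
    · have h3 : ∀ i, (∫ u in Ioi (0:ℝ), Complex.exp (-z * u) * f i u) = l i z :=
        fun i => (hf i).2.2 z hz
      simp only [h3] at h
      beta_reduce
      rw [h.tsum_eq]
      congr 1; ext u; rw [tsum_mul_left]
    · refine Summable.of_nonneg_of_le (fun i => MeasureTheory.integral_nonneg (fun _ => norm_nonneg _))
        (fun i => ?_) (hb.mul_right 2)
      have h0 : MeasureTheory.IntegrableOn (fun u : ℝ => b i * Real.exp (-(1/2) * u)) (Ioi 0) :=
        (integrableOn_exp_mul_Ioi (by norm_num) 0).const_mul _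
      calc _ ≤ ∫ u in Ioi (0:ℝ), b i * Real.exp (-(1/2) * u) := by
            refine MeasureTheory.setIntegral_mono_on (gd_int hz (hf i).1 (hf i).2.1).norm h0
              measurableSet_Ioi (fun u hu => gd_norm hz (hf i).2.1 u (le_of_lt hu))
        _ = b i * 2 := by
            rw [MeasureTheory.integral_const_mul, integral_exp_mul_Ioi (by norm_num)]
            norm_num

lemma gd_unique {b c : ℝ} {f g : ℝ → ℂ} {l : ℂ → ℂ} (hf : Gd b f l) (hg : Gd c g l)
    (u : ℝ) (hu : 0 < u) : f u = g u := by
  have hd := hf.add (hg.cmul (-1))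
  set k : ℝ → ℂ := fun u => f u + -1 * g u with hk
  have hz1 : ∀ z : ℂ, z.re = 1 → ∫ u in Ioi (0:ℝ), Complex.exp (-z * u) * k u = 0 := by
    intro z hz
    rw [hd.2.2 z hz]; ring
  set h : ℝ → ℂ := (Ioi (0:ℝ)).indicator (fun u : ℝ => Complex.exp (-1 * u) * k u) with hh
  have hint : MeasureTheory.Integrable h := by
    rw [hh, MeasureTheory.integrable_indicator_iff measurableSet_Ioi]
    exact gd_int (by simp) hd.1 hd.2.1
  have hF : FourierTransform.fourier h = 0 := by
    ext w
    rw [Real.fourier_real_eq_integral_exp_smul]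
    have := hz1 (1 + 2 * Real.pi * w * Complex.I) (by simp)
    rw [Pi.zero_apply, ← this, ← MeasureTheory.integral_indicator measurableSet_Ioi]
    congr 1; ext v
    rw [hh]
    by_cases hv : v ∈ Ioi (0:ℝ)
    · rw [indicator_of_mem hv, indicator_of_mem hv, smul_eq_mul, ← mul_assoc, ← Complex.exp_add]
      congr 2
      push_cast; ring
    · rw [indicator_of_notMem hv, indicator_of_notMem hv, smul_zero]
  have hcont : ContinuousAt h u := by
    have h1 : ContinuousAt (fun u : ℝ => Complex.exp (-1 * u) * k u) u := by
      refine ContinuousAt.mul (by fun_prop) ?_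
      exact hd.1.continuousAt (Ici_mem_nhds hu)
    refine h1.congr ?_
    filter_upwards [Ioi_mem_nhds hu] with v hv
    rw [hh, indicator_of_mem hv]
  have h5 := hint.fourierInv_fourier_eq (by rw [hF]; exact MeasureTheory.integrable_zero _ _ _) hcont
  rw [hF] at h5
  have h6 : h u = 0 := by
    rw [← h5, Real.fourierInv_eq]
    simp
  rw [hh, indicator_of_mem (show u ∈ Ioi (0:ℝ) from hu)] at h6
  have h7 := (mul_eq_zero.1 h6).resolve_left (Complex.exp_ne_zero _)
  rw [hk] at h7
  linear_combination h7

lemma gd_exp {w : ℂ} (hw : w.re ≤ 0) :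
    Gd 1 (fun u => Complex.exp (w * u)) (fun z => 1 / (z - w)) := by
  refine ⟨by fun_prop, fun u hu => ?_, fun z hz => ?_⟩
  · rw [Complex.norm_exp, one_mul, Real.exp_le_exp]
    have : (w * (u:ℂ)).re = w.re * u := by simp
    rw [this]; nlinarith
  · have h : (w - z).re < 0 := by simp [hz]; linarith
    have := integral_exp_mul_complex_Ioi h 0
    calc _ = ∫ u in Ioi (0:ℝ), Complex.exp ((w - z) * u) := by
          congr 1; ext u; rw [← Complex.exp_add]; congr 1; ring
      _ = _ := by
        rw [this]
        have h0 : z - w ≠ 0 := by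
          intro h1; have := congrArg Complex.re h1; simp at this h; linarith
        have h0' : w - z ≠ 0 := by
          intro h1; apply h0; linear_combination -h1
        simp only [Complex.ofReal_zero, mul_zero, Complex.exp_zero]
        field_simp; ring

lemma gd_one : Gd 1 (fun _ => 1) (fun z => 1 / z) := by
  refine (gd_exp (w := 0) (by simp)).congr (fun u _ => by simp) (fun z _ => by simp)

lemma gd_lin : Gd 2 (fun u => (u:ℂ)) (fun z => 1 / z ^ 2) := by
  have h1 : ContinuousOn (fun u : ℝ => (u:ℂ)) (Ici 0) := by fun_prop
  have h2 : ∀ u : ℝ, 0 ≤ u → ‖(u:ℂ)‖ ≤ 2 * Real.exp (u / 2) := by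
    intro u hu
    rw [Complex.norm_real, Real.norm_of_nonneg hu]
    have := Real.add_one_le_exp (u/2)
    linarith
  refine ⟨h1, h2, fun z hz => ?_⟩
  have hz0 : z ≠ 0 := by intro h; rw [h] at hz; simp at hz
  have key := MeasureTheory.integral_Ioi_of_hasDerivAt_of_tendsto (a := (0:ℝ)) (m := (0:ℂ))
    (f := fun u : ℝ => -((u:ℂ) / z + 1 / z ^ 2) * Complex.exp (-z * u))
    (f' := fun u : ℝ => Complex.exp (-z * u) * u) (by fun_prop) ?_ (gd_int hz h1 h2) ?_
  · rw [key]; simp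
  · intro u _
    have e1 : HasDerivAt (fun u : ℝ => (u:ℂ)) 1 u := Complex.ofRealCLM.hasDerivAt
    have e2 := ((e1.const_mul (-z)).cexp)
    have e3 := ((((e1.div_const z).add_const (1/z^2)).fun_neg).fun_mul e2)
    refine e3.congr_deriv ?_
    field_simp; ring
  · rw [tendsto_zero_iff_norm_tendsto_zero]
    have hb : Tendsto (fun u : ℝ => u ^ 1 * Real.exp (-u) * (1/‖z‖) + Real.exp (-u) * (1/‖z‖^2))
        atTop (𝓝 (0 * (1/‖z‖) + 0 * (1/‖z‖^2))) :=
      ((Real.tendsto_pow_mul_exp_neg_atTop_nhds_zero 1).mul_const _).add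
        (Real.tendsto_exp_neg_atTop_nhds_zero.mul_const _)
    rw [show (0:ℝ) * (1/‖z‖) + 0 * (1/‖z‖^2) = 0 by ring] at hb
    refine tendsto_of_tendsto_of_tendsto_of_le_of_le' tendsto_const_nhds hb
      (Eventually.of_forall (fun _ => norm_nonneg _)) ?_
    filter_upwards [eventually_ge_atTop 0] with u hu
    rw [norm_mul, norm_neg, Complex.norm_exp]
    have : (-z * (u:ℂ)).re = -u := by simp [hz]
    rw [this]
    have h3 : ‖(u:ℂ) / z + 1 / z ^ 2‖ ≤ u / ‖z‖ + 1/‖z‖^2 := by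
      refine (norm_add_le _ _).trans (le_of_eq ?_)
      simp [abs_of_nonneg hu]
    calc _ ≤ (u / ‖z‖ + 1/‖z‖^2) * Real.exp (-u) := by gcongr
      _ = _ := by ring


local notation "Λ" => ArithmeticFunction.vonMangoldt

lemma ZI_countable : Countable ZI := by
  have h := qq_summable_norm.countable_support
  have : Function.support (fun i => ‖qq i‖) = univ := by
    ext i
    simp only [Function.mem_support, mem_univ, iff_true]
    rw [norm_ne_zero_iff, qq]
    exact one_div_ne_zero (mul_ne_zero (zr_ne_zero i) (zr_ne_one i))
  rw [this] at h
  exact countable_univ_iff.1 h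

lemma vm_c {s : ℂ} (hs : 1 < s.re) :
    HasSum (fun n : ℕ => (Λ n : ℂ) * Complex.exp (-s * (Real.log n : ℝ)))
      (-(deriv riemannZeta s / riemannZeta s)) := by
  have h := (ArithmeticFunction.LSeriesSummable_vonMangoldt hs).hasSum
  have h3 := ArithmeticFunction.LSeries_vonMangoldt_eq_deriv_riemannZeta_div hs
  rw [LSeries] at h3
  rw [h3, neg_div] at h
  refine h.congr_fun fun n => ?_
  rcases Nat.eq_zero_or_pos n with rfl | hn
  · simp
  · rw [LSeries.term_of_ne_zero hn.ne']
    have hn0 : (n:ℂ) ≠ 0 := by exact_mod_cast hn.ne'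
    rw [Complex.cpow_def_of_ne_zero hn0, div_eq_mul_inv, ← Complex.exp_neg,
      Complex.ofReal_log (by positivity)]
    congr 2
    push_cast; ring

lemma gd_ramp {a : ℝ} (ha : 0 ≤ a) :
    Gd (Real.exp (-(3/2) * a)) (fun u => ((max (Real.exp (-a) - Real.exp (-u)) 0 : ℝ) : ℂ))
      (fun z => Complex.exp (-(1+z) * a) / (z * (z+1))) := by
  refine ⟨by fun_prop, fun u hu => ?_, fun z hz => ?_⟩
  · rw [Complex.norm_real, Real.norm_of_nonneg (le_max_right _ _), ← Real.exp_add]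
    refine max_le ?_ (Real.exp_pos _).le
    rcases le_total a u with h | h
    · have : Real.exp (-a) ≤ Real.exp (-(3/2)*a + u/2) := Real.exp_le_exp.2 (by linarith)
      linarith [Real.exp_pos (-u)]
    · have : Real.exp (-a) ≤ Real.exp (-u) := Real.exp_le_exp.2 (by linarith)
      linarith [Real.exp_pos (-(3/2)*a + u/2)]
  · beta_reduce
    have e1 : ∫ u in Ioi (0:ℝ), Complex.exp (-z * u) * ((max (Real.exp (-a) - Real.exp (-u)) 0 : ℝ) : ℂ)
       = ∫ u in Ioi a, Complex.exp (-z * u) * ((max (Real.exp (-a) - Real.exp (-u)) 0 : ℝ) : ℂ) := by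
      refine (MeasureTheory.setIntegral_eq_of_subset_of_forall_sdiff_eq_zero measurableSet_Ioi
        (Ioi_subset_Ioi ha) ?_)
      rintro u ⟨_, hu⟩
      have hu' : u ≤ a := not_lt.1 hu
      rw [max_eq_right]
      · simp
      · have : Real.exp (-a) ≤ Real.exp (-u) := Real.exp_le_exp.2 (by linarith)
        linarith
    rw [e1]
    have hz1 : (-z).re < 0 := by simp [hz]
    have hz2 : (-z-1).re < 0 := by simp [hz]
    have i1 := (integrableOn_exp_mul_complex_Ioi hz1 a).const_mul (Complex.exp (-a))
    have i2 := integrableOn_exp_mul_complex_Ioi hz2 a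
    have e2 : ∫ u in Ioi a, Complex.exp (-z * u) * ((max (Real.exp (-a) - Real.exp (-u)) 0 : ℝ) : ℂ)
       = ∫ u in Ioi a, (Complex.exp (-a) * Complex.exp (-z * u) - Complex.exp ((-z-1) * u)) := by
      refine MeasureTheory.setIntegral_congr_fun measurableSet_Ioi (fun u hu => ?_)
      have hu' : a < u := hu
      have : Real.exp (-u) ≤ Real.exp (-a) := Real.exp_le_exp.2 (by linarith)
      rw [max_eq_left (by linarith), show (-z-1)*(u:ℂ) = -z*u + -u by ring, Complex.exp_add]
      push_cast; ring
    rw [e2, MeasureTheory.integral_sub i1 i2, MeasureTheory.integral_const_mul,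
      integral_exp_mul_complex_Ioi hz1, integral_exp_mul_complex_Ioi hz2]
    have h0 : z ≠ 0 := by intro h; rw [h] at hz; simp at hz
    have h1 : z + 1 ≠ 0 := by
      intro h; have := congrArg Complex.re h; norm_num [hz] at this
    have h1' : -z - 1 ≠ 0 := by intro h; apply h1; linear_combination -h
    have e3 : Complex.exp ((-z-1)*a) = Complex.exp (-a) * Complex.exp (-z*a) := by
      rw [← Complex.exp_add]; congr 1; ring
    rw [show -(1+z)*(a:ℂ) = (-z-1)*a by ring, e3]
    field_simp
    ring

noncomputable def dd (u : ℝ) : ℝ := ∑' n : ℕ, Λ n * max (Real.exp (-Real.log n) - Real.exp (-u)) 0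

lemma log_nat_nonneg (n : ℕ) : 0 ≤ Real.log n := Real.log_natCast_nonneg n

lemma vm_sum32 : Summable (fun n : ℕ => Λ n * Real.exp (-(3/2) * Real.log n)) := by
  have := (vm_hasSum (σ := 3/2) (x := 0) (by norm_num)).summable
  simpa using this

lemma gd_dd : ∃ b, Gd b (fun u => (dd u : ℂ))
    (fun z => -(deriv riemannZeta (1+z) / riemannZeta (1+z)) / (z*(z+1))) := by
  have h := gd_tsum (b := fun n : ℕ => ‖(Λ n : ℂ)‖ * Real.exp (-(3/2) * Real.log n))
    (by refine vm_sum32.congr fun n => ?_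
        rw [Complex.norm_real, Real.norm_of_nonneg ArithmeticFunction.vonMangoldt_nonneg])
    (fun n => (gd_ramp (log_nat_nonneg n)).cmul (Λ n : ℂ))
  refine ⟨_, h.congr (fun u _ => ?_) (fun z hz => ?_)⟩
  · rw [dd, Complex.ofReal_tsum]
    congr 1; ext n; push_cast; ring
  · have := (vm_c (s := 1+z) (by simp [hz])).div_const (z*(z+1))
    rw [← this.tsum_eq]
    congr 1; ext n; ring

noncomputable def cz : ℝ := -Real.eulerMascheroniConstant/2 - Real.log Real.pi/2

lemma ne_of_re_one {z w : ℂ} (hz : z.re = 1) (hw : 0 ≤ w.re) : z + w ≠ 0 := by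
  intro h; have := congrArg Complex.re h; simp [hz] at this; linarith

lemma dig_sum : HasSum (fun n : ℕ => 1/(2*((n:ℝ)+1)*(2*n+3))) (1 - Real.log 2) := by
  have h := psi_hasSum (z := 3/2) (by norm_num)
  have e : Complex.digamma (3/2) = 2 + (-2*Complex.log 2 - Real.eulerMascheroniConstant) := by
    have := Complex.digamma_apply_add_one (1/2) (by
      intro m h
      have := congrArg Complex.re h
      norm_num at this
      have h2 : (0:ℝ) ≤ m := by positivity
      linarith)
    rw [Complex.digamma_one_half] at this
    rw [show (3/2:ℂ) = 1/2+1 by norm_num, this]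
    norm_num
    ring
  rw [e] at h
  have h2 := Complex.hasSum_re (h.div_const 2)
  have e2 : ((2 + (-2*Complex.log 2 - (Real.eulerMascheroniConstant:ℂ)) + Real.eulerMascheroniConstant) / 2).re = 1 - Real.log 2 := by
    have : (2 + (-2*Complex.log 2 - (Real.eulerMascheroniConstant:ℂ)) + Real.eulerMascheroniConstant) / 2 = ((1 - Real.log 2 : ℝ) : ℂ) := by
      have hl : Complex.log 2 = (Real.log 2 : ℝ) := by rw [Complex.ofReal_log (by norm_num)]; norm_num
      rw [hl]
      push_cast
      ring
    rw [this, Complex.ofReal_re]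
  rw [e2] at h2
  refine h2.congr_fun fun n => ?_
  have : ((1/((n:ℂ)+1) - 1/((n:ℂ)+3/2))/2) = ((1/(2*((n:ℝ)+1)*(2*n+3)) : ℝ) : ℂ) := by
    have h1 : (n:ℂ)+1 ≠ 0 := by exact_mod_cast (show (n:ℝ)+1 ≠ 0 by positivity)
    have h3 : 2*(n:ℂ)+3 ≠ 0 := by exact_mod_cast (show 2*(n:ℝ)+3 ≠ 0 by positivity)
    have h2 : (n:ℂ)+3/2 ≠ 0 := by intro h; apply h3; linear_combination 2*h
    push_cast
    rw [show (n:ℂ)+3/2 = (2*n+3)/2 by ring, one_div_div]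
    obtain ⟨m, hm⟩ : ∃ m, m = 2*(n:ℂ)+3 := ⟨_, rfl⟩
    rw [← hm] at h3 ⊢
    field_simp
    rw [hm]
    ring
  rw [this, Complex.ofReal_re]

noncomputable def tz (n : ℕ) : ℂ := ((1/(2*((n:ℝ)+1)*(2*n+3)) : ℝ) : ℂ)

lemma tz_norm (n : ℕ) : ‖tz n‖ = 1/(2*((n:ℝ)+1)*(2*n+3)) := by
  rw [tz, Complex.norm_real, Real.norm_of_nonneg (by positivity)]

lemma gd_C : ∃ b, Gd b (fun u => ∑' n : ℕ, tz n * (1 - Complex.exp (-(2*n+3) * u)))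
    (fun z => (1/2*Complex.digamma ((1+z)/2+1) + Real.eulerMascheroniConstant/2) / (z*(z+1))) := by
  have h := gd_tsum (b := fun n : ℕ => ‖tz n‖ * (1 + ‖(-1:ℂ)‖*1))
    (by refine (Summable.mul_right _ ?_)
        exact dig_sum.summable.congr fun n => (tz_norm n).symm)
    (fun n : ℕ => (gd_one.add ((gd_exp (w := -(2*(n:ℂ)+3)) (by
      simp only [Complex.neg_re, Complex.add_re, Complex.mul_re, Complex.natCast_re, Complex.natCast_im, Complex.re_ofNat, Complex.im_ofNat]
      have : (0:ℝ) ≤ n := by positivity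
      linarith)).cmul (-1))).cmul (tz n))
  refine ⟨_, h.congr (fun u _ => ?_) (fun z hz => ?_)⟩
  · congr 1; ext n; ring
  · have h2 := psi_hasSum (z := (1+z)/2+1) (by simp [hz])
    have h3 := (h2.mul_left (1/2)).div_const (z*(z+1))
    rw [show (1/2*Complex.digamma ((1+z)/2+1) + Real.eulerMascheroniConstant/2) / (z*(z+1))
      = 1/2*(Complex.digamma ((1+z)/2+1) + Real.eulerMascheroniConstant)/(z*(z+1)) by ring, ← h3.tsum_eq]
    congr 1; ext n
    have h1 : (n:ℂ)+1 ≠ 0 := by exact_mod_cast (show (n:ℝ)+1 ≠ 0 by positivity)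
    have h3 : 2*(n:ℂ)+3 ≠ 0 := by exact_mod_cast (show 2*(n:ℝ)+3 ≠ 0 by positivity)
    have h4 : z ≠ 0 := by simpa using ne_of_re_one hz (w := 0) (by simp)
    have h5 : z + 1 ≠ 0 := ne_of_re_one hz (by simp)
    have h6 : z + (2*(n:ℂ)+3) ≠ 0 := ne_of_re_one hz (by simp; positivity)
    rw [tz, show (n:ℂ) + ((1+z)/2+1) = (z+(2*n+3))/2 by ring, show z - -(2*(n:ℂ)+3) = z + (2*n+3) by ring]
    push_cast
    field_simp
    ring

lemma gd_D : ∃ b, Gd b (fun u => ∑' i, qq i * (1 + Complex.exp (-u) - Complex.exp ((zr i - 1)*u) - Complex.exp (-zr i * u)))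
    (fun z => (deriv xi (1+z) / xi (1+z)) / (z*(z+1))) := by
  have := ZI_countable
  have h := gd_tsum (b := fun i : ZI => ‖qq i‖ * (1 + 1 + ‖(-1:ℂ)‖*1 + ‖(-1:ℂ)‖*1))
    (qq_summable_norm.mul_right _)
    (fun i : ZI => (((gd_one.add (gd_exp (w := -1) (by simp))).add
      ((gd_exp (w := zr i - 1) (by simp; exact (zr_lt_one i).le)).cmul (-1))).add
      ((gd_exp (w := -zr i) (by simp; linarith [zr_half i])).cmul (-1))).cmul (qq i))
  refine ⟨_, h.congr (fun u _ => ?_) (fun z hz => ?_)⟩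
  · congr 1; ext n; rw [neg_one_mul (u:ℂ)]; ring
  · have h3 := (zr_hasSum (s := 1+z) (xi_ne_zero_of_one_le (by simp [hz]))).div_const (z*(z+1))
    rw [← h3.tsum_eq]
    congr 1; ext i
    have h4 : z ≠ 0 := by simpa using ne_of_re_one hz (w := 0) (by simp)
    have h5 : z + 1 ≠ 0 := ne_of_re_one hz (by simp)
    have h6 : z + (1 - zr i) ≠ 0 := ne_of_re_one hz (by simp; exact (zr_lt_one i).le)
    have h7 : z + zr i ≠ 0 := ne_of_re_one hz (by linarith [zr_half i])
    have h8 := zr_ne_zero i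
    have h9 := zr_ne_one i
    rw [qq, show 1 + z - zr i = z + (1 - zr i) by ring, show 1 + z - 1 + zr i = z + zr i by ring,
      show z - (zr i - 1) = z + (1 - zr i) by ring, show z - -zr i = z + zr i by ring,
      show z - -1 = z + 1 by ring]
    field_simp
    ring

lemma explicit_formula (u : ℝ) (hu : 0 < u) :
    (dd u : ℂ) = u - 1 + Complex.exp (-u) + cz * (1 - Complex.exp (-u))
      + ∑' n : ℕ, tz n * (1 - Complex.exp (-(2*n+3) * u))
      - ∑' i, qq i * (1 + Complex.exp (-u) - Complex.exp ((zr i - 1)*u) - Complex.exp (-zr i * u)) := by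
  obtain ⟨b1, h1⟩ := gd_dd
  obtain ⟨b2, h2⟩ := gd_C
  obtain ⟨b3, h3⟩ := gd_D
  have he := gd_exp (w := -1) (by simp)
  have hA := (((gd_lin.add (gd_one.cmul (-1))).add he).add ((gd_one.add (he.cmul (-1))).cmul cz))
  have hR := (hA.add h2).add (h3.cmul (-1))
  have h1' := h1.congr (fun u _ => rfl) (m := fun z => 1 / z ^ 2 + -1 * (1 / z) + 1 / (z - -1) + ↑cz * (1 / z + -1 * (1 / (z - -1))) +
          (1 / 2 * Complex.digamma ((1 + z) / 2 + 1) + ↑Real.eulerMascheroniConstant / 2) / (z * (z + 1)) +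
        -1 * (deriv xi (1 + z) / xi (1 + z) / (z * (z + 1)))) (by
    intro z hz
    have h4 : z ≠ 0 := by simpa using ne_of_re_one hz (w := 0) (by simp)
    have h5 : z + 1 ≠ 0 := ne_of_re_one hz (by simp)
    rw [xi_logderiv (by simp [hz]), show 1 + z - 1 = z by ring, show z - -1 = z + 1 by ring, cz]
    push_cast
    generalize Complex.digamma ((1 + z) / 2 + 1) = A
    generalize deriv riemannZeta (1 + z) / riemannZeta (1 + z) = B
    field_simp
    ring)
  have := gd_unique h1' hR u hu
  rw [this]
  rw [neg_one_mul (u:ℂ)]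
  ring


lemma zsum_bound (u : ℝ) (hu : 0 < u) :
    Summable (fun i => qq i * (Complex.exp ((zr i - 1)*u) + Complex.exp (-zr i * u))) ∧
    ‖∑' i, qq i * (Complex.exp ((zr i - 1)*u) + Complex.exp (-zr i * u))‖ ≤
      0.0238 * Real.exp (-u/2) + min 0.0238 (0.61/u) := by
  have hn : ∀ i, ‖qq i * (Complex.exp ((zr i - 1)*u) + Complex.exp (-zr i * u))‖
      ≤ ‖qq i‖ * Real.exp (-u/2) + ‖qq i‖ * Real.exp (-(1-(zr i).re)*u) := by
    intro i
    rw [norm_mul, ← mul_add]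
    refine mul_le_mul_of_nonneg_left ?_ (norm_nonneg _)
    refine (norm_add_le _ _).trans ?_
    rw [Complex.norm_exp, Complex.norm_exp, add_comm]
    have h1 : ((zr i - 1) * (u:ℂ)).re = -(1-(zr i).re)*u := by simp
    have h2 : (-zr i * (u:ℂ)).re = -(zr i).re*u := by simp
    rw [h1, h2]
    gcongr
    have := zr_half i
    nlinarith
  have hn1 : ∀ i, ‖qq i‖ * Real.exp (-(1-(zr i).re)*u) ≤ ‖qq i‖ := by
    intro i
    refine mul_le_of_le_one_right (norm_nonneg _) ?_
    rw [Real.exp_le_one_iff]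
    have := zr_lt_one i
    nlinarith
  have hn2 : ∀ i, ‖qq i‖ * Real.exp (-(1-(zr i).re)*u) ≤ ‖qq i‖/(1-(zr i).re) * (0.3679/u) := by
    intro i
    have h1 : 0 < 1 - (zr i).re := by linarith [zr_lt_one i]
    rw [div_mul_eq_mul_div, mul_div_assoc]
    refine mul_le_mul_of_nonneg_left ?_ (norm_nonneg _)
    rw [div_div, le_div_iff₀ (by positivity)]
    set x := (1 - (zr i).re)*u with hx
    have e1 : -(1-(zr i).re)*u = -x := by rw [hx]; ring
    rw [e1, mul_comm u, ← hx]
    have h2 := Real.add_one_le_exp (x - 1)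
    have h3 : Real.exp (-x) * x ≤ Real.exp (-x) * Real.exp (x-1) := by
      refine mul_le_mul_of_nonneg_left (by linarith) (Real.exp_pos _).le
    rw [← Real.exp_add, show -x + (x-1) = -1 by ring] at h3
    linarith [Real.exp_neg_one_lt_d9]
  have sm : Summable (fun i => ‖qq i‖ * Real.exp (-(1-(zr i).re)*u)) :=
    Summable.of_nonneg_of_le (fun i => by positivity) hn1 qq_summable_norm
  have sm0 : Summable (fun i => ‖qq i‖ * Real.exp (-u/2)) := qq_summable_norm.mul_right _
  have t1 : ∑' i, ‖qq i‖ * Real.exp (-(1-(zr i).re)*u) ≤ 0.0238 :=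
    (sm.tsum_le_tsum hn1 qq_summable_norm).trans Qabs_le
  have t2 : ∑' i, ‖qq i‖ * Real.exp (-(1-(zr i).re)*u) ≤ 0.61/u := by
    refine (sm.tsum_le_tsum hn2 (S_summable.mul_right _)).trans ?_
    rw [tsum_mul_right]
    calc _ ≤ 1.65 * (0.3679/u) := by
          refine mul_le_mul_of_nonneg_right S_le (by positivity)
      _ = (1.65*0.3679)/u := by ring
      _ ≤ _ := by gcongr; norm_num
  refine ⟨Summable.of_norm_bounded (sm0.add sm) hn, ?_⟩
  refine (tsum_of_norm_bounded (sm0.add sm).hasSum hn).trans ?_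
  rw [sm0.tsum_add sm, tsum_mul_right]
  refine add_le_add ?_ (le_min t1 t2)
  exact mul_le_mul_of_nonneg_right Qabs_le (Real.exp_pos _).le

lemma log_two_pi_le : Real.log (2*Real.pi) ≤ 1.9 := by
  rw [Real.log_le_iff_le_exp (by positivity)]
  have h1 := Real.pi_lt_d2
  have h2 : Real.exp 1.9 = Real.exp 1 ^ 2 * Real.exp (-0.1) := by
    rw [← Real.exp_nat_mul, ← Real.exp_add]; norm_num
  have h3 := Real.exp_one_gt_d9
  have h4 := Real.add_one_le_exp (-0.1:ℝ)
  rw [h2]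
  have h5 : (2.718:ℝ)^2 ≤ Real.exp 1 ^ 2 := by gcongr; linarith
  nlinarith

noncomputable def ee (u : ℝ) : ℝ := 1.9 * Real.exp (-u) + 0.0238 * Real.exp (-u/2) + min 0.0238 (0.61/u)

lemma dd_bound (u : ℝ) (hu : 0 < u) :
    |dd u - (u - 1 - Real.eulerMascheroniConstant)| ≤ ee u := by
  have h := explicit_formula u hu
  obtain ⟨hs, hb⟩ := zsum_bound u hu
  set Z := ∑' i, qq i * (Complex.exp ((zr i - 1)*u) + Complex.exp (-zr i * u)) with hZ
  have e1 : ∑' i, qq i * (1 + Complex.exp (-u) - Complex.exp ((zr i - 1)*u) - Complex.exp (-zr i * u))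
      = Qsum * (1 + Complex.exp (-u)) - Z := by
    rw [← (((qq_hasSum).mul_right (1 + Complex.exp (-u))).sub hs.hasSum).tsum_eq]
    congr 1; ext i; ring
  set t : ℕ → ℝ := fun n => 1/(2*((n:ℝ)+1)*(2*n+3)) with ht
  have ht0 : ∀ n, 0 ≤ t n := fun n => by rw [ht]; positivity
  have hx : ∀ n : ℕ, t n * Real.exp (-(2*n+3)*u) ≤ t n * Real.exp (-u) := by
    intro n
    refine mul_le_mul_of_nonneg_left ?_ (ht0 n)
    rw [Real.exp_le_exp]
    have : (0:ℝ) ≤ n := by positivity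
    nlinarith
  have sT : Summable (fun n : ℕ => t n * Real.exp (-(2*n+3)*u)) :=
    Summable.of_nonneg_of_le (fun n => mul_nonneg (ht0 n) (Real.exp_pos _).le) hx
      (dig_sum.summable.mul_right _)
  set T := ∑' n : ℕ, t n * Real.exp (-(2*n+3)*u) with hT
  have e2 : ∑' n : ℕ, tz n * (1 - Complex.exp (-(2*n+3) * u)) = ((1 - Real.log 2 - T : ℝ) : ℂ) := by
    rw [← (dig_sum.sub sT.hasSum).tsum_eq, Complex.ofReal_tsum]
    congr 1; ext n; rw [tz, ht]; push_cast; ring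
  have hT0 : 0 ≤ T := tsum_nonneg (fun n => mul_nonneg (ht0 n) (Real.exp_pos _).le)
  have hT1 : T ≤ (1 - Real.log 2) * Real.exp (-u) := by
    have := sT.tsum_le_tsum hx (dig_sum.summable.mul_right _)
    rwa [tsum_mul_right, dig_sum.tsum_eq] at this
  rw [e1, e2] at h
  have hl : Real.log (4*Real.pi) = 2*Real.log 2 + Real.log Real.pi := by
    rw [Real.log_mul (by norm_num) Real.pi_ne_zero, show (4:ℝ) = 2^2 by norm_num, Real.log_pow]
    norm_num
  have hl2 : Real.log (2*Real.pi) = Real.log 2 + Real.log Real.pi :=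
    Real.log_mul (by norm_num) Real.pi_ne_zero
  have key : ((dd u - (u - 1 - Real.eulerMascheroniConstant) : ℝ) : ℂ)
      = ((Real.log (2*Real.pi) * Real.exp (-u) - T : ℝ) : ℂ) + Z := by
    push_cast
    rw [h, hl2, Qsum, cz, hl]
    push_cast
    ring
  have h3 := congrArg norm key
  rw [Complex.norm_real, Real.norm_eq_abs] at h3
  rw [h3]
  refine (norm_add_le _ _).trans ?_
  rw [Complex.norm_real, Real.norm_eq_abs, ee, add_assoc]
  refine add_le_add ?_ hb
  have hE := Real.exp_pos (-u)
  have h4 := log_two_pi_le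
  have h5 := log_pi_ge
  have h6 := Real.log_two_gt_d9
  rw [abs_le]
  constructor
  · rw [hl2]; nlinarith
  · nlinarith


local notation "γ" => Real.eulerMascheroniConstant

noncomputable def pk (a u : ℝ) : ℝ :=
  if a ≤ u then Real.exp (-a) * (1/a - 1/u - 1/u^2) + Real.exp (-u)/u^2 else 0

lemma pk_deriv {a u : ℝ} (ha : 0 < a) (hu : 0 < u) :
    HasDerivAt (pk a) ((1/u^2 + 2/u^3) * max (Real.exp (-a) - Real.exp (-u)) 0) u := by
  have hg : ∀ v : ℝ, 0 < v → HasDerivAt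
      (fun u => Real.exp (-a) * (1/a - 1/u - 1/u^2) + Real.exp (-u)/u^2)
      ((1/v^2 + 2/v^3) * (Real.exp (-a) - Real.exp (-v))) v := by
    intro v hv
    have e1 := (hasDerivAt_id v).fun_inv hv.ne'
    have e2 := ((hasDerivAt_id v).fun_pow 2).fun_inv (by simp; exact hv.ne')
    have e3 := (hasDerivAt_id v).fun_neg.exp
    have := (((e1.const_sub (1/a)).fun_sub e2).const_mul (Real.exp (-a))).fun_add (e3.fun_mul e2)
    simp only [id] at this
    refine (this.congr_of_eventuallyEq (Eventually.of_forall fun w => ?_)).congr_deriv ?_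
    · simp [div_eq_mul_inv]
    · norm_num
      field_simp
      ring
  rcases lt_trichotomy u a with h | h | h
  · rw [max_eq_right (by have := Real.exp_le_exp.2 (by linarith : -a ≤ -u); linarith), mul_zero]
    refine (hasDerivAt_const u (0:ℝ)).congr_of_eventuallyEq ?_
    filter_upwards [Iio_mem_nhds h] with v hv
    rw [pk, if_neg (not_le.2 hv)]
  · subst h
    rw [sub_self, max_self, mul_zero]
    have hz : pk u u = 0 := by
      rw [pk, if_pos le_rfl]; field_simp; ring
    have h1 : HasDerivWithinAt (pk u) 0 (Iic u) u := by
      refine (hasDerivWithinAt_const u (Iic u) (0:ℝ)).congr (fun v hv => ?_) hz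
      rcases eq_or_lt_of_le (show v ≤ u from hv) with h | h
      · rw [h, hz]
      · rw [pk, if_neg (not_le.2 h)]
    have h2 : HasDerivWithinAt (pk u) 0 (Ici u) u := by
      have := (hg u hu).hasDerivWithinAt (s := Ici u)
      rw [sub_self, mul_zero] at this
      refine this.congr (fun v hv => ?_) ?_
      · rw [pk, if_pos (mem_Ici.1 hv)]
      · rw [pk, if_pos le_rfl]
    have := h1.union h2
    rw [Iic_union_Ici] at this
    exact hasDerivWithinAt_univ.1 this
  · rw [max_eq_left (by have := Real.exp_le_exp.2 (by linarith : -u ≤ -a); linarith)]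
    refine (hg u hu).congr_of_eventuallyEq ?_
    filter_upwards [Ioi_mem_nhds h] with v hv
    rw [pk, if_pos (le_of_lt hv)]

noncomputable def GG (u : ℝ) : ℝ := ∑' n : ℕ, Λ n * pk (Real.log n) u

lemma lt_log_of {N n : ℕ} {u : ℝ} (hN : Real.exp u < N) (hn : n ∉ Finset.range N) :
    u < Real.log n := by
  have h1 : (N:ℝ) ≤ n := by exact_mod_cast (by simpa using hn)
  have h0 := Real.exp_pos u
  rw [Real.lt_log_iff_exp_lt (by linarith)]
  linarith

lemma GG_eq {N : ℕ} {u : ℝ} (hN : Real.exp u < N) :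
    GG u = ∑ n ∈ Finset.range N, Λ n * pk (Real.log n) u := by
  refine tsum_eq_sum fun n hn => ?_
  rw [pk, if_neg (not_le.2 (lt_log_of hN hn)), mul_zero]

lemma dd_eq {N : ℕ} {u : ℝ} (hN : Real.exp u < N) :
    dd u = ∑ n ∈ Finset.range N, Λ n * max (Real.exp (-Real.log n) - Real.exp (-u)) 0 := by
  refine tsum_eq_sum fun n hn => ?_
  have := lt_log_of hN hn
  have h2 : Real.exp (-Real.log n) ≤ Real.exp (-u) := Real.exp_le_exp.2 (by linarith)
  rw [max_eq_right (by linarith), mul_zero]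

lemma GG_deriv {u : ℝ} (hu : 0 < u) : HasDerivAt GG ((1/u^2 + 2/u^3) * dd u) u := by
  obtain ⟨N, hN⟩ := exists_nat_gt (Real.exp (u+1))
  have h1 : HasDerivAt (fun u => ∑ n ∈ Finset.range N, Λ n * pk (Real.log n) u)
      (∑ n ∈ Finset.range N, Λ n * ((1/u^2 + 2/u^3) * max (Real.exp (-Real.log n) - Real.exp (-u)) 0)) u := by
    refine HasDerivAt.fun_sum fun n _ => ?_
    rcases lt_or_ge n 2 with h | h
    · have : Λ n = 0 := by interval_cases n <;> simp
      rw [this]; simpa using hasDerivAt_const u (0:ℝ)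
    · exact (pk_deriv (Real.log_pos (by exact_mod_cast h)) hu).const_mul _
  have hN' : Real.exp u < N := lt_trans (Real.exp_lt_exp.2 (by linarith)) hN
  rw [dd_eq hN', Finset.mul_sum]
  refine (h1.congr_of_eventuallyEq ?_).congr_deriv ?_
  · filter_upwards [Iio_mem_nhds (show u < u + 1 by linarith)] with v hv
    exact GG_eq (lt_trans (Real.exp_lt_exp.2 hv) hN)
  · exact Finset.sum_congr rfl fun n _ => by ring

noncomputable def HH (u : ℝ) : ℝ :=
  GG u - (Real.log u + 1 - 1/u - (1/u + 1/u^2) * (u - 1 - γ))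

lemma kk_deriv {u : ℝ} (hu : 0 < u) :
    HasDerivAt (fun u : ℝ => 1/u + 1/u^2) (-(1/u^2 + 2/u^3)) u := by
  have e1 := (hasDerivAt_id u).fun_inv hu.ne'
  have e2 := ((hasDerivAt_id u).fun_pow 2).fun_inv (by simp; exact hu.ne')
  refine ((e1.fun_add e2).congr_of_eventuallyEq (Eventually.of_forall fun w => ?_)).congr_deriv ?_
  · simp
  · norm_num
    field_simp
    ring

lemma HH_deriv {u : ℝ} (hu : 0 < u) :
    HasDerivAt HH ((1/u^2 + 2/u^3) * (dd u - (u - 1 - γ))) u := by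
  have e1 := (hasDerivAt_id u).fun_inv hu.ne'
  have h := (GG_deriv hu).fun_sub ((((Real.hasDerivAt_log hu.ne').add_const 1).fun_sub e1).fun_sub
    ((kk_deriv hu).fun_mul (((hasDerivAt_id u).sub_const 1).sub_const γ)))
  refine (h.congr_of_eventuallyEq (Eventually.of_forall fun w => ?_)).congr_deriv ?_
  · rw [HH]; simp
  · simp only [id]
    field_simp
    ring

lemma ee_anti {u v : ℝ} (hu : 0 < u) (h : u ≤ v) : ee v ≤ ee u := by
  rw [ee, ee]
  gcongr

lemma HH_mono {u0 : ℝ} (hu : 0 < u0) :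
    MonotoneOn (fun u => HH u - ee u0 * (1/u + 1/u^2)) (Ici u0) ∧
    AntitoneOn (fun u => HH u + ee u0 * (1/u + 1/u^2)) (Ici u0) := by
  have d1 : ∀ u, u0 ≤ u → HasDerivAt (fun u => HH u - ee u0 * (1/u + 1/u^2))
      ((1/u^2 + 2/u^3) * (dd u - (u - 1 - γ) + ee u0)) u := by
    intro u h
    have hp : 0 < u := by linarith
    exact ((HH_deriv hp).fun_sub ((kk_deriv hp).const_mul _)).congr_deriv (by ring)
  have d2 : ∀ u, u0 ≤ u → HasDerivAt (fun u => HH u + ee u0 * (1/u + 1/u^2))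
      ((1/u^2 + 2/u^3) * (dd u - (u - 1 - γ) - ee u0)) u := by
    intro u h
    have hp : 0 < u := by linarith
    exact ((HH_deriv hp).fun_add ((kk_deriv hp).const_mul _)).congr_deriv (by ring)
  have bd : ∀ u, u0 ≤ u → |dd u - (u - 1 - γ)| ≤ ee u0 := fun u h =>
    (dd_bound u (by linarith)).trans (ee_anti hu h)
  constructor
  · refine monotoneOn_of_deriv_nonneg (convex_Ici _)
      (fun u h => (d1 u h).continuousAt.continuousWithinAt)
      (fun u h => (d1 u (interior_subset h)).differentiableAt.differentiableWithinAt) ?_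
    intro u h
    have h' : u0 ≤ u := interior_subset h
    have hp : 0 < u := by linarith
    rw [(d1 u h').deriv]
    have := (abs_le.1 (bd u h')).1
    exact mul_nonneg (by positivity) (by linarith)
  · refine antitoneOn_of_deriv_nonpos (convex_Ici _)
      (fun u h => (d2 u h).continuousAt.continuousWithinAt)
      (fun u h => (d2 u (interior_subset h)).differentiableAt.differentiableWithinAt) ?_
    intro u h
    have h' : u0 ≤ u := interior_subset h
    have hp : 0 < u := by linarith
    rw [(d2 u h').deriv]
    have := (abs_le.1 (bd u h')).2
    exact mul_nonpos_of_nonneg_of_nonpos (by positivity) (by linarith)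

lemma kk_tendsto : Tendsto (fun u : ℝ => 1/u + 1/u^2) atTop (𝓝 0) := by
  have h1 : Tendsto (fun u : ℝ => u⁻¹) atTop (𝓝 0) := tendsto_inv_atTop_zero
  have := h1.add (h1.mul h1)
  simp only [mul_zero, add_zero] at this
  refine this.congr fun u => ?_
  ring

lemma ee_pos {u : ℝ} (hu : 0 < u) : 0 ≤ ee u := by
  rw [ee]; have : 0 ≤ min 0.0238 (0.61/u) := le_min (by norm_num) (by positivity)
  positivity

lemma HH_limit : ∃ K : ℝ, Tendsto HH atTop (𝓝 K) ∧
    ∀ u, 0 < u → |HH u - K| ≤ ee u * (1/u + 1/u^2) := by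
  obtain ⟨m1, m2⟩ := HH_mono (u0 := 1) one_pos
  set c := ee 1
  have hc : 0 ≤ c := ee_pos one_pos
  set f : ℝ → ℝ := fun v => HH (max v 1) - c * (1/(max v 1) + 1/(max v 1)^2) with hf
  have fm : Monotone f := fun v w h => m1 (le_max_right v 1) (le_max_right w 1) (max_le_max_right 1 h)
  have fb : BddAbove (range f) := by
    refine ⟨HH 1 + c * (1/1+1/1^2), ?_⟩
    rintro _ ⟨v, rfl⟩
    have h1 := m2 self_mem_Ici (show max v 1 ∈ Ici 1 from le_max_right v 1) (le_max_right v 1)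
    have h2 : 0 < max v 1 := lt_of_lt_of_le one_pos (le_max_right v 1)
    have h3 : 0 ≤ c * (1/(max v 1) + 1/(max v 1)^2) := by positivity
    simp only [hf]
    simp only at h1
    linarith
  have ht := tendsto_atTop_ciSup fm fb
  set K := ⨆ i, f i
  have hH : Tendsto HH atTop (𝓝 K) := by
    have := ht.add (kk_tendsto.const_mul c)
    rw [mul_zero, add_zero] at this
    refine this.congr' ?_
    filter_upwards [eventually_ge_atTop 1] with v hv
    simp only [hf, max_eq_left hv]
    ring
  refine ⟨K, hH, fun u hu => ?_⟩
  obtain ⟨n1, n2⟩ := HH_mono hu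
  have t1 := hH.sub (kk_tendsto.const_mul (ee u))
  have t2 := hH.add (kk_tendsto.const_mul (ee u))
  rw [mul_zero, sub_zero] at t1
  rw [mul_zero, add_zero] at t2
  have a1 := ge_of_tendsto t1 (b := HH u - ee u * (1/u+1/u^2)) (by
    filter_upwards [eventually_ge_atTop u] with v hv
    exact n1 self_mem_Ici hv hv)
  have a2 := le_of_tendsto t2 (b := HH u + ee u * (1/u+1/u^2)) (by
    filter_upwards [eventually_ge_atTop u] with v hv
    exact n2 self_mem_Ici hv hv)
  rw [abs_le]; constructor <;> linarith



lemma pp_hasSum {f : ℕ → ℝ} {a : ℝ} (hf : ∀ n, ¬ IsPrimePow n → f n = 0) :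
    HasSum (fun x : Nat.Primes × ℕ => f ((x.1:ℕ)^(x.2+1))) a ↔ HasSum f a := by
  have h1 : Function.support f ⊆ {n | IsPrimePow n} := by
    intro n hn
    by_contra h
    exact hn (hf n h)
  rw [← hasSum_subtype_iff_of_support_subset h1]
  exact Nat.Primes.prodNatEquiv.hasSum_iff (f := f ∘ Subtype.val)

noncomputable def cn (n : ℕ) : ℝ := Λ n / Real.log n * Real.exp (-Real.log n)

lemma cn_nonneg (n : ℕ) : 0 ≤ cn n := by
  have := ArithmeticFunction.vonMangoldt_nonneg (n := n)
  have := log_nat_nonneg n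
  rw [cn]; positivity

lemma cn_pp (p : Nat.Primes) (k : ℕ) :
    Λ ((p:ℕ)^(k+1)) / Real.log (((p:ℕ)^(k+1) : ℕ):ℝ) = 1/((k:ℝ)+1) := by
  rw [ArithmeticFunction.vonMangoldt_apply_pow (by omega), ArithmeticFunction.vonMangoldt_apply_prime p.2]
  push_cast
  rw [Real.log_pow]
  have : 0 < Real.log (p:ℕ) := Real.log_pos (by exact_mod_cast p.2.one_lt)
  push_cast
  field_simp

lemma logzeta {s : ℝ} (hs : 1 < s) :
    HasSum (fun n : ℕ => Λ n / Real.log n * Real.exp (-s * Real.log n)) (Real.log (riemannZeta s).re) ∧ 0 < (riemannZeta s).re := by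
  have sm : Summable (fun n : ℕ => Λ n / Real.log n * Real.exp (-s * Real.log n)) := by
    have h := ((vm_hasSum (σ := s) (x := 0) hs).summable).mul_right (1/Real.log 2)
    refine Summable.of_nonneg_of_le (fun n => ?_) (fun n => ?_) h
    · have := ArithmeticFunction.vonMangoldt_nonneg (n := n)
      have := log_nat_nonneg n
      positivity
    · have h1 := ArithmeticFunction.vonMangoldt_nonneg (n := n)
      rcases lt_or_ge n 2 with h | h
      · have : Λ n = 0 := by interval_cases n <;> simp
        rw [this]; simp
      · have h2 : Real.log 2 ≤ Real.log n := Real.log_le_log (by norm_num) (by exact_mod_cast h)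
        have h3 : 0 < Real.log 2 := Real.log_pos (by norm_num)
        rw [zero_mul, Real.cos_zero, mul_one, div_mul_eq_mul_div, mul_one_div]
        gcongr
  obtain ⟨T, hT⟩ := sm
  have hT2 := (pp_hasSum (by
    intro n hn
    rw [ArithmeticFunction.vonMangoldt_eq_zero_iff.2 hn]; simp)).2 hT
  have hx : ∀ p : Nat.Primes, 0 < Real.exp (-s * Real.log (p:ℕ)) ∧ Real.exp (-s * Real.log (p:ℕ)) < 1 := by
    intro p
    refine ⟨Real.exp_pos _, ?_⟩
    rw [Real.exp_lt_one_iff]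
    have : 0 < Real.log (p:ℕ) := Real.log_pos (by exact_mod_cast p.2.one_lt)
    nlinarith
  have hT3 : HasSum (fun p : Nat.Primes => -Real.log (1 - Real.exp (-s * Real.log (p:ℕ)))) T := by
    refine hT2.prod_fiberwise fun p => ?_
    have := Real.hasSum_pow_div_log_of_abs_lt_one (x := Real.exp (-s * Real.log (p:ℕ))) (by
      rw [abs_of_pos (hx p).1]; exact (hx p).2)
    refine this.congr_fun fun k => ?_
    rw [cn_pp]
    push_cast
    rw [Real.log_pow, ← Real.exp_nat_mul]
    rw [one_div, div_eq_inv_mul]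
    congr 2
    push_cast; ring
  have hE := riemannZeta_eulerProduct_exp_log (s := (s:ℂ)) (by simpa using hs)
  have e1 : ∑' (p : Nat.Primes), -Complex.log (1 - ((p:ℕ):ℂ) ^ (-(s:ℂ))) = (T : ℂ) := by
    rw [← hT3.tsum_eq, Complex.ofReal_tsum]
    congr 1; ext p
    have hp0 : ((p:ℕ):ℂ) ≠ 0 := by exact_mod_cast p.2.ne_zero
    have : ((p:ℕ):ℂ) ^ (-(s:ℂ)) = ((Real.exp (-s * Real.log (p:ℕ)) : ℝ) : ℂ) := by
      rw [Complex.cpow_def_of_ne_zero hp0]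
      push_cast
      congr 1; ring
    rw [this, ← Complex.ofReal_one, ← Complex.ofReal_sub, ← Complex.ofReal_log (by linarith [(hx p).2])]
    push_cast; ring
  rw [e1] at hE
  rw [← hE, ← Complex.ofReal_exp, Complex.ofReal_re, Real.log_exp]
  exact ⟨hT, Real.exp_pos _⟩

noncomputable def AA (u : ℝ) : ℝ := ∑ n ∈ Finset.range (⌊Real.exp u⌋₊ + 1), cn n

lemma log_le_of_mem {u : ℝ} (hu : 0 < u) {n : ℕ} (hn : n ∈ Finset.range (⌊Real.exp u⌋₊ + 1)) :
    Real.log n ≤ u := by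
  rcases Nat.eq_zero_or_pos n with rfl | h
  · simpa using hu.le
  · rw [Real.log_le_iff_le_exp (by exact_mod_cast h)]
    exact (Nat.le_floor_iff (Real.exp_pos _).le).1 (by simpa [Nat.lt_succ_iff] using hn)

lemma W_eq {u : ℝ} (hu : 0 < u) : GG u + (1/u + 1/u^2) * dd u =
    ∑ n ∈ Finset.range (⌊Real.exp u⌋₊ + 1), Λ n * (Real.exp (-Real.log n)/Real.log n - Real.exp (-u)/u) := by
  have hN : Real.exp u < (⌊Real.exp u⌋₊ + 1 : ℕ) := by
    push_cast; exact Nat.lt_floor_add_one _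
  rw [GG_eq hN, dd_eq hN, Finset.mul_sum, ← Finset.sum_add_distrib]
  refine Finset.sum_congr rfl fun n hn => ?_
  have h1 := log_le_of_mem hu hn
  have h2 := Real.exp_le_exp.2 (by linarith : -u ≤ -Real.log n)
  rw [pk, if_pos h1, max_eq_left (by linarith)]
  field_simp
  ring

lemma W_eq_HH {u : ℝ} (hu : 0 < u) : GG u + (1/u + 1/u^2) * dd u =
    HH u + 1 + Real.log u - 1/u + (1/u+1/u^2)*(dd u - (u - 1 - γ)) := by
  rw [HH]; ring

lemma W_eq_AA {u : ℝ} (hu : 0 < u) : GG u + (1/u + 1/u^2) * dd u =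
    AA u - Chebyshev.psi (Real.exp u) * (Real.exp (-u)/u) := by
  rw [W_eq hu, AA, Chebyshev.psi, Finset.sum_mul]
  have : ∑ n ∈ Finset.Ioc 0 ⌊Real.exp u⌋₊, Λ n * (Real.exp (-u)/u)
      = ∑ n ∈ Finset.range (⌊Real.exp u⌋₊ + 1), Λ n * (Real.exp (-u)/u) := by
    refine Finset.sum_subset (fun n hn => by simp at hn ⊢; omega) (fun n hn hn' => ?_)
    have : n = 0 := by simp at hn hn'; omega
    rw [this]; simp
  rw [this, ← Finset.sum_sub_distrib]
  refine Finset.sum_congr rfl fun n _ => ?_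
  rw [cn]; ring

lemma AA_tendsto {K : ℝ} (hK : Tendsto HH atTop (𝓝 K)) :
    Tendsto (fun u => AA u - Real.log u) atTop (𝓝 (K+1)) := by
  have hi : Tendsto (fun u : ℝ => u⁻¹) atTop (𝓝 0) := tendsto_inv_atTop_zero
  have h1 : Tendsto (fun u => Chebyshev.psi (Real.exp u) * (Real.exp (-u)/u)) atTop (𝓝 0) := by
    have hb : Tendsto (fun u : ℝ => (Real.log 4 + 4) * u⁻¹) atTop (𝓝 0) := by
      simpa using hi.const_mul (Real.log 4 + 4)
    refine tendsto_of_tendsto_of_tendsto_of_le_of_le' tendsto_const_nhds hb ?_ ?_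
    · filter_upwards [eventually_gt_atTop 0] with u hu
      have := Chebyshev.psi_nonneg (Real.exp u)
      positivity
    · filter_upwards [eventually_gt_atTop 0] with u hu
      have := Chebyshev.psi_le_const_mul_self (Real.exp_pos u).le
      calc _ ≤ ((Real.log 4 + 4) * Real.exp u) * (Real.exp (-u)/u) := by gcongr
        _ = (Real.log 4 + 4) * u⁻¹ * (Real.exp u * Real.exp (-u)) := by ring
        _ = _ := by rw [← Real.exp_add]; simp
  have h2 : Tendsto (fun u => (1/u+1/u^2)*(dd u - (u - 1 - γ))) atTop (𝓝 0) := by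
    have hb : Tendsto (fun u : ℝ => (1/u+1/u^2) * ee 1) atTop (𝓝 0) := by
      simpa using kk_tendsto.mul_const (ee 1)
    refine squeeze_zero_norm' ?_ hb
    filter_upwards [eventually_ge_atTop 1] with u hu
    have h0 : 0 < u := by linarith
    rw [norm_mul, Real.norm_of_nonneg (by positivity), Real.norm_eq_abs]
    gcongr
    exact (dd_bound u h0).trans (ee_anti one_pos hu)
  have h3 := (((hK.add_const 1).sub hi).add h2).add h1
  rw [sub_zero, add_zero, add_zero] at h3
  refine h3.congr' ?_
  filter_upwards [eventually_gt_atTop 0] with u hu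
  have e1 := W_eq_HH hu
  have e2 := W_eq_AA hu
  rw [e1] at e2
  rw [inv_eq_one_div]
  linarith

noncomputable def gg (n : ℕ) : ℕ := ⌈Real.log n⌉₊
noncomputable def bm (m : ℕ) : ℝ := ∑' n : (gg ⁻¹' {m} : Set ℕ), cn n

lemma bm_sum (M : ℕ) (hM : 0 < M) : ∑ m ∈ Finset.range (M+1), bm m = AA M := by
  have hM' : (0:ℝ) < M := by exact_mod_cast hM
  set f : ℕ → ℝ := fun n => if gg n ≤ M then cn n else 0 with hf
  have h1 : HasSum f (AA M) := by
    have : AA M = ∑ n ∈ Finset.range (⌊Real.exp M⌋₊ + 1), f n := by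
      rw [AA]
      refine Finset.sum_congr rfl fun n hn => ?_
      rw [hf]; simp only
      rw [if_pos]
      exact Nat.ceil_le.2 (log_le_of_mem hM' hn)
    rw [this]
    refine hasSum_sum_of_ne_finset_zero fun n hn => ?_
    rw [hf]; simp only
    rw [if_neg]
    intro h
    have h2 : Real.log n ≤ M := Nat.ceil_le.1 h
    have h3 := lt_log_of (u := M) (N := ⌊Real.exp M⌋₊ + 1) (by push_cast; exact Nat.lt_floor_add_one _) hn
    linarith
  have h2 := h1.tsum_fiberwise gg
  have h3 : ∀ m, (∑' b : (gg ⁻¹' {m} : Set ℕ), f b) = if m ≤ M then bm m else 0 := by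
    intro m
    split_ifs with h
    · rw [bm]; congr 1; ext ⟨b, hb⟩
      have : gg b = m := hb
      simp [hf, this, h]
    · have : ∀ b : (gg ⁻¹' {m} : Set ℕ), f b = 0 := by
        rintro ⟨b, hb⟩
        have : gg b = m := hb
        simp [hf, this, h]
      simp [this]
  simp only [h3] at h2
  have h4 := hasSum_sum_of_ne_finset_zero (L := SummationFilter.unconditional ℕ)
    (f := fun m => if m ≤ M then bm m else 0) (s := Finset.range (M+1))
    (fun b hb => by rw [if_neg]; simp at hb; omega)
  rw [← h4.unique h2]
  refine Finset.sum_congr rfl fun m hm => ?_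
  rw [if_pos]; simp at hm; omega

lemma bm_pow {d : ℝ} (hd : 0 < d) : ∃ S, HasSum (fun m => bm m * Real.exp (-d)^m) S ∧
    Real.exp (-d) * Real.log (riemannZeta (1+d:ℝ)).re ≤ S ∧ S ≤ Real.log (riemannZeta (1+d:ℝ)).re := by
  have h := (logzeta (s := 1+d) (by linarith)).1
  set Z := Real.log (riemannZeta (1+d:ℝ)).re
  have h' : HasSum (fun n : ℕ => cn n * Real.exp (-d * Real.log n)) Z := by
    refine h.congr_fun fun n => ?_
    rw [cn, mul_assoc, ← Real.exp_add]; congr 2; ring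
  have b1 : ∀ n : ℕ, cn n * Real.exp (-d)^(gg n) ≤ cn n * Real.exp (-d * Real.log n) := by
    intro n
    refine mul_le_mul_of_nonneg_left ?_ (cn_nonneg n)
    rw [← Real.exp_nat_mul, Real.exp_le_exp]
    have : Real.log n ≤ gg n := Nat.le_ceil _
    nlinarith
  have b2 : ∀ n : ℕ, Real.exp (-d) * (cn n * Real.exp (-d * Real.log n)) ≤ cn n * Real.exp (-d)^(gg n) := by
    intro n
    rw [mul_left_comm]
    refine mul_le_mul_of_nonneg_left ?_ (cn_nonneg n)
    rw [← Real.exp_nat_mul, ← Real.exp_add, Real.exp_le_exp]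
    have : (gg n : ℝ) < Real.log n + 1 := Nat.ceil_lt_add_one (log_nat_nonneg n)
    nlinarith
  have sm : Summable (fun n => cn n * Real.exp (-d)^(gg n)) :=
    Summable.of_nonneg_of_le (fun n => mul_nonneg (cn_nonneg n) (by positivity)) b1 h'.summable
  refine ⟨_, ?_, hasSum_le b2 (h'.mul_left _) sm.hasSum, hasSum_le b1 sm.hasSum h'⟩
  refine (sm.hasSum.tsum_fiberwise gg).congr_fun fun m => ?_
  rw [bm, ← tsum_mul_right]
  congr 1; ext ⟨b, hb⟩
  have : gg b = m := hb
  simp [this]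

lemma zeta_log_lim : Tendsto (fun d : ℝ => Real.log (riemannZeta (1+d:ℝ)).re + Real.log d) (𝓝[>] 0) (𝓝 0) := by
  have h1 : Tendsto (fun d : ℝ => ((1+d:ℝ):ℂ)) (𝓝[>] 0) (𝓝[≠] 1) := by
    refine tendsto_nhdsWithin_iff.2 ⟨?_, ?_⟩
    · have : ContinuousAt (fun d : ℝ => ((1+d:ℝ):ℂ)) 0 := by fun_prop
      have h := this.tendsto
      simp only [add_zero, Complex.ofReal_one] at h
      exact h.mono_left nhdsWithin_le_nhds
    · filter_upwards [self_mem_nhdsWithin] with d hd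
      have : (0:ℝ) < d := hd
      intro h
      have h2 : ((1+d:ℝ):ℂ) = 1 := h
      have : (1+d:ℝ) = 1 := by exact_mod_cast h2
      linarith
  have h2 := (Complex.continuous_re.tendsto _).comp (riemannZeta_residue_one.comp h1)
  have h3 := (Real.continuousAt_log (x := (1:ℂ).re) (by simp)).tendsto.comp h2
  simp only [Complex.one_re, Real.log_one] at h3
  refine h3.congr' ?_
  filter_upwards [self_mem_nhdsWithin] with d hd
  have hd' : (0:ℝ) < d := hd
  simp only [Function.comp]
  have e : (((1+d:ℝ):ℂ) - 1) * riemannZeta ((1+d:ℝ):ℂ) = (d:ℂ) * riemannZeta ((1+d:ℝ):ℂ) := by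
    push_cast; ring
  rw [e, Complex.re_ofReal_mul]
  rw [Real.log_mul hd'.ne' (logzeta (s := 1+d) (by linarith)).2.ne', add_comm]



lemma K_eq {K : ℝ} (hK : Tendsto HH atTop (𝓝 K)) : K + 1 = γ := by
  have hA := (AA_tendsto hK).comp (tendsto_natCast_atTop_atTop (R := ℝ))
  set f : ℕ → ℝ := fun m => bm m - 1/(m:ℝ) with hf
  have hH : ∀ M : ℕ, ∑ m ∈ Finset.range (M+1), 1/(m:ℝ) = (harmonic M : ℝ) := by
    intro M
    rw [Finset.sum_range_succ', harmonic]
    push_cast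
    simp
  have p1 : Tendsto (fun n => ∑ i ∈ Finset.range n, f i) atTop (𝓝 (K+1-γ)) := by
    rw [← tendsto_add_atTop_iff_nat 1]
    refine (hA.sub Real.tendsto_harmonic_sub_log).congr' ?_
    filter_upwards [eventually_gt_atTop 0] with M hM
    rw [hf, Finset.sum_sub_distrib, bm_sum M hM, hH]
    simp
  have p2 := Real.tendsto_tsum_powerSeries_nhdsWithin_lt p1
  have hx : Tendsto (fun d : ℝ => Real.exp (-d)) (𝓝[>] 0) (𝓝[<] 1) := by
    refine tendsto_nhdsWithin_iff.2 ⟨?_, ?_⟩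
    · have : ContinuousAt (fun d : ℝ => Real.exp (-d)) 0 := by fun_prop
      have h := this.tendsto
      simp only [neg_zero, Real.exp_zero] at h
      exact h.mono_left nhdsWithin_le_nhds
    · filter_upwards [self_mem_nhdsWithin] with d hd
      have : (0:ℝ) < d := hd
      simpa using this
  have p3 := p2.comp hx
  -- value
  have val : ∀ d : ℝ, 0 < d → ∃ S, (∑' n : ℕ, f n * Real.exp (-d)^n) = S + Real.log (1 - Real.exp (-d)) ∧
    Real.exp (-d) * Real.log (riemannZeta (1+d:ℝ)).re ≤ S ∧ S ≤ Real.log (riemannZeta (1+d:ℝ)).re := by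
    intro d hd
    obtain ⟨S, h1, h2, h3⟩ := bm_pow hd
    refine ⟨S, ?_, h2, h3⟩
    have h4 := Real.hasSum_pow_div_log_of_abs_lt_one (x := Real.exp (-d)) (by
      rw [abs_of_pos (Real.exp_pos _)]; simpa using hd)
    have h5 : HasSum (fun n : ℕ => 1/(n:ℝ) * Real.exp (-d)^n) (-Real.log (1 - Real.exp (-d))) := by
      rw [← hasSum_nat_add_iff' 1]
      simp only [Finset.range_one, Finset.sum_singleton, Nat.cast_zero, div_zero, zero_mul, sub_zero]
      refine h4.congr_fun fun n => ?_
      push_cast; ring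
    have h6 := (h1.sub h5).tsum_eq
    rw [sub_neg_eq_add] at h6
    rw [← h6]
    congr 1; ext n; rw [hf]; ring
  -- limits
  have l1 : Tendsto (fun d : ℝ => (1 - Real.exp (-d))/d) (𝓝[>] 0) (𝓝 1) := by
    have : HasDerivAt (fun d : ℝ => -Real.exp (-d)) 1 0 := by
      have := ((hasDerivAt_neg (0:ℝ)).exp).fun_neg
      simpa using this
    have h := this.tendsto_slope_zero_right
    refine h.congr' ?_
    filter_upwards with d
    simp; ring
  have l2 : Tendsto (fun d : ℝ => Real.log (1 - Real.exp (-d)) - Real.log d) (𝓝[>] 0) (𝓝 0) := by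
    have h := (Real.continuousAt_log (x := 1) one_ne_zero).tendsto.comp l1
    rw [Real.log_one] at h
    refine h.congr' ?_
    filter_upwards [self_mem_nhdsWithin] with d hd
    have hd' : (0:ℝ) < d := hd
    simp only [Function.comp]
    rw [Real.log_div _ hd'.ne']
    have : Real.exp (-d) < 1 := by simpa using hd'
    linarith
  have l3 := zeta_log_lim
  have l4 : Tendsto (fun d : ℝ => Real.log d * d) (𝓝[>] 0) (𝓝 0) := by
    simpa using tendsto_log_mul_rpow_nhdsGT_zero (r := 1) one_pos
  have ld : Tendsto (fun d : ℝ => d) (𝓝[>] 0) (𝓝 0) := tendsto_id.mono_left nhdsWithin_le_nhds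
  have l5 : Tendsto (fun d : ℝ => (1 - Real.exp (-d)) * Real.log (riemannZeta (1+d:ℝ)).re) (𝓝[>] 0) (𝓝 0) := by
    have h := (l1.mul ((ld.mul l3).sub l4))
    simp only [mul_zero, sub_zero] at h
    refine h.congr' ?_
    filter_upwards [self_mem_nhdsWithin] with d hd
    have hd' : (0:ℝ) < d := hd
    field_simp
    ring
  have up := l3.add l2
  have lo := up.sub l5
  rw [add_zero] at up
  rw [add_zero, sub_zero] at lo
  have p4 : Tendsto (fun d : ℝ => ∑' n : ℕ, f n * Real.exp (-d)^n) (𝓝[>] 0) (𝓝 0) := by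
    refine tendsto_of_tendsto_of_tendsto_of_le_of_le' lo up ?_ ?_
    · filter_upwards [self_mem_nhdsWithin] with d hd
      obtain ⟨S, h1, h2, h3⟩ := val d hd
      rw [h1]; linarith
    · filter_upwards [self_mem_nhdsWithin] with d hd
      obtain ⟨S, h1, h2, h3⟩ := val d hd
      rw [h1]; linarith
  have := tendsto_nhds_unique p3 p4
  linarith

lemma W_bound {u : ℝ} (hu : 0 < u) :
    ∑ n ∈ Finset.range (⌊Real.exp u⌋₊ + 1), Λ n * (Real.exp (-Real.log n)/Real.log n - Real.exp (-u)/u)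
    ≤ Real.log u - 1/u + γ + 2*(1/u+1/u^2)*ee u := by
  obtain ⟨K, hK, h1⟩ := HH_limit
  have h2 := K_eq hK
  rw [← W_eq hu, W_eq_HH hu]
  have h3 := (abs_le.1 (h1 u hu)).2
  have h4 := (abs_le.1 (dd_bound u hu)).2
  have h5 := mul_le_mul_of_nonneg_left h4 (by positivity : 0 ≤ 1/u+1/u^2)
  linarith



noncomputable def ww (L : ℝ) (n : ℕ) : ℝ := if n < ⌊Real.exp L⌋₊ + 1 then
  Λ n * (Real.exp (-Real.log n)/Real.log n - Real.exp (-L)/L) else 0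

lemma ww_nonneg {L : ℝ} (hL : 0 < L) (n : ℕ) : 0 ≤ ww L n := by
  rw [ww]
  split_ifs with h
  · have h0 := ArithmeticFunction.vonMangoldt_nonneg (n := n)
    rcases lt_or_ge n 2 with h2 | h2
    · have : Λ n = 0 := by interval_cases n <;> simp
      rw [this]; simp
    have h1 := log_le_of_mem hL (Finset.mem_range.2 h)
    have h3 : 0 < Real.log n := Real.log_pos (by exact_mod_cast h2)
    refine mul_nonneg h0 (sub_nonneg.2 ?_)
    gcongr
  · exact le_rfl

lemma ww_hasSum (L : ℝ) : HasSum (ww L) (∑ n ∈ Finset.range (⌊Real.exp L⌋₊ + 1),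
    Λ n * (Real.exp (-Real.log n)/Real.log n - Real.exp (-L)/L)) := by
  have : ∑ n ∈ Finset.range (⌊Real.exp L⌋₊ + 1),
    Λ n * (Real.exp (-Real.log n)/Real.log n - Real.exp (-L)/L) =
    ∑ n ∈ Finset.range (⌊Real.exp L⌋₊ + 1), ww L n := by
    refine Finset.sum_congr rfl fun n hn => ?_
    rw [ww, if_pos (Finset.mem_range.1 hn)]
  rw [this]
  refine hasSum_sum_of_ne_finset_zero fun n hn => ?_
  rw [ww, if_neg]; simpa using hn

lemma ww_pp {L : ℝ} (hL : 0 < L) (p : Nat.Primes) (k : ℕ) :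
    1/(((k:ℝ)+1)*(p:ℕ)^(k+1)) ≤ ww L ((p:ℕ)^(k+1)) + 1/((k:ℝ)+1) * min (Real.exp (-L)) (1/((p:ℕ):ℝ)^(k+1)) := by
  have hp0 : (0:ℝ) < (p:ℕ) := by exact_mod_cast p.2.pos
  have hlp : 0 < Real.log (p:ℕ) := Real.log_pos (by exact_mod_cast p.2.one_lt)
  rw [ww]
  split_ifs with h
  · have h1 := log_le_of_mem hL (Finset.mem_range.2 h)
    push_cast at h1
    rw [Real.log_pow] at h1
    have e : Λ ((p:ℕ)^(k+1)) * (Real.exp (-Real.log (((p:ℕ)^(k+1) : ℕ):ℝ))/Real.log (((p:ℕ)^(k+1) : ℕ):ℝ) - Real.exp (-L)/L) = 1/(((k:ℝ)+1)*(p:ℕ)^(k+1)) - Real.log (p:ℕ) * (Real.exp (-L)/L) := by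
      rw [ArithmeticFunction.vonMangoldt_apply_pow (by omega), ArithmeticFunction.vonMangoldt_apply_prime p.2]
      push_cast
      rw [Real.exp_neg, Real.exp_log (by positivity), Real.log_pow]
      push_cast
      field_simp
    rw [e]
    have h2 : Real.exp (-L) ≤ 1/((p:ℕ):ℝ)^(k+1) := by
      rw [Real.exp_neg, ← one_div]
      refine one_div_le_one_div_of_le (by positivity) ?_
      have := (Nat.le_floor_iff (Real.exp_pos L).le).1 (Nat.lt_succ_iff.1 h)
      exact_mod_cast this
    rw [min_eq_left h2]
    have : Real.log (p:ℕ) * (Real.exp (-L)/L) ≤ 1/((k:ℝ)+1) * Real.exp (-L) := by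
      rw [mul_div_assoc', div_le_iff₀ hL]
      have : Real.log (p:ℕ) ≤ 1/((k:ℝ)+1) * L := by
        rw [div_mul_eq_mul_div, le_div_iff₀ (by positivity)]
        push_cast at h1; linarith
      nlinarith [Real.exp_pos (-L)]
    linarith
  · have h2 : 1/((p:ℕ):ℝ)^(k+1) ≤ Real.exp (-L) := by
      rw [Real.exp_neg, ← one_div]
      refine one_div_le_one_div_of_le (by positivity) ?_
      have := (Nat.floor_lt (Real.exp_pos L).le).1 (Nat.lt_of_succ_le (not_lt.1 h))
      exact_mod_cast this.le
    rw [min_eq_right h2]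
    apply le_of_eq; field_simp; simp

lemma ww_p {L : ℝ} (hL : 0 < L) (p : Nat.Primes) :
    1/((p:ℕ):ℝ) - ww L (p:ℕ) ≤ Real.log (p:ℕ) * (Real.exp (-L)/L) := by
  have hp0 : (0:ℝ) < (p:ℕ) := by exact_mod_cast p.2.pos
  have hlp : 0 < Real.log (p:ℕ) := Real.log_pos (by exact_mod_cast p.2.one_lt)
  rw [ww]
  split_ifs with h
  · rw [ArithmeticFunction.vonMangoldt_apply_prime p.2, Real.exp_neg, Real.exp_log hp0]
    apply le_of_eq; field_simp; ring
  · have h1 := (Nat.floor_lt (Real.exp_pos L).le).1 (Nat.lt_of_succ_le (not_lt.1 h))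
    have h2 : L ≤ Real.log (p:ℕ) := (Real.le_log_iff_exp_le hp0).2 h1.le
    rw [sub_zero, Real.exp_neg]
    have := Real.exp_pos L
    rw [div_le_iff₀ hp0]
    have : 1 ≤ (Real.log (p:ℕ) / L) * ((p:ℕ) / Real.exp L) := by
      have a1 : 1 ≤ Real.log (p:ℕ) / L := (one_le_div hL).2 h2
      have a2 : 1 ≤ (p:ℕ) / Real.exp L := (one_le_div (by positivity)).2 h1.le
      nlinarith
    refine this.trans (le_of_eq ?_)
    field_simp

noncomputable def tau (L : ℝ) (n : ℕ) : ℝ := 1/2 * min (Real.exp (-L)) (1/(n:ℝ)^2) +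
  1/3 * min (Real.exp (-L)) (1/(n:ℝ)^3) + Real.exp (-L/2) * (1/4) * (1/(n:ℝ)^2/(1 - √(1/(n:ℝ))))

lemma min_le_gm {L : ℝ} {n k : ℕ} (hn : 0 < n) :
    min (Real.exp (-L)) (1/(n:ℝ)^k) ≤ Real.exp (-L/2) * √(1/(n:ℝ))^k := by
  have hn' : (0:ℝ) < n := by exact_mod_cast hn
  have e1 : Real.exp (-L) = Real.exp (-L/2)^2 := by rw [← Real.exp_nat_mul]; congr 1; push_cast; ring
  have e2 : 1/(n:ℝ)^k = (√(1/(n:ℝ))^k)^2 := by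
    rw [← pow_mul, mul_comm, pow_mul, Real.sq_sqrt (by positivity)]; simp
  rw [e1, e2]
  set a := Real.exp (-L/2)
  set b := √(1/(n:ℝ))^k
  have ha : 0 ≤ a := (Real.exp_pos _).le
  have hb : 0 ≤ b := by positivity
  rcases le_total a b with h | h
  · exact (min_le_left _ _).trans (by nlinarith)
  · exact (min_le_right _ _).trans (by nlinarith)

lemma logp_bound {L : ℝ} (hL : 0 < L) (p : Nat.Primes) {V : ℝ}
    (hV : HasSum (fun k : ℕ => ww L ((p:ℕ)^(k+1))) V) :
    -Real.log (1 - 1/((p:ℕ):ℝ)) ≤ Real.log (p:ℕ) * (Real.exp (-L)/L) + V + tau L p := by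
  have hp1 : (1:ℝ) < (p:ℕ) := by exact_mod_cast p.2.one_lt
  have hp0 : (0:ℝ) < (p:ℕ) := by linarith
  have hlt : 1/((p:ℕ):ℝ) < 1 := by rw [div_lt_one hp0]; exact hp1
  have h1 := Real.hasSum_pow_div_log_of_abs_lt_one (x := 1/((p:ℕ):ℝ)) (by
    rw [abs_of_pos (by positivity)]; exact hlt)
  set t := √(1/((p:ℕ):ℝ)) with ht
  have ht0 : 0 ≤ t := by positivity
  have ht1 : t < 1 := by rw [ht, Real.sqrt_lt' one_pos]; simpa using hlt
  have t4 : t^4 = 1/((p:ℕ):ℝ)^2 := by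
    rw [show t^4 = (t^2)^2 by ring, ht, Real.sq_sqrt (by positivity)]; simp
  set b : ℕ → ℝ := fun k => if k = 0 then Real.log (p:ℕ) * (Real.exp (-L)/L) else
    if k = 1 then 1/2 * min (Real.exp (-L)) (1/((p:ℕ):ℝ)^2) else
    if k = 2 then 1/3 * min (Real.exp (-L)) (1/((p:ℕ):ℝ)^3) else
    Real.exp (-L/2) * (1/4) * t^(k+1) with hb
  have h2 : HasSum b (Real.log (p:ℕ) * (Real.exp (-L)/L) + tau L p) := by
    rw [← hasSum_nat_add_iff' 3]
    have h3 := ((hasSum_geometric_of_lt_one ht0 ht1).mul_left (Real.exp (-L/2) * (1/4) * t^4))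
    have e2 : Real.log (p:ℕ) * (Real.exp (-L)/L) + tau L p - ∑ i ∈ Finset.range 3, b i =
        Real.exp (-L/2) * (1/4) * t^4 * (1-t)⁻¹ := by
      rw [Finset.sum_range_succ, Finset.sum_range_succ, Finset.sum_range_one]
      simp only [hb, if_true]
      rw [if_neg (by omega), if_neg (by omega), if_neg (by omega), t4, tau, ← ht]
      ring
    rw [e2]
    refine h3.congr_fun fun k => ?_
    simp only [hb]
    rw [if_neg (by omega), if_neg (by omega), if_neg (by omega)]
    ring
  have h4 := hasSum_le (fun k => ?_) h1 (hV.add h2)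
  · linarith
  have hw := ww_pp hL p k
  have e : (1/((p:ℕ):ℝ))^(k+1)/((k:ℝ)+1) = 1/(((k:ℝ)+1)*(p:ℕ)^(k+1)) := by
    rw [div_pow, one_pow, div_div, mul_comm]
  rw [e]
  rcases Nat.lt_or_ge k 3 with h | h
  · interval_cases k
    · have := ww_p hL p
      simp only [hb, if_true]
      simp only [zero_add, pow_one, Nat.cast_zero, one_mul] 
      linarith
    · simp only [hb]
      norm_num at hw ⊢
      linarith
    · simp only [hb]
      norm_num at hw ⊢
      linarith
  · simp only [hb]
    rw [if_neg (by omega), if_neg (by omega), if_neg (by omega)]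
    refine hw.trans (add_le_add le_rfl ?_)
    have m1 := min_le_gm (L := L) (n := p) (k := k+1) p.2.pos
    have m2 : 1/((k:ℝ)+1) ≤ 1/4 := by
      refine one_div_le_one_div_of_le (by norm_num) ?_
      have : (3:ℝ) ≤ k := by exact_mod_cast h
      linarith
    calc _ ≤ 1/4 * (Real.exp (-L/2) * t^(k+1)) := by
          refine mul_le_mul m2 m1 (le_min (Real.exp_pos _).le (by positivity)) (by norm_num)
      _ = _ := by ring

lemma sum_bound {L : ℝ} (hL : 0 < L) (S : Finset Nat.Primes)
    (hS : ∑ p ∈ S, Real.log (p:ℕ) ≤ Real.exp L) :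
    ∑ p ∈ S, -Real.log (1 - 1/((p:ℕ):ℝ)) ≤ Real.log L + γ + 2*(1/L+1/L^2)*ee L + ∑ p ∈ S, tau L p := by
  have h1 := (pp_hasSum (fun n hn => by
    rw [ww, ArithmeticFunction.vonMangoldt_eq_zero_iff.2 hn]; simp)).2 (ww_hasSum L)
  have hs : ∀ p : Nat.Primes, HasSum (fun k : ℕ => ww L ((p:ℕ)^(k+1))) (∑' k : ℕ, ww L ((p:ℕ)^(k+1))) :=
    fun p => (h1.summable.prod_factor p).hasSum
  have h2 := h1.prod_fiberwise hs
  have h3 : ∑ p ∈ S, (∑' k : ℕ, ww L ((p:ℕ)^(k+1))) ≤ _ :=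
    sum_le_hasSum S (fun p _ => tsum_nonneg fun k => ww_nonneg hL _) h2
  have h4 := W_bound hL
  have h5 : ∑ p ∈ S, -Real.log (1 - 1/((p:ℕ):ℝ)) ≤
    ∑ p ∈ S, (Real.log (p:ℕ) * (Real.exp (-L)/L) + (∑' k : ℕ, ww L ((p:ℕ)^(k+1))) + tau L p) :=
    Finset.sum_le_sum fun p _ => logp_bound hL p (hs p)
  rw [Finset.sum_add_distrib, Finset.sum_add_distrib, ← Finset.sum_mul] at h5
  have h6 : (∑ p ∈ S, Real.log (p:ℕ)) * (Real.exp (-L)/L) ≤ 1/L := by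
    calc _ ≤ Real.exp L * (Real.exp (-L)/L) := by gcongr
      _ = (Real.exp L * Real.exp (-L))/L := by ring
      _ = _ := by rw [← Real.exp_add]; simp
  linarith



lemma en {y : ℝ} (hy : 0 ≤ y) (n m : ℕ) (hm : m ≠ 0) (h : 1 ≤ y^m * 2.718281828^n) :
    Real.exp (-((n:ℝ)/m)) ≤ y := by
  refine le_of_pow_le_pow_left₀ hm hy ?_
  have hm' : (m:ℝ) ≠ 0 := by exact_mod_cast hm
  rw [← Real.exp_nat_mul]
  have e : (m:ℝ) * (-((n:ℝ)/m)) = -((n:ℕ) * 1 : ℝ) := by field_simp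
  rw [e, Real.exp_neg, Real.exp_nat_mul, inv_le_iff_one_le_mul₀ (by positivity)]
  refine h.trans ?_
  gcongr
  linarith [Real.exp_one_gt_d9]

lemma tele {G F : ℕ → ℝ} (hG : ∀ n, 0 ≤ G n) {B : ℝ} (h : ∀ m, G (2*m+3) ≤ F (m+1) - F m)
    (hB : ∀ m, F m ≤ B) (S : Finset Nat.Primes) : ∑ p ∈ S, G p ≤ G 2 + B - F 0 := by
  classical
  set S' := S.image (fun p : Nat.Primes => (p:ℕ)) with hS'
  have e : ∑ p ∈ S, G p = ∑ n ∈ S', G n := by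
    rw [hS', Finset.sum_image]
    intro a _ b _ hab
    exact Subtype.ext hab
  set N := S'.sup id
  have hsub : S' ⊆ insert 2 ((Finset.range N).image (fun m => 2*m+3)) := by
    intro n hn
    have hp : n.Prime := by
      obtain ⟨p, _, rfl⟩ := Finset.mem_image.1 hn
      exact p.2
    have hN : n ≤ N := Finset.le_sup (f := id) hn
    rcases hp.eq_two_or_odd with h2 | h2
    · simp [h2]
    · have := hp.two_le
      refine Finset.mem_insert_of_mem (Finset.mem_image.2 ⟨(n-3)/2, ?_, ?_⟩)
      · simp; omega
      · omega
  rw [e]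
  refine (Finset.sum_le_sum_of_subset_of_nonneg hsub fun n _ _ => hG n).trans ?_
  rw [Finset.sum_insert (by simp), Finset.sum_image (by intro a _ b _ hab; simpa using hab)]
  have : ∑ m ∈ Finset.range N, G (2*m+3) ≤ ∑ m ∈ Finset.range N, (F (m+1) - F m) :=
    Finset.sum_le_sum fun m _ => h m
  rw [Finset.sum_range_sub] at this
  linarith [hB N]

noncomputable def Ph2 (r s : ℝ) : ℝ := if s ≤ r then s/r^2 else 2/r - 1/s
noncomputable def Ph3 (r s : ℝ) : ℝ := if s ≤ r then s/r^3 else 3/(2*r^2) - 1/(2*s^2)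

lemma Ph2_le {r s : ℝ} (hr : 0 < r) (hs : 0 < s) : Ph2 r s ≤ 2/r := by
  rw [Ph2]; split_ifs with h
  · rw [div_le_div_iff₀ (by positivity) hr]; nlinarith [mul_pos hr hr, mul_le_mul_of_nonneg_right h hr.le]
  · have : 0 < 1/s := by positivity
    linarith

lemma Ph3_le {r s : ℝ} (hr : 0 < r) (hs : 0 < s) : Ph3 r s ≤ 3/(2*r^2) := by
  rw [Ph3]; split_ifs with h
  · calc s/r^3 ≤ r/r^3 := by gcongr
      _ = 2/(2*r^2) := by field_simp
      _ ≤ _ := by gcongr; norm_num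
  · have : 0 < 1/(2*s^2) := by positivity
    linarith

lemma Ph2_step {r s : ℝ} (hr : 0 < r) (hs : 3 ≤ s) :
    2 * min (1/r^2) (1/s^2) ≤ Ph2 r s - Ph2 r (s-2) := by
  have h0 : 0 < s := by linarith
  have h2 : 0 < s - 2 := by linarith
  have mr := min_le_right (1/r^2) (1/s^2)
  rw [Ph2, Ph2]
  rcases le_or_gt s r with h | h
  · rw [if_pos h, if_pos (by linarith)]
    have e : s/r^2 - (s-2)/r^2 = 2 * (1/r^2) := by ring
    rw [e]; gcongr; exact min_le_left _ _
  · rw [if_neg (by linarith)]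
    split_ifs with h3
    · have a1 : (r - (s-2))*(1/s^2) ≤ (r-(s-2))*(1/r^2) := by
        refine mul_le_mul_of_nonneg_left ?_ (by linarith)
        gcongr
      have a2 : (s-r)*(1/s^2) ≤ 1/r - 1/s := by
        rw [div_sub_div _ _ hr.ne' h0.ne', mul_one_div, div_le_div_iff₀ (by positivity) (by positivity)]
        have : 0 ≤ (s-r)*s*(s-r) := by have : 0 ≤ s - r := by linarith
                                       positivity
        nlinarith
      have e : 2/r - 1/s - (s-2)/r^2 = (r-(s-2))*(1/r^2) + (1/r - 1/s) := by field_simp; ring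
      rw [e]; linarith
    · have e : 2/r - 1/s - (2/r - 1/(s-2)) = 2/(s*(s-2)) := by field_simp; ring
      rw [e]
      have : 2 * (1/s^2) ≤ 2/(s*(s-2)) := by
        rw [mul_one_div]; gcongr; nlinarith
      linarith

lemma Ph3_step {r s : ℝ} (hr : 0 < r) (hs : 3 ≤ s) :
    2 * min (1/r^3) (1/s^3) ≤ Ph3 r s - Ph3 r (s-2) := by
  have h0 : 0 < s := by linarith
  have h2 : 0 < s - 2 := by linarith
  have mr := min_le_right (1/r^3) (1/s^3)
  rw [Ph3, Ph3]
  rcases le_or_gt s r with h | h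
  · rw [if_pos h, if_pos (by linarith)]
    have e : s/r^3 - (s-2)/r^3 = 2 * (1/r^3) := by ring
    rw [e]; gcongr; exact min_le_left _ _
  · rw [if_neg (by linarith)]
    split_ifs with h3
    · have a1 : (r - (s-2))*(1/s^3) ≤ (r-(s-2))*(1/r^3) := by
        refine mul_le_mul_of_nonneg_left ?_ (by linarith)
        gcongr
      have a2 : (s-r)*(1/s^3) ≤ 1/(2*r^2) - 1/(2*s^2) := by
        have e : 1/(2*r^2) - 1/(2*s^2) = (s-r)*((s+r)/(2*r^2*s^2)) := by field_simp; ring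
        rw [e]
        refine mul_le_mul_of_nonneg_left ?_ (by linarith)
        rw [div_le_div_iff₀ (by positivity) (by positivity)]
        have : 0 ≤ s^2 * (s*(s+r) - 2*r^2) := by
          have : 0 ≤ s*(s+r) - 2*r^2 := by nlinarith
          positivity
        nlinarith
      have e : 3/(2*r^2) - 1/(2*s^2) - (s-2)/r^3 = (r-(s-2))*(1/r^3) + (1/(2*r^2) - 1/(2*s^2)) := by field_simp; ring
      rw [e]; linarith
    · have e : 3/(2*r^2) - 1/(2*s^2) - (3/(2*r^2) - 1/(2*(s-2)^2)) = 2*((s-1)/(s^2*(s-2)^2)) := by field_simp; ring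
      rw [e]
      have : 1/s^3 ≤ (s-1)/(s^2*(s-2)^2) := by
        rw [div_le_div_iff₀ (by positivity) (by positivity)]
        have : (s-2)^2 ≤ s*(s-1) := by nlinarith
        nlinarith [mul_le_mul_of_nonneg_left this (by positivity : 0 ≤ s^2)]
      linarith

lemma tau_nonneg (L : ℝ) (n : ℕ) : 0 ≤ tau L n := by
  have h1 : 0 ≤ 1 - √(1/(n:ℝ)) := by
    rw [sub_nonneg, Real.sqrt_le_left one_pos.le, one_pow]
    rcases Nat.eq_zero_or_pos n with rfl | h
    · simp
    · rw [div_le_one (by exact_mod_cast h)]; exact_mod_cast h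
  have h2 : ∀ k, 0 ≤ min (Real.exp (-L)) (1/(n:ℝ)^k) := fun k => le_min (Real.exp_pos _).le (by positivity)
  have := h2 2
  have := h2 3
  rw [tau]; positivity

lemma tau_sum {L : ℝ} (hL : 8 ≤ L) (S : Finset Nat.Primes) :
    ∑ p ∈ S, tau L p ≤ 0.94 * Real.exp (-L/2) := by
  set r := Real.exp (L/2) with hr
  set r3 := Real.exp (L/3) with hr3
  have hr0 : 0 < r := Real.exp_pos _
  have hr30 : 0 < r3 := Real.exp_pos _
  have x2 : Real.exp (-L) = 1/r^2 := by
    rw [hr, ← Real.exp_nat_mul, one_div, ← Real.exp_neg]; congr 1; push_cast; ring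
  have x3 : Real.exp (-L) = 1/r3^3 := by
    rw [hr3, ← Real.exp_nat_mul, one_div, ← Real.exp_neg]; congr 1; push_cast; ring
  have x1 : Real.exp (-L/2) = 1/r := by
    rw [hr, one_div, ← Real.exp_neg]; congr 1; ring
  set F : ℕ → ℝ := fun m => 1/4 * Ph2 r (2*m+1) + 1/6 * Ph3 r3 (2*m+1) - Real.exp (-L/2) * (1/4) * 2.367 * (1/2) * (1/(2*m+2)) with hF
  have h := tele (G := tau L) (F := F) (B := 1/4 * (2/r) + 1/6 * (3/(2*r3^2))) (tau_nonneg L) ?_ ?_ S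
  · refine h.trans ?_
    have f0 : F 0 = 1/4 * Real.exp (-L) + 1/6 * Real.exp (-L) - Real.exp (-L/2) * (1/4) * 2.367 * (1/4) := by
      simp only [hF]
      have a1 : (1:ℝ) ≤ r := Real.one_le_exp (by linarith)
      have a2 : (1:ℝ) ≤ r3 := Real.one_le_exp (by linarith)
      rw [Ph2, Ph3, if_pos (by simpa using a1), if_pos (by simpa using a2)]
      nth_rewrite 1 [x2]
      rw [x3]
      push_cast; ring
    have g2 : tau L 2 ≤ 1/2 * Real.exp (-L) + 1/3 * Real.exp (-L) + Real.exp (-L/2) * (1/4) * (0.25 * 3.42) := by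
      rw [tau]
      have s1 : √(1/((2:ℕ):ℝ)) ≤ 0.7072 := by
        rw [Real.sqrt_le_left (by norm_num)]; norm_num
      have s2 : 1/((2:ℕ):ℝ)^2/(1 - √(1/((2:ℕ):ℝ))) ≤ 0.25*3.42 := by
        rw [div_le_iff₀ (by linarith)]; norm_num at s1 ⊢; linarith
      gcongr
      · exact min_le_left _ _
      · exact min_le_left _ _
    have y1 : Real.exp (-L) ≤ 0.0184 * Real.exp (-L/2) := by
      have : Real.exp (-L) = Real.exp (-L/2) * Real.exp (-L/2) := by rw [← Real.exp_add]; congr 1; ring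
      rw [this]
      gcongr
      refine le_trans (Real.exp_le_exp.2 ?_) (en (n := 4) (m := 1) (by norm_num) one_ne_zero (by norm_num))
      push_cast; linarith
    have y2 : 3/(2*r3^2) ≤ 1.5 * 0.264 * Real.exp (-L/2) := by
      have : 3/(2*r3^2) = 1.5 * (Real.exp (-L/6) * Real.exp (-L/2)) := by
        rw [hr3, ← Real.exp_add, ← Real.exp_nat_mul]
        have : -L/6 + -L/2 = -(((2:ℕ):ℝ) * (L/3)) := by push_cast; ring
        rw [this, Real.exp_neg]; field_simp; norm_num
      rw [this, mul_assoc]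
      gcongr
      refine le_trans (Real.exp_le_exp.2 ?_) (en (n := 4) (m := 3) (by norm_num) (by norm_num) (by norm_num))
      push_cast; linarith
    rw [f0]
    have : 2/r = 2 * Real.exp (-L/2) := by rw [x1]; ring
    rw [this]
    have := Real.exp_pos (-L/2)
    linarith
  · intro m
    have hs : (3:ℝ) ≤ 2*(m:ℝ)+3 := by have : (0:ℝ) ≤ m := Nat.cast_nonneg m
                                      linarith
    have p2 := Ph2_step hr0 hs
    have p3 := Ph3_step hr30 hs
    simp only [hF]
    rw [tau]
    push_cast
    rw [← x2] at p2
    rw [← x3] at p3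
    have e1 : 2*(m:ℝ)+3-2 = 2*m+1 := by ring
    have e2 : 2*((m:ℝ)+1)+1 = 2*m+3 := by ring
    rw [e1] at p2 p3
    rw [e2]
    have s1 : √(1/(2*(m:ℝ)+3)) ≤ 0.5775 := by
      rw [Real.sqrt_le_left (by norm_num)]
      calc 1/(2*(m:ℝ)+3) ≤ 1/3 := by gcongr
        _ ≤ _ := by norm_num
    have s2 : 1/(2*(m:ℝ)+3)^2/(1 - √(1/(2*(m:ℝ)+3))) ≤ 2.367 * ((1/2) * (1/(2*m+2)) - (1/2) * (1/(2*(m+1)+2))) := by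
      have t1 : 1/(2*(m:ℝ)+3)^2 ≤ (1/2) * (1/(2*m+2)) - (1/2) * (1/(2*(m+1)+2)) := by
        have e : (1/2) * (1/(2*(m:ℝ)+2)) - (1/2) * (1/(2*(m+1)+2)) = 1/((2*m+2)*(2*m+4)) := by
          have : 2*((m:ℝ)+1)+2 = 2*m+4 := by ring
          rw [this]; field_simp; ring
        rw [e]
        gcongr
        nlinarith
      rw [div_le_iff₀ (by linarith)]
      set Y := (1/2) * (1/(2*(m:ℝ)+2)) - (1/2) * (1/(2*(m+1)+2))
      have hY : 0 ≤ Y := le_trans (by positivity) t1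
      nlinarith
    have s3 := mul_le_mul_of_nonneg_left s2 (by positivity : 0 ≤ Real.exp (-L/2) * (1/4))
    linarith
  · intro m
    have hs : (0:ℝ) < 2*(m:ℝ)+1 := by positivity
    simp only [hF]
    have p2 := Ph2_le hr0 hs
    have p3 := Ph3_le hr30 hs
    have : 0 ≤ Real.exp (-L/2) * (1/4) * 2.367 * (1/2) * (1/(2*m+2)) := by positivity
    linarith



lemma sq_exp_anti {a L : ℝ} (ha : 4 ≤ a) (hL : a ≤ L) : L^2 * Real.exp (-L/2) ≤ a^2 * Real.exp (-a/2) := by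
  have h1 : L/a ≤ Real.exp ((L-a)/4) := by
    have := Real.add_one_le_exp ((L-a)/4)
    refine le_trans ?_ this
    have h0 : 0 < a := by linarith
    rw [div_le_iff₀ h0]
    nlinarith
  have h2 : L ≤ a * Real.exp ((L-a)/4) := by
    rw [div_le_iff₀ (by linarith)] at h1; linarith
  have h3 : L^2 ≤ (a * Real.exp ((L-a)/4))^2 := by
    gcongr
    linarith
  calc L^2 * Real.exp (-L/2) ≤ (a * Real.exp ((L-a)/4))^2 * Real.exp (-L/2) := by gcongr
    _ = a^2 * (Real.exp ((L-a)/4)^2 * Real.exp (-L/2)) := by ring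
    _ = _ := by
      rw [← Real.exp_nat_mul, ← Real.exp_add]; congr 2; push_cast; ring

lemma final_piece {a b z L : ℝ} (ha : 8 ≤ a) (hL : a ≤ L) (hb : L ≤ b) (hz : Real.exp (-a/2) ≤ z)
    (h : 2*(b+1)*(1.9*z^2+0.0238*z+0.0238) + 0.94*(a^2*z) < 1.66) :
    2*(L+1)*ee L + 0.94*(L^2 * Real.exp (-L/2)) < 1.66 := by
  have h1 := sq_exp_anti (by linarith) hL
  have hz2 : Real.exp (-L/2) ≤ z := (Real.exp_le_exp.2 (by linarith)).trans hz
  have hz0 : 0 < z := (Real.exp_pos _).trans_le hz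
  have e1 : Real.exp (-L) = Real.exp (-L/2)^2 := by rw [← Real.exp_nat_mul]; congr 1; push_cast; ring
  have h2 : ee L ≤ 1.9*z^2+0.0238*z+0.0238 := by
    rw [ee, e1]
    have := min_le_left 0.0238 (0.61/L)
    gcongr
  have h3 : 2*(L+1)*ee L ≤ 2*(b+1)*(1.9*z^2+0.0238*z+0.0238) := by
    exact mul_le_mul (by linarith) h2 (ee_pos (by linarith)) (by linarith)
  have h4 : a^2 * Real.exp (-a/2) ≤ a^2*z := by gcongr
  linarith

lemma final_mul {L : ℝ} (hL : 8 ≤ L) : 2*(L+1)*ee L + 0.94*(L^2 * Real.exp (-L/2)) < 1.66 := by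
  rcases le_total L 9 with h9 | h9
  · refine final_piece (a := 8) (z := 0.01833) le_rfl hL h9 ?_ (by norm_num)
    have := en (y := 0.01833) (by norm_num) 4 1 one_ne_zero (by norm_num)
    norm_num at this ⊢; linarith
  rcases le_total L 12 with h12 | h12
  · refine final_piece (a := 9) (z := 0.0112) (by norm_num) h9 h12 ?_ (by norm_num)
    have := en (y := 0.0112) (by norm_num) 9 2 two_ne_zero (by norm_num)
    norm_num at this ⊢; linarith
  rcases le_total L 16 with h16 | h16
  · refine final_piece (a := 12) (z := 0.0025) (by norm_num) h12 h16 ?_ (by norm_num)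
    have := en (y := 0.0025) (by norm_num) 6 1 one_ne_zero (by norm_num)
    norm_num at this ⊢; linarith
  rcases le_total L 26 with h26 | h26
  · refine final_piece (a := 16) (z := 0.00034) (by norm_num) h16 h26 ?_ (by norm_num)
    have := en (y := 0.00034) (by norm_num) 8 1 one_ne_zero (by norm_num)
    norm_num at this ⊢; linarith
  have h1 := sq_exp_anti (a := 26) (by norm_num) h26
  have h2 : Real.exp (-(26:ℝ)/2) ≤ 0.000003 := by
    have := en (y := 0.000003) (by norm_num) 13 1 one_ne_zero (by norm_num)
    norm_num at this ⊢; linarith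
  have h0 : 0 < L := by linarith
  set z := Real.exp (-L/2) with hz
  have hz0 : 0 < z := Real.exp_pos _
  have hzs : z ≤ 0.000003 := (Real.exp_le_exp.2 (by linarith)).trans h2
  have e1 : Real.exp (-L) = z^2 := by rw [hz, ← Real.exp_nat_mul]; congr 1; push_cast; ring
  have h3 : ee L ≤ 1.9*z^2+0.0238*z+0.61/L := by
    rw [ee, e1]
    have := min_le_right 0.0238 (0.61/L)
    gcongr
  have h4 : 1.9*z^2+0.0238*z ≤ z := by nlinarith
  have h5 : 2*(L+1)*ee L ≤ 2*(L+1)*(z+0.61/L) := by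
    gcongr; linarith
  have h6 : 2*(L+1)*(z+0.61/L) = 2*((L+1)*z) + 1.22 + 1.22/L := by field_simp; ring
  have h7 : 1.22/L ≤ 0.05 := by rw [div_le_iff₀ h0]; linarith
  have h8 : (L+1)*z ≤ L^2*z := by gcongr; nlinarith
  have h9' : L^2*z ≤ 0.003 := by nlinarith
  linarith

lemma final_num {L : ℝ} (hL : 8 ≤ L) :
    2*(1/L+1/L^2)*ee L + 0.94*Real.exp (-L/2) < Real.log (1 + 1.683/L^2) := by
  have h0 : 0 < L := by linarith
  have h1 := Real.le_log_one_add_of_nonneg (x := 1.683/L^2) (by positivity)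
  refine lt_of_lt_of_le ?_ h1
  have h2 := final_mul hL
  have e : 2*(1/L+1/L^2)*ee L + 0.94*Real.exp (-L/2) = (2*(L+1)*ee L + 0.94*(L^2 * Real.exp (-L/2)))/L^2 := by
    field_simp
  rw [e, mul_div_assoc', div_lt_div_iff₀ (by positivity) (by positivity)]
  have h3 : 1.683/L^2 ≤ 0.0263 := by rw [div_le_iff₀ (by positivity)]; nlinarith
  have e2 : 2*1.683/L^2*L^2 = 3.366 := by field_simp; norm_num
  rw [e2]
  have hp : 0 ≤ 1.683/L^2 := by positivity
  nlinarith

lemma exp_gamma_le : Real.exp γ ≤ 1.7817 := by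
  refine (Real.exp_le_exp.2 gamma_le).trans ?_
  refine (Real.exp_bound' (n := 7) (by norm_num) (by norm_num) (by norm_num)).trans ?_
  norm_num [Finset.sum_range_succ, Nat.factorial]

lemma totient_of_sum {q : ℕ} (hq : 0 < q) {B : ℝ} (hB : 0 < B)
    (h : ∑ p ∈ q.primeFactors, -Real.log (1 - 1/(p:ℝ)) < Real.log B) : (q:ℝ)/B < (Nat.totient q : ℝ) := by
  have e : (Nat.totient q : ℝ) = q * ∏ p ∈ q.primeFactors, (1 - 1/(p:ℝ)) := by
    have := Nat.totient_eq_mul_prod_factors q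
    have h2 : ((Nat.totient q : ℚ) : ℝ) = ((q * ∏ p ∈ q.primeFactors, (1 - (p:ℚ)⁻¹) : ℚ) : ℝ) := by rw [this]
    push_cast at h2
    simpa using h2
  have hpos : ∀ p ∈ q.primeFactors, 0 < 1 - 1/(p:ℝ) := by
    intro p hp
    have : (1:ℝ) < p := by exact_mod_cast (Nat.prime_of_mem_primeFactors hp).one_lt
    rw [sub_pos, div_lt_one (by linarith)]; exact this
  rw [e, div_eq_mul_inv]
  have hq' : (0:ℝ) < q := by exact_mod_cast hq
  refine mul_lt_mul_of_pos_left ?_ hq'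
  rw [← Real.log_lt_log_iff (by positivity) (Finset.prod_pos hpos), Real.log_inv,
    Real.log_prod (fun p hp => (hpos p hp).ne')]
  rw [Finset.sum_neg_distrib] at h
  linarith

lemma sum_log_le {q : ℕ} (hq : 0 < q) : ∑ p ∈ q.primeFactors, Real.log p ≤ Real.log q := by
  rw [← Real.log_prod (fun p hp => by exact_mod_cast (Nat.prime_of_mem_primeFactors hp).ne_zero)]
  have h1 := Nat.le_of_dvd hq (Nat.prod_primeFactors_dvd q)
  have h2 : (0:ℝ) < ∏ p ∈ q.primeFactors, (p:ℝ) :=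
    Finset.prod_pos fun p hp => by exact_mod_cast (Nat.prime_of_mem_primeFactors hp).pos
  refine Real.log_le_log h2 ?_
  have h3 : ((∏ p ∈ q.primeFactors, p : ℕ) : ℝ) ≤ q := by exact_mod_cast h1
  rwa [Nat.cast_prod] at h3

lemma large_case {q : ℕ} (hq : 3 ≤ q) (hL : 8 ≤ Real.log (Real.log q)) :
    (q:ℝ)/(Real.exp γ * Real.log (Real.log q) + 3/Real.log (Real.log q)) < (Nat.totient q : ℝ) := by
  set L := Real.log (Real.log q) with hLdef
  have h0 : 0 < L := by linarith
  have hlq : 0 < Real.log q := Real.log_pos (by exact_mod_cast (by omega : 1 < q))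
  have hE : Real.exp L = Real.log q := by rw [hLdef, Real.exp_log hlq]
  refine totient_of_sum (by omega) (by positivity) ?_
  have e1 : ∀ f : ℕ → ℝ, ∑ p ∈ q.primeFactors.subtype Nat.Prime, f (p:ℕ) = ∑ p ∈ q.primeFactors, f p :=
    fun f => Finset.sum_subtype_of_mem f (fun p hp => Nat.prime_of_mem_primeFactors hp)
  have h1 := sum_bound h0 (q.primeFactors.subtype Nat.Prime) (by
    refine (e1 (fun p => Real.log p)).le.trans ?_
    rw [hE]; exact sum_log_le (by omega))
  have h2 := tau_sum hL (q.primeFactors.subtype Nat.Prime)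
  have h3 := final_num hL
  have e2 := e1 (fun p => -Real.log (1 - 1/(p:ℝ)))
  rw [← e2]
  refine lt_of_le_of_lt h1 ?_
  have h4 : Real.log (L * Real.exp γ * (1 + 1.683/L^2)) ≤ Real.log (Real.exp γ * L + 3/L) := by
    refine Real.log_le_log (by positivity) ?_
    have e3 : L * Real.exp γ * (1 + 1.683/L^2) = Real.exp γ * L + (1.683 * Real.exp γ)/L := by
      field_simp
    rw [e3]
    gcongr
    linarith [exp_gamma_le]
  rw [Real.log_mul (by positivity) (by positivity), Real.log_mul h0.ne' (by positivity), Real.log_exp] at h4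
  linarith



lemma gamma_ge : 0.573 ≤ γ := by
  have h1 := Real.eulerMascheroniSeq_lt_eulerMascheroniConstant 127
  rw [Real.eulerMascheroniSeq] at h1
  have h2 : (5.4253:ℚ) ≤ harmonic 127 := by
    norm_num [harmonic, Finset.sum_range_succ]
  have h3 : (5.4253:ℝ) ≤ (harmonic 127 : ℝ) := by
    have : ((5.4253:ℚ):ℝ) ≤ (harmonic 127 : ℝ) := by exact_mod_cast h2
    norm_num at this ⊢
    try linarith
  have h4 : Real.log (((127:ℕ):ℝ) + 1) = 7 * Real.log 2 := by
    have : ((127:ℕ):ℝ) + 1 = 2^7 := by norm_num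
    rw [this, Real.log_pow]; push_cast; ring
  rw [h4] at h1
  linarith [Real.log_two_lt_d9]

lemma exp_gamma_ge : 1.773 ≤ Real.exp γ := by
  refine le_trans ?_ (Real.exp_le_exp.2 gamma_ge)
  refine le_trans ?_ (Real.sum_le_exp_of_nonneg (by norm_num) 8)
  norm_num [Finset.sum_range_succ, Nat.factorial]

lemma ex0 {S A : Finset ℕ} {h : ℕ → ℝ} (hA : ∀ a ∈ A, 0 ≤ h a) (hS : ∀ p ∈ S, p ∉ A → h p ≤ 0) :
    ∑ p ∈ S, h p ≤ ∑ p ∈ A, h p := by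
  classical
  rw [← Finset.sum_filter_add_sum_filter_not S (· ∈ A)]
  have h1 : ∑ p ∈ S with p ∉ A, h p ≤ 0 := Finset.sum_nonpos fun p hp => by
    rw [Finset.mem_filter] at hp; exact hS p hp.1 hp.2
  have h2 : ∑ p ∈ S with p ∈ A, h p ≤ ∑ p ∈ A, h p := by
    refine Finset.sum_le_sum_of_subset_of_nonneg (fun p hp => (Finset.mem_filter.1 hp).2) fun a ha _ => hA a ha
  linarith

noncomputable def ff (n : ℕ) : ℝ := -Real.log (1 - 1/(n:ℝ))

lemma ff_anti {m n : ℕ} (hm : 2 ≤ m) (h : m ≤ n) : ff n ≤ ff m := by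
  have hm' : (2:ℝ) ≤ m := by exact_mod_cast hm
  have h' : (m:ℝ) ≤ n := by exact_mod_cast h
  rw [ff, ff, neg_le_neg_iff]
  refine Real.log_le_log ?_ ?_
  · rw [sub_pos, div_lt_one (by linarith)]; linarith
  · have := one_div_le_one_div_of_le (by linarith) h'
    linarith

lemma ff_pos {m : ℕ} (hm : 2 ≤ m) : 0 ≤ ff m := by
  have hm' : (2:ℝ) ≤ m := by exact_mod_cast hm
  rw [ff, Left.nonneg_neg_iff]
  refine Real.log_nonpos ?_ ?_
  · rw [sub_nonneg, div_le_one (by linarith)]; linarith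
  · have : 0 ≤ 1/(m:ℝ) := by positivity
    linarith

lemma ex1 {S A : Finset ℕ} {P : ℕ} (hP : 2 ≤ P) (hS2 : ∀ p ∈ S, 2 ≤ p) (hA2 : ∀ a ∈ A, 2 ≤ a)
    (hA : ∀ a ∈ A, a ≤ P) (hS : ∀ p ∈ S, p ∉ A → P ≤ p)
    (h : ∑ p ∈ S, Real.log p < ∑ p ∈ A, Real.log p + Real.log P) :
    ∑ p ∈ S, ff p ≤ ∑ p ∈ A, ff p := by
  have h1 := ex0 (S := S) (A := A) (h := fun p => Real.log P - Real.log p) (fun a ha => by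
      have := hA2 a ha
      exact sub_nonneg.2 (Real.log_le_log (by exact_mod_cast (by omega : 0 < a)) (by exact_mod_cast hA a ha)))
    (fun p hp hpA => sub_nonpos.2 (Real.log_le_log (by exact_mod_cast (by omega : 0 < P)) (by exact_mod_cast hS p hp hpA)))
  have h2 := ex0 (S := S) (A := A) (h := fun p => ff p - ff P) (fun a ha =>
      sub_nonneg.2 (ff_anti (hA2 a ha) (hA a ha)))
    (fun p hp hpA => sub_nonpos.2 (ff_anti hP (hS p hp hpA)))
  simp only [Finset.sum_sub_distrib, Finset.sum_const, nsmul_eq_mul] at h1 h2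
  have hlP : 0 < Real.log P := Real.log_pos (by exact_mod_cast (by omega : 1 < P))
  have h3 : (S.card:ℝ) < A.card + 1 := by
    have : (S.card:ℝ) * Real.log P < (A.card + 1) * Real.log P := by linarith
    exact lt_of_mul_lt_mul_right this hlP.le
  have h4 : (S.card:ℝ) ≤ A.card := by
    have : S.card < A.card + 1 := by exact_mod_cast h3
    exact_mod_cast Nat.lt_succ_iff.1 this
  have := mul_le_mul_of_nonneg_right h4 (ff_pos hP)
  linarith

def okp (P n : ℕ) : Bool := (Nat.ble 2 n && Nat.ble (n+1) P) && ((Nat.beq n 2 || Nat.beq n 3 || Nat.beq n 5 || Nat.beq n 7) ||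
  (Nat.beq (Nat.gcd n 5040) 1 && (Nat.ble n 53 || Nat.beq (Nat.gcd n 4274883284060025564298013753389399649690343788366813724672000000000000) 1)))

lemma okp_prime {P n : ℕ} (hn : n.Prime) (h : n < P) : okp P n = true := by
  have h53 : (4274883284060025564298013753389399649690343788366813724672000000000000:ℕ) = Nat.factorial 53 := by
    norm_num [Nat.factorial]
  have h7 : (5040:ℕ) = Nat.factorial 7 := by norm_num [Nat.factorial]
  rw [okp, h53, h7]
  have h2 := hn.two_le
  have c7 : (((n = 2 ∨ n = 3) ∨ n = 5) ∨ n = 7) ∨ Nat.gcd n (Nat.factorial 7) = 1 := by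
    rcases Nat.lt_or_ge 7 n with h | h
    · exact Or.inr ((Nat.Prime.coprime_iff_not_dvd hn).2 (by rw [hn.dvd_factorial]; omega))
    · left
      interval_cases n <;> first | omega | (exfalso; revert hn; norm_num)
  have c53 : n ≤ 53 ∨ Nat.gcd n (Nat.factorial 53) = 1 := by
    rw [or_iff_not_imp_left]; intro h
    exact (Nat.Prime.coprime_iff_not_dvd hn).2 (by rw [hn.dvd_factorial]; exact h)
  simp only [Bool.and_eq_true, Bool.or_eq_true, Nat.ble_eq, Nat.beq_eq]
  exact ⟨⟨h2, h⟩, by tauto⟩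

def pn (P k : ℕ) : ℕ → ℕ := Nat.rec (motive := fun _ => ℕ → ℕ)
  (fun n => cond (okp P n) n 1) (fun k ih n => ih n * ih (n + 2^k)) k
def pd (P k : ℕ) : ℕ → ℕ := Nat.rec (motive := fun _ => ℕ → ℕ)
  (fun n => cond (okp P n) (n-1) 1) (fun k ih n => ih n * ih (n + 2^k)) k

def okset (P k : ℕ) : Finset ℕ := (Finset.Ico 0 (2^k)).filter (fun n => okp P n = true)

lemma pn_eq' (P k : ℕ) : ∀ n, pn P k n = ∏ i ∈ Finset.Ico n (n+2^k), cond (okp P i) i 1 := by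
  induction k with
  | zero => intro n; simp [pn]
  | succ k ih =>
    intro n
    have : pn P (k+1) n = pn P k n * pn P k (n+2^k) := rfl
    rw [this, ih, ih, Finset.prod_Ico_consecutive _ (Nat.le_add_right _ _) (Nat.le_add_right _ _)]
    congr 2; ring

lemma pd_eq' (P k : ℕ) : ∀ n, pd P k n = ∏ i ∈ Finset.Ico n (n+2^k), cond (okp P i) (i-1) 1 := by
  induction k with
  | zero => intro n; simp [pd]
  | succ k ih =>
    intro n
    have : pd P (k+1) n = pd P k n * pd P k (n+2^k) := rfl
    rw [this, ih, ih, Finset.prod_Ico_consecutive _ (Nat.le_add_right _ _) (Nat.le_add_right _ _)]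
    congr 2; ring

lemma pn_eq (P k : ℕ) : pn P k 0 = ∏ i ∈ okset P k, i := by
  rw [pn_eq', okset, Finset.prod_filter, zero_add]
  refine Finset.prod_congr rfl fun i _ => ?_
  cases okp P i <;> simp

lemma pd_eq (P k : ℕ) : pd P k 0 = ∏ i ∈ okset P k, (i-1) := by
  rw [pd_eq', okset, Finset.prod_filter, zero_add]
  refine Finset.prod_congr rfl fun i _ => ?_
  cases okp P i <;> simp

lemma mem_okset {P k n : ℕ} (h : n ∈ okset P k) : 2 ≤ n ∧ n < P := by
  rw [okset, Finset.mem_filter, okp] at h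
  simp only [Bool.and_eq_true, Nat.ble_eq] at h
  exact ⟨h.2.1.1, h.2.1.2⟩

lemma sum_ff_okset (P k : ℕ) : ∑ p ∈ okset P k, ff p = Real.log ((pn P k 0 : ℝ)/(pd P k 0)) ∧
    0 < pn P k 0 ∧ 0 < pd P k 0 := by
  have p1 : 0 < pn P k 0 := by
    rw [pn_eq]; exact Finset.prod_pos fun i hi => by have := mem_okset hi; omega
  have p2 : 0 < pd P k 0 := by
    rw [pd_eq]; exact Finset.prod_pos fun i hi => by have := mem_okset hi; omega
  refine ⟨?_, p1, p2⟩
  have p1' : (0:ℝ) < pn P k 0 := by exact_mod_cast p1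
  have p2' : (0:ℝ) < pd P k 0 := by exact_mod_cast p2
  rw [Real.log_div p1'.ne' p2'.ne', pn_eq, pd_eq, Nat.cast_prod, Nat.cast_prod, Real.log_prod, Real.log_prod,
    ← Finset.sum_sub_distrib]
  · refine Finset.sum_congr rfl fun i hi => ?_
    have h2 : (2:ℝ) ≤ i := by exact_mod_cast (mem_okset hi).1
    have e : 1 - 1/(i:ℝ) = ((i-1:ℕ):ℝ)/i := by
      rw [Nat.cast_sub (by have := mem_okset hi; omega)]; field_simp; simp
    have : ((i-1:ℕ):ℝ) ≠ 0 := by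
      have := mem_okset hi
      exact_mod_cast (by omega : i - 1 ≠ 0)
    rw [ff, e, Real.log_div this (by linarith)]; ring
  · intro i hi; have := mem_okset hi
    exact_mod_cast (by omega : i - 1 ≠ 0)
  · intro i hi; have := mem_okset hi
    exact_mod_cast (by omega : i ≠ 0)

lemma exp_nat_le (n : ℕ) : Real.exp n ≤ (2718281829:ℝ)^n / 10^(9*n) := by
  have : Real.exp n = (Real.exp 1)^n := by rw [← Real.exp_nat_mul, mul_one]
  rw [this, pow_mul, ← div_pow]
  gcongr
  have := Real.exp_one_lt_d9
  norm_num; linarith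

lemma band_core {q P k n2 : ℕ} (hq : 3 ≤ q) (hP : 2 ≤ P) (hk : P ≤ 2^k)
    (h1 : 2718281829^n2 ≤ pn P k 0 * P * 10^(9*n2)) (hlog : Real.log q < n2) :
    ∑ p ∈ q.primeFactors, -Real.log (1 - 1/(p:ℝ)) ≤ Real.log ((pn P k 0 : ℝ)/(pd P k 0)) := by
  obtain ⟨e, p1, p2⟩ := sum_ff_okset P k
  rw [← e]
  refine ex1 hP (fun p hp => (Nat.prime_of_mem_primeFactors hp).two_le) (fun a ha => (mem_okset ha).1)
    (fun a ha => (mem_okset ha).2.le) (fun p hp hpA => ?_) ?_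
  · by_contra hlt
    push Not at hlt
    exact hpA (by
      rw [okset, Finset.mem_filter, Finset.mem_Ico]
      exact ⟨⟨by omega, by omega⟩, okp_prime (Nat.prime_of_mem_primeFactors hp) hlt⟩)
  · refine lt_of_le_of_lt (sum_log_le (by omega)) (hlog.trans_le ?_)
    have p1' : (0:ℝ) < pn P k 0 := by exact_mod_cast p1
    have hP' : (0:ℝ) < P := by exact_mod_cast (by omega : 0 < P)
    have e2 : ∑ p ∈ okset P k, Real.log p + Real.log P = Real.log (pn P k 0 * P) := by
      rw [Real.log_mul p1'.ne' hP'.ne', pn_eq, Nat.cast_prod, Real.log_prod]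
      intro i hi; have := mem_okset hi
      exact_mod_cast (by omega : i ≠ 0)
    rw [e2, Real.le_log_iff_exp_le (by positivity)]
    refine (exp_nat_le n2).trans ?_
    rw [div_le_iff₀ (by positivity)]
    exact_mod_cast h1

def chk (n P n2 a k : ℕ) : Bool := Nat.ble 2 P && (Nat.ble P (2^k) && (Nat.ble 190 a &&
  (Nat.ble (2718281829^n2) (pn P k 0 * P * 10^(9*n2)) && (Nat.ble (2718281829^a) (n^100 * 10^(9*a)) &&
  Nat.ble (pn P k 0 * (100000*a) + 1) (pd P k 0 * (1773*a^2+30000000))))))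

lemma band {q n P n2 a k : ℕ} (hq : 3 ≤ q) (h : chk n P n2 a k = true) (hn : (n:ℝ) ≤ Real.log q)
    (hn2 : Real.log q < n2) :
    (q:ℝ)/(Real.exp γ * Real.log (Real.log q) + 3/Real.log (Real.log q)) < (Nat.totient q : ℝ) := by
  simp only [chk, Bool.and_eq_true, Nat.ble_eq] at h
  obtain ⟨hP, hk, ha, h1, h2, h3⟩ := h
  have hb := band_core hq hP hk h1 hn2
  obtain ⟨_, p1, p2⟩ := sum_ff_okset P k
  have p1' : (0:ℝ) < pn P k 0 := by exact_mod_cast p1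
  have p2' : (0:ℝ) < pd P k 0 := by exact_mod_cast p2
  have ha' : (190:ℝ) ≤ a := by exact_mod_cast ha
  have hn0 : 0 < n := by
    rcases Nat.eq_zero_or_pos n with rfl | h
    · simp at h2
    · exact h
  have hn0' : (0:ℝ) < n := by exact_mod_cast hn0
  have hlq : 0 < Real.log q := by linarith
  have hy : (a:ℝ)/100 ≤ Real.log (Real.log q) := by
    refine le_trans ?_ (Real.log_le_log hn0' hn)
    have : (a:ℝ) ≤ Real.log ((n:ℝ)^100) := by
      rw [Real.le_log_iff_exp_le (by positivity)]
      refine (exp_nat_le a).trans ?_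
      rw [div_le_iff₀ (by positivity)]
      exact_mod_cast h2
    rw [Real.log_pow] at this
    push_cast at this
    linarith
  set L := Real.log (Real.log q)
  have hL0 : 0 < L := by linarith
  refine totient_of_sum (by omega) (by positivity) (lt_of_le_of_lt hb ?_)
  refine Real.log_lt_log (by positivity) ?_
  have h3' : (pn P k 0 : ℝ) * (100000*a) + 1 ≤ pd P k 0 * (1773*a^2+30000000) := by exact_mod_cast h3
  have m1 : (pn P k 0 : ℝ)/pd P k 0 < 1.773 * (a/100) + 3/(a/100) := by
    have e : 1.773 * ((a:ℝ)/100) + 3/(a/100) = (1773*a^2+30000000)/(100000*a) := by field_simp; ring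
    rw [e, div_lt_div_iff₀ p2' (by positivity)]
    linarith
  have hy1 : 1.9 ≤ (a:ℝ)/100 := by linarith
  set y := (a:ℝ)/100
  have hy0 : 0 < y := by linarith
  have m2 : 1.773 * y + 3/y ≤ 1.773 * L + 3/L := by
    have : 1.773 * L + 3/L - (1.773 * y + 3/y) = (L - y)*(1.773 - 3/(y*L)) := by field_simp; ring
    have h5 : 3/(y*L) ≤ 1.773 := by
      rw [div_le_iff₀ (by positivity)]; nlinarith
    nlinarith [mul_nonneg (sub_nonneg.2 hy) (sub_nonneg.2 h5)]
  have m3 : 1.773 * L ≤ Real.exp γ * L := mul_le_mul_of_nonneg_right exp_gamma_ge hL0.le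
  linarith

lemma small_case {q : ℕ} (hq : 3 ≤ q) (h7 : Real.log q < (7:ℕ)) :
    (q:ℝ)/(Real.exp γ * Real.log (Real.log q) + 3/Real.log (Real.log q)) < (Nat.totient q : ℝ) := by
  have hb := band_core (P := 11) (k := 4) hq (by norm_num) (by norm_num) (by decide +kernel) h7
  have e1 : pn 11 4 0 = 210 := by decide +kernel
  have e2 : pd 11 4 0 = 48 := by decide +kernel
  rw [e1, e2] at hb
  have hlq : 1 < Real.log q := by
    rw [Real.lt_log_iff_exp_lt (by exact_mod_cast (by omega : 0 < q))]
    have : (3:ℝ) ≤ q := by exact_mod_cast hq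
    linarith [Real.exp_one_lt_d9]
  have hL0 : 0 < Real.log (Real.log q) := Real.log_pos hlq
  set L := Real.log (Real.log q)
  refine totient_of_sum (by omega) (by positivity) (lt_of_le_of_lt hb ?_)
  refine Real.log_lt_log (by norm_num) ?_
  have m3 : 1.773 * L ≤ Real.exp γ * L := mul_le_mul_of_nonneg_right exp_gamma_ge hL0.le
  have m4 : (4.5:ℝ) ≤ 1.773 * L + 3/L := by
    have : 1.773 * L + 3/L = (1.773*L^2 + 3)/L := by field_simp
    rw [this, le_div_iff₀ hL0]
    nlinarith [sq_nonneg (L - 1.27)]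
  norm_num
  linarith

def chkL : ℕ → List (ℕ × ℕ × ℕ × ℕ) → Bool
  | n, [] => Nat.ble 2981 n
  | n, (P, n2, a, k) :: l => chk n P n2 a k && chkL n2 l

lemma ladder {q : ℕ} (hq : 3 ≤ q) (hlog : Real.log q < 2981) : ∀ (l : List (ℕ × ℕ × ℕ × ℕ)) (n : ℕ),
    chkL n l = true → (n:ℝ) ≤ Real.log q →
    (q:ℝ)/(Real.exp γ * Real.log (Real.log q) + 3/Real.log (Real.log q)) < (Nat.totient q : ℝ) := by
  intro l
  induction l with
  | nil =>
    intro n h hn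
    rw [chkL, Nat.ble_eq] at h
    have : (2981:ℝ) ≤ n := by exact_mod_cast h
    linarith
  | cons x l ih =>
    obtain ⟨P, n2, a, k⟩ := x
    intro n h hn
    rw [chkL, Bool.and_eq_true] at h
    rcases lt_or_ge (Real.log q) n2 with h2 | h2
    · exact band hq h.1 hn h2
    · exact ih n2 h.2 h2
def bandList : List (ℕ × ℕ × ℕ × ℕ) :=
  [(13, 10, 194, 4), (17, 13, 230, 5), (19, 16, 256, 5), (23, 19, 277, 5), (29, 22, 294, 5), (31, 26,
   309, 5), (37, 29, 325, 6), (41, 33, 336, 6), (43, 37, 349, 6), (53, 44, 361, 6), (61, 53, 378, 6),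
   (71, 61, 397, 7), (79, 70, 411, 7), (89, 79, 424, 7), (103, 92, 436, 7), (113, 107, 452, 7), (139,
   126, 467, 8), (163, 146, 483, 8), (191, 172, 498, 8), (223, 199, 514, 8), (251, 232, 529, 8), (283,
   271, 544, 9), (347, 317, 560, 9), (389, 364, 575, 9), (449, 425, 589, 9), (521, 493, 605, 10), (607,
   575, 620, 10), (691, 666, 635, 10), (811, 772, 650, 10), (937, 894, 664, 10), (1063, 1032, 679, 11),
   (1229, 1187, 693, 11), (1429, 1367, 707, 11), (1613, 1579, 722, 11), (1873, 1818, 736, 11), (2137,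
   2084, 750, 12), (2441, 2394, 764, 12), (2801, 2756, 778, 12), (3251, 3157, 792, 12)]

set_option maxRecDepth 100000 in
lemma bandList_ok : chkL 7 bandList = true := by decide +kernel

theorem totient_gt_explicit_lower_bound (q : ℕ) (hq : 3 ≤ q) :
    (q : ℝ) /
        (Real.exp Real.eulerMascheroniConstant * Real.log (Real.log q)
          + 3 / Real.log (Real.log q))
      < (Nat.totient q : ℝ) := by
  rcases lt_or_ge (Real.log q) ((7:ℕ):ℝ) with h7 | h7
  · exact small_case hq h7
  rcases lt_or_ge (Real.log q) 2981 with h | h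
  · exact ladder hq h _ _ bandList_ok h7
  · refine large_case hq ?_
    rw [Real.le_log_iff_exp_le (by linarith)]
    have := exp_nat_le 8
    norm_num at this
    linarith
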